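/- For every ε > 0 there is a constant C = C(ε) such that for all x ≥ 2 and all reals E, F satisfying x^{1/2} ≤ E ≤ x^{3/4} and x²/8 ≤ E²·F ≤ 8·x², one has M(E, F) ≤ C·x^{7/12+ε}, where M(E, F) = #{(e, f, n) ∈ ℕ³ : E/2 < e ≤ E, F/2 < f ≤ F, e²·f = n²+1}. -/

import Mathlib

/-- `M(E, F)`: the number of triples `(e, f, n)` of positive integers with
`E/2 < e ≤ E`, `F/2 < f ≤ F` and `e² f = n² + 1`. -/
noncomputable def MEF (E F : ℝ) : ℕ :=
  Nat.card {t : ℕ × ℕ × ℕ | 0 < t.1 ∧ 0 < t.2.1 ∧ 0 < t.2.2 ∧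
    E / 2 < (t.1 : ℝ) ∧ (t.1 : ℝ) ≤ E ∧
    F / 2 < (t.2.1 : ℝ) ∧ (t.2.1 : ℝ) ≤ F ∧
    t.1 ^ 2 * t.2.1 = t.2.2 ^ 2 + 1}



theorem det_expand {R ι κ : Type*} [CommRing R] [Fintype ι] [DecidableEq ι] [Fintype κ]
    (W : ι → κ → R) (c : κ → ι → R) :
    Matrix.det (Matrix.of fun i j => ∑ m, W i m * c m j) =
      ∑ r : ι → κ, (∏ j, c (r j) j) * Matrix.det (Matrix.of fun i j => W i (r j)) := by
  classical
  rw [← Matrix.det_transpose]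
  have h : (Matrix.of fun i j => ∑ m, W i m * c m j).transpose
      = fun j => ∑ m, c m j • (fun i => W i m) := by
    funext j i
    simp [Matrix.transpose_apply, Finset.sum_apply, mul_comm]
  rw [h]
  change Matrix.detRowAlternating.toMultilinearMap _ = _
  rw [MultilinearMap.map_sum]
  refine Finset.sum_congr rfl fun r _ => ?_
  rw [MultilinearMap.map_smul_univ, smul_eq_mul]
  congr 1
  rw [← Matrix.det_transpose]
  rfl

theorem det_of_not_injective {R ι κ : Type*} [CommRing R] [Fintype ι] [DecidableEq ι]
    (W : ι → κ → R) (r : ι → κ) (hr : ¬ Function.Injective r) :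
    Matrix.det (Matrix.of fun i j => W i (r j)) = 0 := by
  simp only [Function.Injective, not_forall] at hr
  obtain ⟨a, b, hab, hne⟩ := hr
  exact Matrix.det_zero_of_column_eq hne (fun k => by simp [hab])

theorem abs_det_le_cols {ι : Type*} [Fintype ι] [DecidableEq ι] (A : Matrix ι ι ℝ) (b : ι → ℝ)
    (h : ∀ i j, |A i j| ≤ b j) : |A.det| ≤ (Nat.factorial (Fintype.card ι)) * ∏ j, b j := by
  rw [Matrix.det_apply]
  calc |∑ σ : Equiv.Perm ι, Equiv.Perm.sign σ • ∏ i, A (σ i) i|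
      ≤ ∑ σ : Equiv.Perm ι, |Equiv.Perm.sign σ • ∏ i, A (σ i) i| := Finset.abs_sum_le_sum_abs _ _
    _ ≤ ∑ σ : Equiv.Perm ι, ∏ j, b j := by
        refine Finset.sum_le_sum fun σ _ => ?_
        have : |Equiv.Perm.sign σ • ∏ i, A (σ i) i| = |∏ i, A (σ i) i| := by
          rcases Int.units_eq_one_or (Equiv.Perm.sign σ) with h | h <;> simp [h]
        rw [this, Finset.abs_prod]
        exact Finset.prod_le_prod (fun _ _ => abs_nonneg _) (fun i _ => h _ _)
    _ = _ := by simp [Fintype.card_perm]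

theorem exists_orth {ι : Type*} [Fintype ι] [DecidableEq ι] [Nonempty ι] (S : Set (ι → ℤ)) (B : ℝ)
    (hB : 1 ≤ B) (hS : ∀ v ∈ S, ∀ i, |(v i : ℝ)| ≤ B)
    (hdet : ∀ g : ι → ι → ℤ, (∀ i, g i ∈ S) → Matrix.det (Matrix.of g) = 0) :
    ∃ t : ι → ℤ, t ≠ 0 ∧ (∀ i, |(t i : ℝ)| ≤ (Fintype.card ι * B) ^ (Fintype.card ι)) ∧
      ∀ v ∈ S, ∑ i, t i * v i = 0 := by
  classical
  have hn1 : (1 : ℝ) ≤ Fintype.card ι := by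
    exact_mod_cast Fintype.card_pos
  let c : (ι → ℤ) → (ι → ℚ) := fun v i => (v i : ℚ)
  obtain ⟨b, hbS, hspan, hli⟩ := exists_linearIndependent ℚ (c '' S)
  have : Finite b := hli.finite
  have : Fintype b := Fintype.ofFinite b
  have hcard : Fintype.card b ≤ Fintype.card ι := by
    have := hli.fintype_card_le_finrank
    simpa using this
  -- choose preimages
  have hpre : ∀ y : b, ∃ v ∈ S, c v = y := fun y => hbS y.2
  choose pre hpreS hpre using hpre
  have hlt : Fintype.card b < Fintype.card ι := by
    refine lt_of_le_of_ne hcard fun he => ?_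
    let e : ι ≃ b := Fintype.equivOfCardEq he.symm
    have h0 := hdet (fun i => pre (e i)) (fun i => hpreS _)
    have h1 : LinearIndependent ℚ (fun i : ι => ((e i : b) : ι → ℚ)) := hli.comp e e.injective
    have h2 : (Matrix.of fun i => ((e i : b) : ι → ℚ)).det ≠ 0 := by
      have : IsUnit (Matrix.of fun i => ((e i : b) : ι → ℚ)) := by
        rw [← Matrix.linearIndependent_rows_iff_isUnit]
        exact h1
      exact ((Matrix.isUnit_iff_isUnit_det _).1 this).ne_zero
    apply h2
    have h3 : (Matrix.of fun i => ((e i : b) : ι → ℚ)) =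
        (Int.castRingHom ℚ).mapMatrix (Matrix.of (fun i => pre (e i))) := by
      ext i j
      simp [← hpre, c]
    rw [h3, ← RingHom.map_det, h0, map_zero]
  have key : ∃ t : ι → ℤ, t ≠ 0 ∧ (∀ i, |(t i : ℝ)| ≤ (Fintype.card ι * B) ^ (Fintype.card ι)) ∧
      ∀ y : b, ∑ i, t i * pre y i = 0 := by
    have hbig : (1:ℝ) ≤ Fintype.card ι * B := by nlinarith
    rcases Nat.eq_zero_or_pos (Fintype.card b) with h0 | hpos
    · obtain ⟨i0⟩ := ‹Nonempty ι›
      refine ⟨Pi.single i0 1, by simp, fun i => ?_, fun y => ?_⟩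
      · refine le_trans ?_ (one_le_pow₀ hbig)
        by_cases h : i = i0
        · subst h; simp
        · simp [h]
      · exact absurd h0 (by have := Fintype.card_pos_iff.2 ⟨y⟩; omega)
    · let A : Matrix b ι ℤ := Matrix.of fun y i => pre y i
      let _ := Matrix.seminormedAddCommGroup (m := b) (n := ι) (α := ℤ)
      obtain ⟨t, ht0, htA, htn⟩ := Int.Matrix.exists_ne_zero_int_vec_norm_le A hlt hpos
      refine ⟨t, ht0, fun i => ?_, fun y => ?_⟩
      · have h1 : |(t i : ℝ)| ≤ ‖t‖ := by
          have := norm_le_pi_norm t i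
          rwa [Int.norm_eq_abs] at this
        refine h1.trans (htn.trans ?_)
        have hA : max 1 ‖A‖ ≤ B := by
          refine max_le hB ?_
          rw [Matrix.norm_le_iff (by linarith)]
          intro y i
          rw [Int.norm_eq_abs]
          exact hS _ (hpreS y) i
        have h2 : (Fintype.card ι * max 1 ‖A‖ : ℝ) ≤ Fintype.card ι * B := by gcongr
        have hd : (1:ℝ) ≤ (Fintype.card ι : ℝ) - Fintype.card b := by
          have : (Fintype.card b : ℝ) + 1 ≤ Fintype.card ι := by exact_mod_cast hlt
          linarith
        have he : (Fintype.card b : ℝ) / ((Fintype.card ι : ℝ) - Fintype.card b) ≤ Fintype.card ι := by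
          rw [div_le_iff₀ (by linarith)]
          have : (Fintype.card b : ℝ) ≤ Fintype.card ι := by exact_mod_cast hcard
          nlinarith
        calc _ ≤ (Fintype.card ι * B : ℝ) ^ ((Fintype.card b : ℝ) / ((Fintype.card ι : ℝ) - Fintype.card b)) := by
              apply Real.rpow_le_rpow (by positivity) h2
              apply div_nonneg (by positivity) (by linarith)
          _ ≤ (Fintype.card ι * B : ℝ) ^ (Fintype.card ι : ℝ) :=
              Real.rpow_le_rpow_of_exponent_le hbig he
          _ = _ := Real.rpow_natCast _ _
      · have := congrFun htA y
        simpa [Matrix.mulVec, dotProduct, A, mul_comm] using this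
  obtain ⟨t, ht0, htb, hty⟩ := key
  refine ⟨t, ht0, htb, fun v hv => ?_⟩
  let L : (ι → ℚ) →ₗ[ℚ] ℚ := ∑ i, (t i : ℚ) • LinearMap.proj i
  have hL : ∀ w : ι → ℚ, L w = ∑ i, (t i : ℚ) * w i := by
    intro w; simp [L, LinearMap.sum_apply]
  have hb : Submodule.span ℚ b ≤ LinearMap.ker L := by
    rw [Submodule.span_le]
    intro y hy
    have := hty ⟨y, hy⟩
    have h2 := hpre ⟨y, hy⟩
    simp only [SetLike.mem_coe, LinearMap.mem_ker, hL]
    have h3 : ∀ i, y i = (pre ⟨y, hy⟩ i : ℚ) := fun i => by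
      have := congrFun h2 i; exact this.symm
    simp only [h3]
    exact_mod_cast this
  have hv' : c v ∈ LinearMap.ker L := by
    apply hb; rw [hspan]; exact Submodule.subset_span ⟨v, hv, rfl⟩
  rw [LinearMap.mem_ker, hL] at hv'
  simp only [c] at hv'
  exact_mod_cast hv'

open Polynomial

theorem natDegree_det_le_of {n : Type*} [Fintype n] [DecidableEq n] (A : Matrix n n ℚ[X]) (K : ℕ)
    (h : ∀ i j, (A i j).natDegree ≤ K) : A.det.natDegree ≤ Fintype.card n * K := by
  rw [Matrix.det_apply]
  apply Polynomial.natDegree_sum_le_of_forall_le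
  intro σ _
  refine (Polynomial.natDegree_smul_le _ _).trans ?_
  refine (Polynomial.natDegree_prod_le _ _).trans ?_
  refine (Finset.sum_le_sum (fun i _ => h _ _)).trans ?_
  simp

theorem coeff_swap (p : ℚ[X][X]) (i j : ℕ) :
    ((Bivariate.swap p).coeff i).coeff j = (p.coeff j).coeff i := by
  induction p using Polynomial.induction_on' with
  | add p q hp hq => simp [hp, hq]
  | monomial n f =>
    induction f using Polynomial.induction_on' with
    | add p q hp hq =>
      rw [map_add (monomial n), map_add]
      simp only [coeff_add, hp, hq]
    | monomial m r =>
      rw [Bivariate.swap_monomial_monomial]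
      simp only [coeff_monomial]
      split_ifs <;> simp_all [coeff_monomial]

noncomputable def tdeg (G : ℚ[X][X]) : ℕ := (Bivariate.swap G).natDegree

theorem coeff_natDegree_le_tdeg (G : ℚ[X][X]) (j : ℕ) : (G.coeff j).natDegree ≤ tdeg G := by
  rw [Polynomial.natDegree_le_iff_coeff_eq_zero]
  intro N hN
  rw [← coeff_swap, Polynomial.coeff_eq_zero_of_natDegree_lt hN, coeff_zero]

theorem tdeg_le (G : ℚ[X][X]) (k : ℕ) (h : ∀ j, (G.coeff j).natDegree ≤ k) : tdeg G ≤ k := by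
  unfold tdeg
  rw [Polynomial.natDegree_le_iff_coeff_eq_zero]
  intro N hN
  ext j
  rw [coeff_swap, coeff_zero]
  exact Polynomial.coeff_eq_zero_of_natDegree_lt (lt_of_le_of_lt (h j) hN)

theorem tdeg_mul (G H : ℚ[X][X]) (hG : G ≠ 0) (hH : H ≠ 0) : tdeg (G * H) = tdeg G + tdeg H := by
  unfold tdeg
  rw [map_mul, natDegree_mul]
  · simpa using hG
  · simpa using hH

theorem cz_res_ne (G g : ℚ[X][X]) (hG : Irreducible G) (hdeg : 1 ≤ G.natDegree) (hnd : ¬ G ∣ g) :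
    resultant G g ≠ 0 := by
  have hg0 : g ≠ 0 := by rintro rfl; exact hnd (dvd_zero _)
  let K := FractionRing ℚ[X]
  let φ := algebraMap ℚ[X] K
  have hinj : Function.Injective φ := IsFractionRing.injective ℚ[X] K
  have hprim : G.IsPrimitive := hG.isPrimitive (by omega)
  have hirr : Irreducible (G.map φ) := (hprim.irreducible_iff_irreducible_map_fraction_map).1 hG
  intro h0
  have h1 : resultant (G.map φ) (g.map φ) = 0 := by
    rw [natDegree_map_eq_of_injective hinj, natDegree_map_eq_of_injective hinj, resultant_map_map, h0, map_zero]
  rw [resultant_eq_zero_iff] at h1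
  have h2 : G.map φ ∣ g.map φ := by
    by_contra h
    exact h1.2 ((hirr.coprime_iff_not_dvd).2 h)
  apply hnd
  exact hprim.dvd_of_fraction_map_dvd_fraction_map (K := K) h2

theorem cz (G g : ℚ[X][X]) (hG : Irreducible G) (hdeg : 1 ≤ G.natDegree) (hnd : ¬ G ∣ g)
    (m n K : ℕ) (hm : G.natDegree ≤ m) (hn : g.natDegree ≤ n)
    (hGK : ∀ j, (G.coeff j).natDegree ≤ K) (hgK : ∀ j, (g.coeff j).natDegree ≤ K)
    (A : Finset ℚ) (h : ∀ T ∈ A, ∃ U, G.evalEval T U = 0 ∧ g.evalEval T U = 0) :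
    A.card ≤ (m + n) * K := by
  have hne := cz_res_ne G g hG hdeg hnd
  have hd : (resultant G g).natDegree ≤ (m + n) * K := by
    refine (natDegree_det_le_of _ K ?_).trans ?_
    · intro i j
      simp only [sylvester, Matrix.of_apply]
      refine Fin.addCases (fun j => ?_) (fun j => ?_) j
      · simp only [Fin.addCases_left]; split_ifs <;> simp [hGK, hgK]
      · simp only [Fin.addCases_right]; split_ifs <;> simp [hGK, hgK]
    · simp only [Fintype.card_fin]
      gcongr
  refine le_trans ?_ hd
  refine (Finset.card_le_card ?_).trans ((Multiset.toFinset_card_le _).trans (card_roots' (resultant G g)))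
  intro T hT
  obtain ⟨U, h1, h2⟩ := h T hT
  rw [Multiset.mem_toFinset, mem_roots hne]
  obtain ⟨p, q, -, -, e⟩ := exists_mul_add_mul_eq_C_resultant G g le_rfl le_rfl (Or.inl (by omega))
  have := congrArg (evalEval T U) e
  simp [h1, h2] at this
  rw [evalEval_C] at this
  exact this.symm

theorem divisor_bound (ε : ℝ) (hε : 0 < ε) : ∃ C : ℝ, 0 < C ∧ ∀ n : ℕ, n ≠ 0 →
    (n.divisors.card : ℝ) ≤ C * (n : ℝ) ^ ε := by
  obtain ⟨C1, hC1, hC1b⟩ : ∃ C1 : ℝ, 1 ≤ C1 ∧ ∀ a : ℕ, ((a : ℝ) + 1) ≤ C1 * (2 : ℝ) ^ (a * ε) := by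
    refine ⟨max 1 (1 / (ε * Real.log 2)) + 1, by
      have := le_max_left 1 (1 / (ε * Real.log 2)); linarith, fun a => ?_⟩
    have hl : 0 < Real.log 2 := Real.log_pos (by norm_num)
    have h1 : (2:ℝ) ^ (a * ε) = Real.exp (Real.log 2 * (a * ε)) := by
      rw [Real.rpow_def_of_pos (by norm_num)]
    have h2 : Real.log 2 * (a * ε) + 1 ≤ (2:ℝ) ^ (a * ε) := by rw [h1]; exact Real.add_one_le_exp _
    have h3 : (1:ℝ) ≤ (2:ℝ)^(a*ε) := by
      apply Real.one_le_rpow (by norm_num); positivity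
    have h4 : (a:ℝ) ≤ 1 / (ε * Real.log 2) * (2:ℝ)^(a*ε) := by
      rw [div_mul_eq_mul_div, le_div_iff₀ (by positivity)]
      nlinarith
    have h5 := le_max_right 1 (1 / (ε * Real.log 2))
    nlinarith
  set P0 : ℕ := ⌈(2:ℝ) ^ (1/ε)⌉₊ with hP0
  refine ⟨C1 ^ P0, by positivity, fun n hn => ?_⟩
  rw [Nat.card_divisors hn]
  have hn' : (n : ℝ) ^ ε = ∏ p ∈ n.primeFactors, ((p : ℝ) ^ (n.factorization p * ε)) := by
    conv_lhs => rw [← Nat.factorization_prod_pow_eq_self hn]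
    rw [Finsupp.prod, Nat.support_factorization, Nat.cast_prod, ← Real.finset_prod_rpow]
    · refine Finset.prod_congr rfl fun p _ => ?_
      rw [Nat.cast_pow, ← Real.rpow_natCast, ← Real.rpow_mul (by positivity)]
    · intros; positivity
  have hbd : ∀ p ∈ n.primeFactors, ((n.factorization p : ℝ) + 1) ≤
      (if p < P0 then C1 else 1) * (p : ℝ) ^ (n.factorization p * ε) := by
    intro p hp
    have hpp := Nat.prime_of_mem_primeFactors hp
    have hp2 : (2:ℝ) ≤ p := by exact_mod_cast hpp.two_le
    split_ifs with hlt
    · refine (hC1b _).trans ?_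
      gcongr
    · rw [one_mul]
      have h1 : (2:ℝ) ^ (1/ε) ≤ p := (Nat.le_ceil _).trans (by exact_mod_cast not_lt.1 hlt)
      have h2 : (2:ℝ) ≤ (p:ℝ)^ε := by
        calc (2:ℝ) = ((2:ℝ) ^ (1/ε))^ε := by
              rw [← Real.rpow_mul (by norm_num)]; field_simp; simp
          _ ≤ _ := by gcongr
      have h3 : (p:ℝ) ^ (n.factorization p * ε) = ((p:ℝ)^ε) ^ (n.factorization p) := by
        rw [mul_comm, Real.rpow_mul (by positivity), Real.rpow_natCast]
      rw [h3]
      have h4 : ((n.factorization p : ℝ) + 1) ≤ 2 ^ (n.factorization p) := by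
        exact_mod_cast Nat.lt_two_pow_self
      exact h4.trans (by gcongr)
  push_cast
  calc ∏ p ∈ n.primeFactors, ((n.factorization p : ℝ) + 1)
      ≤ ∏ p ∈ n.primeFactors, ((if p < P0 then C1 else 1) * (p : ℝ) ^ (n.factorization p * ε)) :=
        Finset.prod_le_prod (fun _ _ => by positivity) hbd
    _ = (∏ p ∈ n.primeFactors, (if p < P0 then C1 else 1)) * (n:ℝ)^ε := by
        rw [Finset.prod_mul_distrib, hn']
    _ ≤ _ := by
        gcongr
        rw [← Finset.prod_filter, Finset.prod_const]
        apply pow_le_pow_right₀ hC1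
        calc _ ≤ (Finset.range P0).card := Finset.card_le_card (by
              intro p hp; simp at hp ⊢; exact hp.2)
          _ = P0 := by simp

open Polynomial

structure Pt where
  (p q r s : ℤ)

namespace Pt
noncomputable def T (z : Pt) : ℚ := z.p / z.q
noncomputable def U (z : Pt) : ℚ := z.r / z.s
def mon (k l : ℕ) (z : Pt) (x : Fin (k+1) × Fin (l+1)) : ℤ :=
  z.p^(x.1:ℕ)*z.q^(k-x.1)*(z.r^(x.2:ℕ)*z.s^(l-x.2))
end Pt

structure Good (Λ B : ℝ) (z : Pt) : Prop where
  q0 : z.q ≠ 0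
  s0 : z.s ≠ 0
  cpq : IsCoprime z.p z.q
  crs : IsCoprime z.r z.s
  hp : |(z.p:ℝ)| ≤ Λ
  hq : |(z.q:ℝ)| ≤ Λ
  hr : |(z.r:ℝ)| ≤ B
  hs : |(z.s:ℝ)| ≤ B

noncomputable def Gp (k l : ℕ) (g : Fin (k+1) × Fin (l+1) → ℤ) : ℚ[X][X] :=
  ∑ x : Fin (k+1) × Fin (l+1), monomial (x.2:ℕ) (monomial (x.1:ℕ) (g x : ℚ))

theorem Gp_coeff (k l g) (x : Fin (k+1) × Fin (l+1)) :
    ((Gp k l g).coeff x.2).coeff x.1 = g x := by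
  unfold Gp
  rw [finsetSum_coeff, finsetSum_coeff, Finset.sum_eq_single x]
  · simp
  · intro y _ hy
    rw [coeff_monomial]
    split_ifs with h
    · rw [coeff_monomial, if_neg]
      intro h'
      exact hy (Prod.ext (Fin.ext h') (Fin.ext h))
    · simp
  · simp

theorem Gp_natDegree (k l g) : (Gp k l g).natDegree ≤ l := by
  unfold Gp
  apply natDegree_sum_le_of_forall_le
  intro x _
  exact (natDegree_monomial_le _).trans (by omega)

theorem Gp_coeff_natDegree (k l g j) : ((Gp k l g).coeff j).natDegree ≤ k := by
  unfold Gp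
  rw [finsetSum_coeff]
  apply natDegree_sum_le_of_forall_le
  intro x _
  rw [coeff_monomial]
  split_ifs with h
  · exact (natDegree_monomial_le _).trans (by omega)
  · simp

theorem Gp_ne (k l g) (h : g ≠ 0) : Gp k l g ≠ 0 := by
  intro h0
  apply h
  funext x
  have := Gp_coeff k l g x
  rw [h0] at this
  simpa using this.symm

theorem evalEval_Gp (k l g) (T U : ℚ) :
    (Gp k l g).evalEval T U = ∑ x : Fin (k+1) × Fin (l+1), g x * (T^(x.1:ℕ) * U^(x.2:ℕ)) := by
  unfold Gp evalEval
  rw [eval_finsetSum, eval_finsetSum]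
  refine Finset.sum_congr rfl fun x _ => ?_
  rw [eval_monomial, eval_mul, eval_monomial, ← C_pow, eval_C]
  ring

theorem evalEval_eq (k l : ℕ) (G : ℚ[X][X]) (hl : G.natDegree ≤ l)
    (hk : ∀ j, (G.coeff j).natDegree ≤ k) (T U : ℚ) :
    G.evalEval T U = ∑ x : Fin (k+1) × Fin (l+1), (G.coeff x.2).coeff x.1 * (T^(x.1:ℕ) * U^(x.2:ℕ)) := by
  unfold evalEval
  rw [eval_eq_sum_range' (p := G) (n := l+1) (by omega), eval_finsetSum, Fintype.sum_prod_type_right,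
    Finset.sum_range]
  refine Finset.sum_congr rfl fun j _ => ?_
  rw [eval_mul, ← C_pow, eval_C, eval_eq_sum_range' (p := G.coeff j) (n := k+1) (by have := hk j; omega),
    Finset.sum_mul, Finset.sum_range]
  refine Finset.sum_congr rfl fun i _ => ?_
  ring

theorem mon_eq (k l : ℕ) (z : Pt) (hq : z.q ≠ 0) (hs : z.s ≠ 0) (x : Fin (k+1) × Fin (l+1)) :
    (z.mon k l x : ℚ) = z.q^k*z.s^l*(z.T^(x.1:ℕ) * z.U^(x.2:ℕ)) := by
  have hq' : (z.q:ℚ) ≠ 0 := by exact_mod_cast hq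
  have hs' : (z.s:ℚ) ≠ 0 := by exact_mod_cast hs
  unfold Pt.mon Pt.T Pt.U
  push_cast
  rw [div_pow, div_pow]
  have h1 : (z.q:ℚ)^k = z.q^(x.1:ℕ) * z.q^(k-x.1) := by rw [← pow_add]; congr 1; omega
  have h2 : (z.s:ℚ)^l = z.s^(x.2:ℕ) * z.s^(l-x.2) := by rw [← pow_add]; congr 1; omega
  rw [h1, h2]
  field_simp

theorem sum_mon (k l : ℕ) (z : Pt) (hq : z.q ≠ 0) (hs : z.s ≠ 0) (g : Fin (k+1) × Fin (l+1) → ℤ) :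
    ((∑ x, g x * z.mon k l x : ℤ) : ℚ) = z.q^k*z.s^l*(Gp k l g).evalEval z.T z.U := by
  rw [evalEval_Gp, Finset.mul_sum]
  push_cast
  refine Finset.sum_congr rfl fun x _ => ?_
  rw [mon_eq k l z hq hs]; ring

theorem mon_le (k l : ℕ) (z : Pt) (Λ B : ℝ) (h : Good Λ B z) (h1 : 1 ≤ Λ) (h2 : 1 ≤ B)
    (x : Fin (k+1) × Fin (l+1)) : |(z.mon k l x : ℝ)| ≤ Λ^k*B^l := by
  unfold Pt.mon
  push_cast
  rw [abs_mul, abs_mul, abs_mul, abs_pow, abs_pow, abs_pow, abs_pow]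
  have e1 : Λ^k = Λ^(x.1:ℕ) * Λ^(k-x.1) := by rw [← pow_add]; congr 1; omega
  have e2 : B^l = B^(x.2:ℕ) * B^(l-x.2) := by rw [← pow_add]; congr 1; omega
  rw [e1, e2]
  have := h.hp; have := h.hq; have := h.hr; have := h.hs
  gcongr

/-- orthogonal form gives an auxiliary polynomial -/
theorem aux_poly (k l : ℕ) (S : Finset Pt) (Λ B : ℝ) (hΛ : 1 ≤ Λ) (hB : 1 ≤ B)
    (hS : ∀ z ∈ S, Good Λ B z)
    (hdet : ∀ g : Fin (k+1) × Fin (l+1) → Pt, (∀ i, g i ∈ S) →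
      Matrix.det (Matrix.of fun i x => (g i).mon k l x) = 0) :
    ∃ g : Fin (k+1) × Fin (l+1) → ℤ, g ≠ 0 ∧
      (∀ x, |(g x : ℝ)| ≤ (((k+1)*(l+1):ℕ) * (Λ^k*B^l))^((k+1)*(l+1))) ∧
      ∀ z ∈ S, (Gp k l g).evalEval z.T z.U = 0 := by
  obtain ⟨t, h1, h2, h3⟩ := exists_orth (ι := Fin (k+1) × Fin (l+1))
    {v | ∃ z ∈ S, v = z.mon k l} (Λ^k*B^l) (one_le_mul_of_one_le_of_one_le (one_le_pow₀ hΛ) (one_le_pow₀ hB))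
    (by rintro v ⟨z, hz, rfl⟩ i; exact mon_le k l z Λ B (hS z hz) hΛ hB i)
    (by
      intro g hg
      choose f hf1 hf2 using hg
      rw [← hdet f hf1]
      congr 1
      ext i x
      simp [hf2])
  refine ⟨t, h1, by simpa using h2, fun z hz => ?_⟩
  have h4 := h3 _ ⟨z, hz, rfl⟩
  have hg := hS z hz
  have h5 := sum_mon k l z hg.q0 hg.s0 t
  rw [h4] at h5
  have hq' : (z.q:ℚ)^k ≠ 0 := pow_ne_zero _ (by exact_mod_cast hg.q0)
  have hs' : (z.s:ℚ)^l ≠ 0 := pow_ne_zero _ (by exact_mod_cast hg.s0)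
  simpa [hq', hs', hg.q0, hg.s0] using h5.symm

theorem intver (k l : ℕ) (S : Finset Pt) (Λ B : ℝ) (hΛ : 1 ≤ Λ) (hB : 1 ≤ B)
    (hS : ∀ z ∈ S, Good Λ B z) (hT : Set.InjOn Pt.T S)
    (G : ℚ[X][X]) (hG : Irreducible G) (hl0 : 1 ≤ l) (hl : G.natDegree = l) (hk : tdeg G = k)
    (hv : ∀ z ∈ S, G.evalEval z.T z.U = 0) :
    S.card ≤ (l + l) * k ∨
    ∃ g : Fin (k+1) × Fin (l+1) → ℤ,
      (∀ x, |(g x : ℝ)| ≤ (((k+1)*(l+1):ℕ) * (Λ^k*B^l))^((k+1)*(l+1))) ∧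
      Irreducible (Gp k l g) ∧ (Gp k l g).natDegree = l ∧ tdeg (Gp k l g) = k ∧
      ∀ z ∈ S, (Gp k l g).evalEval z.T z.U = 0 := by
  have hcd : ∀ j, (G.coeff j).natDegree ≤ k := fun j => hk ▸ coeff_natDegree_le_tdeg G j
  obtain ⟨g, h1, h2, h3⟩ := aux_poly k l S Λ B hΛ hB hS (by
    intro f hf
    set M : Matrix (Fin (k+1) × Fin (l+1)) (Fin (k+1) × Fin (l+1)) ℤ := Matrix.of fun i x => (f i).mon k l x with hM
    have : (M.map (Int.cast : ℤ → ℚ)).det = 0 := by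
      rw [← Matrix.exists_mulVec_eq_zero_iff]
      refine ⟨fun x => (G.coeff x.2).coeff x.1, ?_, ?_⟩
      · intro h0
        apply hG.ne_zero
        ext j i
        rw [coeff_zero, coeff_zero]
        by_cases hj : j ≤ l
        · by_cases hi : i ≤ k
          · exact congrFun h0 (⟨i, by omega⟩, ⟨j, by omega⟩)
          · exact coeff_eq_zero_of_natDegree_lt (lt_of_le_of_lt (hcd j) (by omega))
        · rw [coeff_eq_zero_of_natDegree_lt (n := j) (by omega), coeff_zero]
      · funext i
        simp only [Matrix.mulVec, dotProduct, hM, Matrix.map_apply, Matrix.of_apply, Pi.zero_apply]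
        have hg := hS _ (hf i)
        have h5 := hv _ (hf i)
        rw [evalEval_eq k l G hl.le hcd] at h5
        rw [← mul_zero (((f i).q:ℚ)^k * (f i).s^l), ← h5, Finset.mul_sum]
        refine Finset.sum_congr rfl fun x _ => ?_
        rw [mon_eq k l _ hg.q0 hg.s0]; ring
    rw [show M.map (Int.cast : ℤ → ℚ) = (Int.castRingHom ℚ).mapMatrix M from rfl, ← RingHom.map_det] at this
    simpa using this)
  by_cases hd : G ∣ Gp k l g
  · right
    obtain ⟨H, hH⟩ := hd
    have hne := Gp_ne k l g h1
    have hH0 : H ≠ 0 := by rintro rfl; simp at hH; exact hne hH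
    have e1 : (Gp k l g).natDegree = G.natDegree + H.natDegree := by
      rw [hH, natDegree_mul hG.ne_zero hH0]
    have e2 : tdeg (Gp k l g) = tdeg G + tdeg H := by rw [hH, tdeg_mul _ _ hG.ne_zero hH0]
    have e3 := Gp_natDegree k l g
    have e4 := tdeg_le _ k (Gp_coeff_natDegree k l g)
    have e5 : H.natDegree = 0 := by omega
    have e6 : (H.coeff 0).natDegree = 0 := by have := coeff_natDegree_le_tdeg H 0; omega
    have e7 : H = C (C ((H.coeff 0).coeff 0)) := by
      rw [← eq_C_of_natDegree_eq_zero e6, ← eq_C_of_natDegree_eq_zero e5]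
    have hu : IsUnit H := by
      rw [e7, isUnit_C, isUnit_C, isUnit_iff_ne_zero]
      intro h0; rw [h0] at e7; simp at e7; exact hH0 e7
    refine ⟨g, h2, ?_, by omega, by omega, h3⟩
    rw [hH]
    exact (irreducible_mul_isUnit hu).2 hG
  · left
    rw [← Finset.card_image_of_injOn hT]
    refine cz G (Gp k l g) hG (by omega) hd l l k hl.le (Gp_natDegree k l g) hcd (Gp_coeff_natDegree k l g) _ ?_
    intro T hT'
    obtain ⟨z, hz, rfl⟩ := Finset.mem_image.1 hT'
    exact ⟨z.U, hv z hz, h3 z hz⟩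

open Polynomial

theorem sum_distinct (n : ℕ) : ∀ s : Finset ℕ, s.card = n → ∑ i ∈ Finset.range n, i ≤ ∑ i ∈ s, i := by
  induction n with
  | zero => intro s _; simp
  | succ n ih =>
    intro s hs
    have hne : s.Nonempty := by rw [← Finset.card_pos]; omega
    have h1 := ih (s.erase (s.max' hne)) (by rw [Finset.card_erase_of_mem (s.max'_mem hne)]; omega)
    rw [Finset.sum_range_succ, ← Finset.sum_erase_add _ _ (s.max'_mem hne)]
    refine add_le_add h1 ?_
    have : s ⊆ Finset.range (s.max' hne + 1) := by
      intro x hx; rw [Finset.mem_range]; have := s.le_max' x hx; omega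
    have := Finset.card_le_card this
    rw [Finset.card_range] at this
    omega

section ev
variable {R : Type*} [CommRing R] (k l : ℕ) (g : Fin (k+1) × Fin (l+1) → ℤ)

def ev (t u : R) : R := ∑ x, (g x : R) * (t^(x.1:ℕ) * u^(x.2:ℕ))
def evU (t u : R) : R := ∑ x, (g x : R) * (t^(x.1:ℕ) * (((x.2:ℕ):R) * u^((x.2:ℕ)-1)))
def Dz (z : Pt) : ℤ := ∑ x, g x * (z.p^(x.1:ℕ)*z.q^(k-x.1) * (((x.2:ℕ):ℤ) * (z.r^((x.2:ℕ)-1)*z.s^(l+1-x.2))))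

theorem ev_taylor (t u h : R) : ∃ c, ev k l g t (u+h) = ev k l g t u + h * evU k l g t u + h^2*c := by
  refine ⟨∑ x, (g x : R) * (t^(x.1:ℕ) * (powAddExpansion u h (x.2:ℕ)).1), ?_⟩
  unfold ev evU
  rw [Finset.mul_sum, Finset.mul_sum, ← Finset.sum_add_distrib, ← Finset.sum_add_distrib]
  refine Finset.sum_congr rfl fun x _ => ?_
  linear_combination (g x : R) * t^(x.1:ℕ) * (powAddExpansion u h (x.2:ℕ)).2

theorem ev_map {R' : Type*} [CommRing R'] (f : R →+* R') (t u : R) :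
    f (ev k l g t u) = ev k l g (f t) (f u) := by
  simp [ev]
theorem evU_map {R' : Type*} [CommRing R'] (f : R →+* R') (t u : R) :
    f (evU k l g t u) = evU k l g (f t) (f u) := by
  simp [evU]

theorem mon_ring (z : Pt) (t u : R) (ht : t * z.q = z.p) (hu : u * z.s = z.r) (x : Fin (k+1) × Fin (l+1)) :
    (z.mon k l x : R) = z.q^k*z.s^l*(t^(x.1:ℕ) * u^(x.2:ℕ)) := by
  unfold Pt.mon
  push_cast
  rw [← ht, ← hu]
  have h1 : (z.q:R)^k = z.q^(x.1:ℕ) * z.q^(k-x.1) := by rw [← pow_add]; congr 1; omega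
  have h2 : (z.s:R)^l = z.s^(x.2:ℕ) * z.s^(l-x.2) := by rw [← pow_add]; congr 1; omega
  rw [h1, h2]
  ring

theorem Dz_ring (z : Pt) (t u : R) (ht : t * z.q = z.p) (hu : u * z.s = z.r) :
    (Dz k l g z : R) = z.q^k*z.s^l*evU k l g t u := by
  unfold Dz evU
  push_cast
  rw [Finset.mul_sum]
  refine Finset.sum_congr rfl fun x _ => ?_
  rcases Nat.eq_zero_or_pos (x.2:ℕ) with h0 | h0
  · simp [h0]
  rw [← ht, ← hu]
  have h1 : (z.q:R)^k = z.q^(x.1:ℕ) * z.q^(k-x.1) := by rw [← pow_add]; congr 1; omega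
  have h2 : (z.s:R)^l = z.s^((x.2:ℕ)-1) * z.s^(l+1-x.2) := by rw [← pow_add]; congr 1; omega
  rw [h1, h2]
  ring

theorem newton (π u0 γ : R) (Z : Set (R × R))
    (hZ : ∀ z ∈ Z, ev k l g z.1 z.2 = 0 ∧ π ∣ z.2 - u0 ∧ π ∣ 1 - γ * evU k l g z.1 z.2) (n : ℕ) :
    ∃ f : R[X], ∀ z ∈ Z, π^(n+1) ∣ z.2 - f.eval z.1 := by
  induction n with
  | zero => exact ⟨C u0, fun z hz => by simpa using (hZ z hz).2.1⟩
  | succ n ih =>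
    obtain ⟨f, hf⟩ := ih
    refine ⟨f - C γ * ev k l g X f, fun z hz => ?_⟩
    obtain ⟨h1, h2, h3⟩ := hZ z hz
    obtain ⟨d, hd⟩ := hf z hz
    obtain ⟨m, hm⟩ := h3
    obtain ⟨c, hc⟩ := ev_taylor k l g z.1 z.2 (- (z.2 - f.eval z.1))
    have e1 : eval z.1 (ev k l g X f) = ev k l g z.1 (f.eval z.1) := by
      have := ev_map k l g (evalRingHom z.1) X f
      simpa using this
    rw [eval_sub, eval_mul, eval_C, e1]
    have e2 : z.2 + -(z.2 - f.eval z.1) = f.eval z.1 := by ring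
    rw [e2, h1] at hc
    rw [hc]
    refine ⟨d * (m + γ * π^n*d*c), ?_⟩
    have e3 : γ * evU k l g z.1 z.2 = 1 - π * m := by rw [← hm]; ring
    have : z.2 - (f.eval z.1 - γ * (0 + -(z.2 - f.eval z.1) * evU k l g z.1 z.2 + (-(z.2 - f.eval z.1))^2*c))
      = (z.2 - f.eval z.1) * (1 - γ * evU k l g z.1 z.2) + γ * (z.2 - f.eval z.1)^2*c := by ring
    rw [this, hd, e3]
    ring

theorem padic_det {ι : Type*} [Fintype ι] [DecidableEq ι] (π t0 : R) (J : ℕ)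
    (hJ : J ≤ ∑ i ∈ Finset.range (Fintype.card ι), i) (hπ : π^J = 0) (f : R[X])
    (w t τ u : ι → R) (ht : ∀ i, t i - t0 = π * τ i) (hu : ∀ i, u i = f.eval (t i)) (a b : ι → ℕ) :
    (Matrix.of fun i x => w i * (t i ^ (a x) * u i ^ (b x))).det = 0 := by
  let Q : ι → R[X] := fun x => X^(a x) * f^(b x)
  obtain ⟨N, hN⟩ : ∃ N, ∀ x, (taylor t0 (Q x)).natDegree < N := by
    refine ⟨(Finset.univ.sup fun x => (taylor t0 (Q x)).natDegree) + 1, fun x => ?_⟩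
    have := Finset.le_sup (f := fun x => (taylor t0 (Q x)).natDegree) (Finset.mem_univ x)
    omega
  have key : (Matrix.of fun i x => w i * (t i ^ (a x) * u i ^ (b x))) =
      Matrix.of fun i x => ∑ m : Fin N, (w i * (π * τ i)^(m:ℕ)) * (taylor t0 (Q x)).coeff m := by
    ext i x
    simp only [Matrix.of_apply]
    have e1 : t i ^ (a x) * u i ^ (b x) = (Q x).eval (t i) := by simp [Q, hu]
    have e2 : (Q x).eval (t i) = (taylor t0 (Q x)).eval (t i - t0) := by
      rw [taylor_eval]; simp
    rw [e1, e2, eval_eq_sum_range' (hN x), Finset.sum_range, Finset.mul_sum, ht]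
    exact Finset.sum_congr rfl fun m _ => by ring
  rw [key, det_expand (fun i (m : Fin N) => w i * (π * τ i)^(m:ℕ)) (fun m x => (taylor t0 (Q x)).coeff m)]
  refine Finset.sum_eq_zero fun r _ => ?_
  by_cases hr : Function.Injective r
  swap
  · rw [det_of_not_injective (fun i (m : Fin N) => w i * (π * τ i)^(m:ℕ)) r hr, mul_zero]
  have : (Matrix.of fun i j => w i * (π * τ i)^(r j:ℕ)) =
      Matrix.of fun i j => π^(r j:ℕ) * (Matrix.of fun i j => w i * (τ i)^(r j:ℕ)) i j := by
    ext i j; simp only [Matrix.of_apply]; ring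
  rw [this, Matrix.det_mul_row, Finset.prod_pow_eq_pow_sum]
  have h2 : J ≤ ∑ j, (r j : ℕ) := by
    have h3 := sum_distinct (Fintype.card ι) (Finset.univ.image fun j => (r j : ℕ)) (by
      rw [Finset.card_image_of_injective]; · rfl
      exact fun x y h => hr (Fin.ext h))
    rw [Finset.sum_image (fun x _ y _ h => hr (Fin.ext h))] at h3
    omega
  rw [pow_eq_zero_of_le h2 hπ]
  simp
end ev

open Polynomial

theorem evalEval_ev (k l g) (T U : ℚ) : (Gp k l g).evalEval T U = ev k l g T U := evalEval_Gp k l g T U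

theorem evalEval_evU (k l g) (T U : ℚ) : (derivative (Gp k l g)).evalEval T U = evU k l g T U := by
  unfold Gp evalEval evU
  rw [derivative_sum, eval_finsetSum, eval_finsetSum]
  refine Finset.sum_congr rfl fun x _ => ?_
  rw [derivative_monomial, eval_monomial, eval_mul, eval_mul, eval_monomial, ← C_pow, eval_C,
    eval_natCast]
  ring

theorem Pt.T_mul (z : Pt) (h : z.q ≠ 0) : z.T * z.q = z.p := by
  unfold Pt.T; have : (z.q:ℚ) ≠ 0 := by exact_mod_cast h
  field_simp
theorem Pt.U_mul (z : Pt) (h : z.s ≠ 0) : z.U * z.s = z.r := by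
  unfold Pt.U; have : (z.s:ℚ) ≠ 0 := by exact_mod_cast h
  field_simp

theorem ev_zero_ring {R : Type*} [CommRing R] (k l g) (z : Pt) (hq : z.q ≠ 0) (hs : z.s ≠ 0)
    (h : (Gp k l g).evalEval z.T z.U = 0) (t u : R) (ht : t * z.q = z.p) (hu : u * z.s = z.r)
    (hqu : IsUnit (z.q : R)) (hsu : IsUnit (z.s : R)) : ev k l g t u = 0 := by
  have h1 := sum_mon k l z hq hs g
  rw [h, mul_zero] at h1
  have h2 : (∑ x, g x * z.mon k l x : ℤ) = 0 := by exact_mod_cast h1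
  have h3 : ((∑ x, g x * z.mon k l x : ℤ) : R) = z.q^k*z.s^l * ev k l g t u := by
    unfold ev
    push_cast
    rw [Finset.mul_sum]
    refine Finset.sum_congr rfl fun x _ => ?_
    rw [mon_ring k l z t u ht hu]; ring
  rw [h2] at h3
  have h4 : IsUnit ((z.q:R)^k*(z.s:R)^l) := (hqu.pow k).mul (hsu.pow l)
  rw [Int.cast_zero, eq_comm, h4.mul_right_eq_zero] at h3
  exact h3

theorem class_bound (k l K : ℕ) (g) (hl : 2 ≤ l) (hG : Irreducible (Gp k l g)) (hGl : (Gp k l g).natDegree = l)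
    (P : ℕ) (hP : P.Prime) (S : Finset Pt) (Λ B : ℝ) (hΛ : 1 ≤ Λ) (hB : 1 ≤ B)
    (hS : ∀ z ∈ S, Good Λ B z) (hT : Set.InjOn Pt.T S) (hv : ∀ z ∈ S, (Gp k l g).evalEval z.T z.U = 0)
    (hgood : ∀ z ∈ S, ¬ (P:ℤ) ∣ z.q ∧ ¬ (P:ℤ) ∣ z.s ∧ ¬ (P:ℤ) ∣ Dz k l g z)
    (hcl : ∀ z ∈ S, ∀ z' ∈ S, (P:ℤ) ∣ z.p * z'.q - z'.p * z.q ∧ (P:ℤ) ∣ z.r * z'.s - z'.r * z.s)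
    (hbig : ((2*(K+1)).factorial : ℝ) * (Λ^K*B)^(2*(K+1)) < (P:ℝ)^((K+1)*(2*K+1))) :
    S.card ≤ (l + 1) * max k K := by
  obtain rfl | ⟨z0, hz0⟩ := S.eq_empty_or_nonempty
  · simp
  set J := (K+1)*(2*K+1) with hJ
  have hJ1 : 1 ≤ J := Nat.mul_pos (by omega) (by omega)
  let R := ZMod (P^J)
  have hPI : Prime (P:ℤ) := Nat.prime_iff_prime_int.1 hP
  have hun : ∀ a : ℤ, ¬ (P:ℤ) ∣ a → IsUnit (a : R) := by
    intro a ha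
    rw [ZMod.coe_int_isUnit_iff_isCoprime]
    push_cast
    exact IsCoprime.pow_left ((hPI.coprime_iff_not_dvd).2 ha)
  have hπ : ((P:ℕ):R)^J = 0 := by
    rw [← Nat.cast_pow]; exact ZMod.natCast_self _
  have hdv : ∀ a : ℤ, (P:ℤ) ∣ a → ((P:ℕ):R) ∣ (a:R) := by
    rintro a ⟨b, rfl⟩; exact ⟨b, by rw [Int.cast_mul, Int.cast_natCast]⟩
  choose! t ht using fun z hz => (hun _ (hgood z hz).1).exists_left_inv
  choose! u hu using fun z hz => (hun _ (hgood z hz).2.1).exists_left_inv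
  let tt : Pt → R := fun z => t z * z.p
  let uu : Pt → R := fun z => u z * z.r
  have htt : ∀ z ∈ S, tt z * z.q = z.p := fun z hz => by
    simp only [tt]; linear_combination (z.p:R) * ht z hz
  have huu : ∀ z ∈ S, uu z * z.s = z.r := fun z hz => by
    simp only [uu]; linear_combination (z.r:R) * hu z hz
  have htd : ∀ z ∈ S, ((P:ℕ):R) ∣ tt z - tt z0 := by
    intro z hz
    have h1 := hdv _ (hcl z hz z0 hz0).1
    push_cast at h1
    have e : tt z - tt z0 = (z.p * z0.q - z0.p * z.q) * (t z * t z0) := by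
      simp only [tt]
      linear_combination (-(t z * z.p)) * ht z0 hz0 + t z0 * z0.p * ht z hz
    rw [e]; exact h1.mul_right _
  have hud : ∀ z ∈ S, ((P:ℕ):R) ∣ uu z - uu z0 := by
    intro z hz
    have h1 := hdv _ (hcl z hz z0 hz0).2
    push_cast at h1
    have e : uu z - uu z0 = (z.r * z0.s - z0.r * z.s) * (u z * u z0) := by
      simp only [uu]
      linear_combination (-(u z * z.r)) * hu z0 hz0 + u z0 * z0.r * hu z hz
    rw [e]; exact h1.mul_right _
  have hU0 : IsUnit (evU k l g (tt z0) (uu z0)) := by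
    have h1 := hun _ (hgood z0 hz0).2.2
    rw [Dz_ring k l g z0 _ _ (htt z0 hz0) (huu z0 hz0)] at h1
    exact isUnit_of_mul_isUnit_right h1
  obtain ⟨γ, hγ⟩ := hU0.exists_left_inv
  obtain ⟨f, hf⟩ := newton k l g ((P:ℕ):R) (uu z0) γ {y | ∃ z ∈ S, y = (tt z, uu z)} (by
    rintro y ⟨z, hz, rfl⟩
    have hg := hS z hz
    refine ⟨ev_zero_ring k l g z hg.q0 hg.s0 (hv z hz) _ _ (htt z hz) (huu z hz)
      (hun _ (hgood z hz).1) (hun _ (hgood z hz).2.1), hud z hz, ?_⟩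
    simp only
    rw [← hγ, ← mul_sub]
    refine Dvd.dvd.mul_left ?_ _
    rw [← Ideal.mem_span_singleton, ← Ideal.Quotient.eq_zero_iff_mem, map_sub, evU_map, evU_map, sub_eq_zero]
    have e1 : Ideal.Quotient.mk (Ideal.span {((P:ℕ):R)}) (tt z) = Ideal.Quotient.mk (Ideal.span {((P:ℕ):R)}) (tt z0) := by
      rw [Ideal.Quotient.eq, Ideal.mem_span_singleton]; exact htd z hz
    have e2 : Ideal.Quotient.mk (Ideal.span {((P:ℕ):R)}) (uu z) = Ideal.Quotient.mk (Ideal.span {((P:ℕ):R)}) (uu z0) := by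
      rw [Ideal.Quotient.eq, Ideal.mem_span_singleton]; exact hud z hz
    rw [e1, e2]) J
  have hf' : ∀ z ∈ S, uu z = f.eval (tt z) := by
    intro z hz
    have h1 := hf _ ⟨z, hz, rfl⟩
    rw [pow_succ, hπ, zero_mul, zero_dvd_iff, sub_eq_zero] at h1
    exact h1
  choose! τ hτ using htd
  obtain ⟨g', h1, -, h3⟩ := aux_poly K 1 S Λ B hΛ hB hS (by
    intro y hy
    set M : Matrix (Fin (K+1) × Fin (1+1)) (Fin (K+1) × Fin (1+1)) ℤ := Matrix.of fun i x => (y i).mon K 1 x with hM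
    have hcard : Fintype.card (Fin (K+1) × Fin (1+1)) = 2*(K+1) := by simp; ring
    have hz : ((M.det : ℤ) : R) = 0 := by
      have e : ((M.det : ℤ) : R) = ((Int.castRingHom R).mapMatrix M).det := by
        rw [← RingHom.map_det]; simp
      rw [e]
      have := padic_det (ι := Fin (K+1) × Fin (1+1)) ((P:ℕ):R) (tt z0) J (by
          rw [hcard]
          have := Finset.sum_range_id_mul_two (2*(K+1))
          have e : 2*(K+1)-1 = 2*K+1 := by omega
          rw [e] at this
          rw [hJ]; nlinarith) hπ f (fun i => ((y i).q:R)^K * ((y i).s:R)^1) (fun i => tt (y i)) (fun i => τ (y i))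
          (fun i => uu (y i)) (fun i => hτ _ (hy i)) (fun i => hf' _ (hy i)) (fun x => x.1) (fun x => x.2)
      rw [← this]
      congr 1
      ext i x
      simp only [RingHom.mapMatrix_apply, Matrix.map_apply, hM, Matrix.of_apply]
      rw [← mon_ring K 1 (y i) _ _ (htt _ (hy i)) (huu _ (hy i))]
      simp
    rw [ZMod.intCast_zmod_eq_zero_iff_dvd] at hz
    by_contra hne
    have h1 := Int.le_of_dvd (abs_pos.2 hne) ((dvd_abs _ _).2 hz)
    have h2 := abs_det_le_cols ((Int.castRingHom ℝ).mapMatrix M) (fun _ => Λ^K*B^1) (by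
      intro i j
      simpa [hM] using mon_le K 1 (y i) Λ B (hS _ (hy i)) hΛ hB j)
    rw [← RingHom.map_det, hcard, Finset.prod_const, Finset.card_univ, hcard, pow_one] at h2
    have h3 : ((P:ℝ)^J) ≤ |((M.det:ℤ):ℝ)| := by exact_mod_cast h1
    have h4 := lt_of_le_of_lt h2 hbig
    simp only [eq_intCast] at h4
    linarith)
  rw [← Finset.card_image_of_injOn hT]
  refine cz (Gp k l g) (Gp K 1 g') hG (by omega) ?_ l 1 (max k K) hGl.le (Gp_natDegree K 1 g')
    (fun j => (Gp_coeff_natDegree k l g j).trans (le_max_left _ _))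
    (fun j => (Gp_coeff_natDegree K 1 g' j).trans (le_max_right _ _)) _ ?_
  · intro hd
    have := natDegree_le_of_dvd hd (Gp_ne K 1 g' h1)
    have := Gp_natDegree K 1 g'
    omega
  · intro T hT'
    obtain ⟨z, hz, rfl⟩ := Finset.mem_image.1 hT'
    exact ⟨z.U, hv z hz, h3 z hz⟩

open Polynomial

theorem curve_mod_card (k l : ℕ) (g) (P : ℕ) [Fact P.Prime] (F : Finset (ZMod P × ZMod P))
    (hF : ∀ y ∈ F, ev k l g y.1 y.2 = 0 ∧ evU k l g y.1 y.2 ≠ 0) : F.card ≤ l * P := by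
  classical
  have h1 := Finset.card_le_mul_card_image (f := Prod.fst) F l (by
    intro t ht
    let Q : (ZMod P)[X] := ∑ x, C ((g x : ZMod P) * t^(x.1:ℕ)) * X^(x.2:ℕ)
    have hQ : ∀ u, Q.eval u = ev k l g t u := by
      intro u; simp only [Q, ev, eval_finsetSum, eval_mul, eval_C, eval_pow, eval_X]
      exact Finset.sum_congr rfl fun x _ => by ring
    have hQ' : ∀ u, (derivative Q).eval u = evU k l g t u := by
      intro u; simp only [Q, evU, derivative_sum, eval_finsetSum, derivative_C_mul, derivative_X_pow, eval_mul, eval_C, eval_pow, eval_X]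
      exact Finset.sum_congr rfl fun x _ => by ring
    have hdeg : Q.natDegree ≤ l := by
      apply natDegree_sum_le_of_forall_le
      intro x _
      exact (natDegree_C_mul_X_pow_le _ _).trans (by omega)
    obtain ⟨y, hy, rfl⟩ := Finset.mem_image.1 ht
    have hQ0 : Q ≠ 0 := by
      intro h0
      have := (hF y hy).2
      rw [← hQ', h0] at this
      simp at this
    refine le_trans ?_ ((Multiset.toFinset_card_le Q.roots).trans ((card_roots' Q).trans hdeg))
    refine Finset.card_le_card_of_injOn Prod.snd ?_ ?_
    · intro w hw
      simp only [Finset.coe_filter, Set.mem_setOf_eq] at hw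
      simp only [Multiset.mem_toFinset, Finset.mem_coe]
      rw [mem_roots hQ0, IsRoot, hQ, ← hw.2]
      exact (hF w hw.1).1
    · intro w hw w' hw' h
      simp only [Finset.coe_filter, Set.mem_setOf_eq] at hw hw'
      exact Prod.ext (hw.2.trans hw'.2.symm) h)
  refine h1.trans (Nat.mul_le_mul_left _ ?_)
  exact (Finset.card_le_univ _).trans (by rw [ZMod.card])

theorem prime_count (k l K : ℕ) (g) (hl : 2 ≤ l) (hG : Irreducible (Gp k l g)) (hGl : (Gp k l g).natDegree = l)
    (P : ℕ) (hP : P.Prime) (S : Finset Pt) (Λ B : ℝ) (hΛ : 1 ≤ Λ) (hB : 1 ≤ B)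
    (hS : ∀ z ∈ S, Good Λ B z) (hT : Set.InjOn Pt.T S) (hv : ∀ z ∈ S, (Gp k l g).evalEval z.T z.U = 0)
    (hgood : ∀ z ∈ S, ¬ (P:ℤ) ∣ z.q ∧ ¬ (P:ℤ) ∣ z.s ∧ ¬ (P:ℤ) ∣ Dz k l g z)
    (hbig : ((2*(K+1)).factorial : ℝ) * (Λ^K*B)^(2*(K+1)) < (P:ℝ)^((K+1)*(2*K+1))) :
    S.card ≤ (l + 1) * max k K * (l * P) := by
  classical
  haveI := Fact.mk hP
  have hne : ∀ a : ℤ, ¬ (P:ℤ) ∣ a → (a : ZMod P) ≠ 0 := fun a ha h =>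
    ha ((ZMod.intCast_zmod_eq_zero_iff_dvd a P).1 h)
  let cls : Pt → ZMod P × ZMod P := fun z => ((z.p:ZMod P) / z.q, (z.r:ZMod P)/z.s)
  have hcq : ∀ z ∈ S, (cls z).1 * z.q = z.p := fun z hz => div_mul_cancel₀ _ (hne _ (hgood z hz).1)
  have hcs : ∀ z ∈ S, (cls z).2 * z.s = z.r := fun z hz => div_mul_cancel₀ _ (hne _ (hgood z hz).2.1)
  have h1 := Finset.card_le_mul_card_image (f := cls) S ((l + 1) * max k K) (by
    intro y hy
    have hmem : ∀ z ∈ S.filter (fun z => cls z = y), z ∈ S ∧ cls z = y := fun z hz => Finset.mem_filter.1 hz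
    refine class_bound k l K g hl hG hGl P hP _ Λ B hΛ hB (fun z hz => hS z (hmem z hz).1)
      (hT.mono (by intro z hz; exact (hmem z hz).1)) (fun z hz => hv z (hmem z hz).1)
      (fun z hz => hgood z (hmem z hz).1) ?_ hbig
    intro z hz z' hz'
    obtain ⟨a1, a2⟩ := hmem z hz
    obtain ⟨b1, b2⟩ := hmem z' hz'
    have e1 := hcq z a1; have e2 := hcq z' b1
    have e3 := hcs z a1; have e4 := hcs z' b1
    rw [a2] at e1 e3; rw [b2] at e2 e4
    constructor
    · rw [← ZMod.intCast_zmod_eq_zero_iff_dvd]; push_cast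
      rw [← e1, ← e2]; ring
    · rw [← ZMod.intCast_zmod_eq_zero_iff_dvd]; push_cast
      rw [← e3, ← e4]; ring)
  refine h1.trans (Nat.mul_le_mul_left _ (curve_mod_card k l g P _ ?_))
  intro y hy
  obtain ⟨z, hz, rfl⟩ := Finset.mem_image.1 hy
  have hg := hS z hz
  refine ⟨ev_zero_ring k l g z hg.q0 hg.s0 (hv z hz) _ _ (hcq z hz) (hcs z hz)
    (isUnit_iff_ne_zero.2 (hne _ (hgood z hz).1)) (isUnit_iff_ne_zero.2 (hne _ (hgood z hz).2.1)), ?_⟩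
  have h2 := hne _ (hgood z hz).2.2
  rw [Dz_ring k l g z _ _ (hcq z hz) (hcs z hz)] at h2
  exact right_ne_zero_of_mul h2

theorem exists_primes (N : ℕ) (hN : 1 ≤ N) (ρ : ℕ) :
    ∃ A : Finset ℕ, A.card = ρ ∧ ∀ P ∈ A, P.Prime ∧ N < P ∧ P ≤ 2^ρ*N := by
  induction ρ with
  | zero => exact ⟨∅, by simp⟩
  | succ ρ ih =>
    obtain ⟨A, h1, h2⟩ := ih
    obtain ⟨p, hp, h3, h4⟩ := Nat.exists_prime_lt_and_le_two_mul (2^ρ*N) (by positivity)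
    have hNN : N ≤ 2^ρ*N := Nat.le_mul_of_pos_left _ (by positivity)
    have e : 2^(ρ+1)*N = 2*(2^ρ*N) := by ring
    refine ⟨insert p A, ?_, ?_⟩
    · rw [Finset.card_insert_of_notMem, h1]
      intro h; have := (h2 p h).2.2; omega
    · intro q hq
      rcases Finset.mem_insert.1 hq with rfl | hq
      · exact ⟨hp, by omega, by omega⟩
      · obtain ⟨a, b, c⟩ := h2 q hq
        exact ⟨a, b, by omega⟩

theorem Dz_le (k l : ℕ) (g) (z : Pt) (Λ B M : ℝ) (h : Good Λ B z) (h1 : 1 ≤ Λ) (h2 : 1 ≤ B)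
    (hM : ∀ x, |(g x : ℝ)| ≤ M) : |(Dz k l g z : ℝ)| ≤ ((k+1)*(l+1):ℕ) * (M * (Λ^k*(l*B^l))) := by
  unfold Dz
  push_cast
  refine (Finset.abs_sum_le_sum_abs _ _).trans ?_
  have hM0 : 0 ≤ M := (abs_nonneg _).trans (hM 0)
  refine (Finset.sum_le_card_nsmul _ _ (M * (Λ^k*(l*B^l))) ?_).trans ?_
  · intro x _
    rcases Nat.eq_zero_or_pos (x.2:ℕ) with h0 | h0
    · simp [h0]; positivity
    rw [abs_mul, abs_mul, abs_mul, abs_mul, abs_mul, abs_pow, abs_pow, abs_pow, abs_pow, Nat.abs_cast]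
    have e1 : Λ^k = Λ^(x.1:ℕ) * Λ^(k-x.1) := by rw [← pow_add]; congr 1; omega
    have e2 : B^l = B^((x.2:ℕ)-1) * B^(l+1-x.2) := by rw [← pow_add]; congr 1; omega
    rw [e1, e2]
    have := h.hp; have := h.hq; have := h.hr; have := h.hs; have := hM x
    have : ((x.2:ℕ):ℝ) ≤ l := by exact_mod_cast (by omega)
    gcongr
  · simp

open Polynomial

theorem big_ineq (K : ℕ) (F Λ B P e : ℝ) (hF : 1 ≤ F) (hΛ : 1 ≤ Λ) (hB : 1 ≤ B) (hK : 1 ≤ K)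
    (he : B ≤ e^K) (he1 : 1 ≤ e) (hP : F * Λ * e < P) :
    F * (Λ^K*B)^(2*(K+1)) < P^((K+1)*(2*K+1)) := by
  have hP1 : 1 < P := lt_of_le_of_lt (one_le_mul_of_one_le_of_one_le (one_le_mul_of_one_le_of_one_le hF hΛ) he1) hP
  have h1 : F * (Λ^K*B) ≤ P^K := by
    calc F * (Λ^K*B) ≤ F^K * (Λ^K * e^K) := by
          gcongr
          exact le_self_pow₀ hF (by omega)
      _ = (F*Λ*e)^K := by rw [mul_pow, mul_pow]; ring
      _ ≤ _ := by gcongr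
  have h2 : F * (Λ^K*B)^2 < P^(2*K+1) := by
    have h0 : 0 < F * (Λ^K*B)^2 := by positivity
    calc F * (Λ^K*B)^2 ≤ F * (F * (Λ^K*B)^2) := le_mul_of_one_le_left h0.le hF
      _ = (F * (Λ^K*B))^2 := by ring
      _ ≤ (P^K)^2 := by gcongr
      _ < (P^K)^2 * P := by
          apply lt_mul_of_one_lt_right _ hP1
          positivity
      _ = _ := by ring
  calc F * (Λ^K*B)^(2*(K+1)) ≤ F^(K+1) * (Λ^K*B)^(2*(K+1)) := by
        gcongr
        exact le_self_pow₀ hF (by omega)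
    _ = (F * (Λ^K*B)^2)^(K+1) := by rw [mul_pow F, ← pow_mul]
    _ < (P^(2*K+1))^(K+1) := by
        apply pow_lt_pow_left₀ h2 (by positivity) (by omega)
    _ = _ := by rw [← pow_mul]; ring_nf

theorem padic_case (k l : ℕ) (hl : 2 ≤ l) (ε : ℝ) (hε : 0 < ε) :
    ∃ C : ℝ, 0 < C ∧ ∀ Λ B : ℝ, 1 ≤ Λ → Λ ≤ B → ∀ (S : Finset Pt) (g : Fin (k+1) × Fin (l+1) → ℤ),
    (∀ z ∈ S, Good Λ B z) → Set.InjOn Pt.T S → (∀ z ∈ S, (Gp k l g).evalEval z.T z.U = 0) →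
    (∀ x, |(g x : ℝ)| ≤ (((k+1)*(l+1):ℕ) * (Λ^k*B^l))^((k+1)*(l+1))) →
    Irreducible (Gp k l g) → (Gp k l g).natDegree = l → (S.card : ℝ) ≤ C * B^ε * Λ := by
  classical
  set N := (k+1)*(l+1) with hN
  have hN1 : 1 ≤ N := Nat.mul_pos (by omega) (by omega)
  set c1 : ℕ := N * (N^N * l) with hc1
  set c2 : ℕ := (k+l)*N + (k + l) + 2 with hc2
  obtain ⟨K, hK1, hK⟩ : ∃ K : ℕ, 1 ≤ K ∧ 1 ≤ ε * K := by
    refine ⟨⌈1/ε⌉₊, Nat.one_le_ceil_iff.2 (by positivity), ?_⟩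
    have := Nat.le_ceil (1/ε)
    rw [div_le_iff₀ hε] at this; linarith
  set ρ : ℕ := K * c2 with hρ
  have hρ1 : 1 ≤ ρ := Nat.mul_pos (by omega) (by omega)
  set c0 : ℕ := (2*(K+1)).factorial + c1 with hc0
  have hc0' : 1 ≤ c0 := by have := Nat.factorial_pos (2*(K+1)); omega
  refine ⟨(l+l)*k + ρ * ((l+1) * max k K * (l * (2^ρ * (2*c0)))) , ?_, ?_⟩
  · have : 0 < max k K := lt_of_lt_of_le (by omega) (le_max_right k K)
    have : 0 < ρ * ((l+1) * max k K * (l * (2^ρ * (2*c0)))) := by positivity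
    have : (0:ℝ) < ρ * ((l+1) * max k K * (l * (2^ρ * (2*c0)))) := by exact_mod_cast this
    positivity
  intro Λ B hΛ hΛB S g hS hT hv hg hG hGl
  have hB : 1 ≤ B := hΛ.trans hΛB
  set e := B^ε with he
  have he1 : 1 ≤ e := Real.one_le_rpow hB hε.le
  have heK : B ≤ e^K := by
    rw [he, ← Real.rpow_natCast, ← Real.rpow_mul (by positivity)]
    conv_lhs => rw [← Real.rpow_one B]
    exact Real.rpow_le_rpow_of_exponent_le hB hK
  have hX1 : (1:ℝ) ≤ c0 * Λ * e := by
    have : (1:ℝ) ≤ c0 := by exact_mod_cast hc0'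
    exact one_le_mul_of_one_le_of_one_le (one_le_mul_of_one_le_of_one_le this hΛ) he1
  set N0 := ⌈(c0 * Λ * e : ℝ)⌉₊ with hN0
  have hN0a : c0 * Λ * e ≤ N0 := Nat.le_ceil _
  have hN0b : (N0:ℝ) ≤ 2 * (c0 * Λ * e) := by
    have := Nat.ceil_lt_add_one (a := (c0 * Λ * e : ℝ)) (by positivity)
    rw [← hN0] at this; linarith
  have hN01 : 1 ≤ N0 := Nat.one_le_ceil_iff.2 (by linarith)
  obtain ⟨A, hA1, hA2⟩ := exists_primes N0 hN01 ρ
  let bad := S.filter fun z => evU k l g z.T z.U = 0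
  let Sp : ℕ → Finset Pt := fun P => S.filter fun z =>
    ¬ (P:ℤ) ∣ z.q ∧ ¬ (P:ℤ) ∣ z.s ∧ ¬ (P:ℤ) ∣ Dz k l g z
  have hcov : S ⊆ bad ∪ A.biUnion Sp := by
    intro z hz
    by_cases hb : evU k l g z.T z.U = 0
    · exact Finset.mem_union_left _ (Finset.mem_filter.2 ⟨hz, hb⟩)
    apply Finset.mem_union_right
    rw [Finset.mem_biUnion]
    by_contra hcon
    push Not at hcon
    have hgd := hS z hz
    have hD0 : Dz k l g z ≠ 0 := by
      have := Dz_ring k l g z z.T z.U (z.T_mul hgd.q0) (z.U_mul hgd.s0)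
      intro h0
      rw [h0] at this
      have hq' : (z.q:ℚ)^k ≠ 0 := pow_ne_zero _ (by exact_mod_cast hgd.q0)
      have hs' : (z.s:ℚ)^l ≠ 0 := pow_ne_zero _ (by exact_mod_cast hgd.s0)
      rw [Int.cast_zero, eq_comm] at this
      exact (mul_ne_zero (mul_ne_zero hq' hs') hb) this
    set W : ℤ := z.q * z.s * Dz k l g z with hW
    have hW0 : W ≠ 0 := mul_ne_zero (mul_ne_zero hgd.q0 hgd.s0) hD0
    have hdv : ∀ P ∈ A, (P:ℤ) ∣ W := by
      intro P hP
      have h1 := hcon P hP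
      simp only [Sp, Finset.mem_filter, not_and, not_not] at h1
      by_cases h2 : (P:ℤ) ∣ z.q
      · exact Dvd.dvd.mul_right (h2.mul_right _) _
      by_cases h3 : (P:ℤ) ∣ z.s
      · exact Dvd.dvd.mul_right (h3.mul_left _) _
      exact (h1 hz h2 h3).mul_left _
    have hprod : (∏ P ∈ A, P) ∣ W.natAbs := by
      apply Finset.prod_primes_dvd
      · intro P hP; exact (hA2 P hP).1.prime
      · intro P hP; exact Int.natCast_dvd.1 (hdv P hP)
    have h5 : N0^ρ ≤ W.natAbs := by
      refine le_trans ?_ (Nat.le_of_dvd (Int.natAbs_pos.2 hW0) hprod)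
      rw [← hA1]
      exact Finset.pow_card_le_prod _ _ _ (fun P hP => (hA2 P hP).2.1.le)
    have h6 : ((N0:ℝ))^ρ ≤ |(W:ℝ)| := by
      rw [← Int.cast_abs, Int.abs_eq_natAbs]; exact_mod_cast h5
    have h7 : |(W:ℝ)| ≤ c1 * B^c2 := by
      rw [hW]; push_cast
      rw [abs_mul, abs_mul]
      have h8 := Dz_le k l g z Λ B _ hgd hΛ hB hg
      have h9 := hgd.hq.trans hΛB
      have h10 := hgd.hs
      calc _ ≤ B * B * (N * ((N * (B^k*B^l))^N * (B^k*(l*B^l)))) := by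
            gcongr
            refine h8.trans ?_
            gcongr
        _ = c1 * B^c2 := by
            rw [hc1, hc2]; push_cast
            rw [← pow_add, mul_pow, ← pow_mul]; ring
    have h11 : (c1:ℝ) * B^c2 < (N0:ℝ)^ρ := by
      have e1 : B^c2 ≤ e^ρ := by
        rw [hρ, pow_mul]; gcongr
      have e2 : (c1:ℝ) < c0 * Λ := by
        have : (c1:ℝ) + 1 ≤ c0 := by rw [hc0]; exact_mod_cast (by have := Nat.factorial_pos (2*(K+1)); omega)
        nlinarith [(Nat.cast_nonneg c1 : (0:ℝ) ≤ c1)]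
      have e3 : 1 ≤ c0 * Λ := by
        have : (1:ℝ) ≤ c0 := by exact_mod_cast hc0'
        exact one_le_mul_of_one_le_of_one_le this hΛ
      calc (c1:ℝ) * B^c2 < (c0*Λ) * B^c2 := by gcongr
        _ ≤ (c0*Λ)^ρ * e^ρ := by
            gcongr
            exact le_self_pow₀ e3 (by omega)
        _ = (c0 * Λ * e)^ρ := by rw [← mul_pow]
        _ ≤ _ := by gcongr
    linarith
  have hbad : bad.card ≤ (l+l)*k := by
    have hmem : ∀ z ∈ bad, z ∈ S ∧ evU k l g z.T z.U = 0 := fun z hz => Finset.mem_filter.1 hz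
    rw [← Finset.card_image_of_injOn (hT.mono (fun z hz => (hmem z hz).1) : Set.InjOn Pt.T bad)]
    refine cz (Gp k l g) (derivative (Gp k l g)) hG (by omega) ?_ l l k hGl.le
      ((natDegree_derivative_le _).trans (by omega)) (Gp_coeff_natDegree k l g) ?_ _ ?_
    · intro hd
      have hne : derivative (Gp k l g) ≠ 0 := by
        intro h0
        have := derivative_eq_zero.1 h0
        omega
      have h1 := natDegree_le_of_dvd hd hne
      have h2 := natDegree_derivative_lt (p := Gp k l g) (by omega)
      omega
    · intro j
      rw [coeff_derivative]
      have : ((j:ℚ[X]) + 1) = C ((j:ℚ)+1) := by simp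
      rw [this]
      exact (natDegree_mul_C_le _ _).trans (Gp_coeff_natDegree k l g _)
    · intro T hT'
      obtain ⟨z, hz, rfl⟩ := Finset.mem_image.1 hT'
      exact ⟨z.U, hv z (hmem z hz).1, by rw [evalEval_evU]; exact (hmem z hz).2⟩
  have hSp : ∀ P ∈ A, (Sp P).card ≤ (l+1) * max k K * (l * (2^ρ*N0)) := by
    intro P hP
    obtain ⟨a, b, c⟩ := hA2 P hP
    have hmem : ∀ z ∈ Sp P, z ∈ S ∧ (¬ (P:ℤ) ∣ z.q ∧ ¬ (P:ℤ) ∣ z.s ∧ ¬ (P:ℤ) ∣ Dz k l g z) :=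
      fun z hz => Finset.mem_filter.1 hz
    refine (prime_count k l K g hl hG hGl P a (Sp P) Λ B hΛ hB (fun z hz => hS z (hmem z hz).1)
      (hT.mono (fun z hz => (hmem z hz).1)) (fun z hz => hv z (hmem z hz).1) (fun z hz => (hmem z hz).2) ?_).trans ?_
    · apply big_ineq K _ Λ B P e (by exact_mod_cast Nat.factorial_pos _) hΛ hB hK1 heK he1
      have h1 : (((2*(K+1)).factorial:ℕ):ℝ) ≤ c0 := by rw [hc0]; exact_mod_cast (by omega)
      calc _ ≤ c0 * Λ * e := by gcongr
        _ ≤ N0 := hN0a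
        _ < P := by exact_mod_cast b
    · gcongr
  have hfin : S.card ≤ (l+l)*k + ρ * ((l+1) * max k K * (l * (2^ρ*N0))) := by
    refine (Finset.card_le_card hcov).trans ((Finset.card_union_le _ _).trans (add_le_add hbad ?_))
    refine Finset.card_biUnion_le.trans ?_
    refine (Finset.sum_le_card_nsmul _ _ _ hSp).trans ?_
    rw [hA1, smul_eq_mul]
  have hfin' : (S.card:ℝ) ≤ (l+l)*k + ρ * ((l+1) * (max k K : ℕ) * (l * (2^ρ*N0))) := by exact_mod_cast hfin
  have heΛ : 1 ≤ e * Λ := one_le_mul_of_one_le_of_one_le he1 hΛ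
  calc (S.card:ℝ) ≤ (l+l)*k + ρ * ((l+1) * (max k K : ℕ) * (l * (2^ρ*(2 * (c0 * Λ * e))))) := by
        refine hfin'.trans ?_
        gcongr
    _ ≤ ((l+l)*k) * (e*Λ) + ρ * ((l+1) * (max k K : ℕ) * (l * (2^ρ*(2 * (c0 * Λ * e))))) := by
        refine add_le_add_left ?_ _
        exact le_mul_of_one_le_right (by positivity) heΛ
    _ = _ := by push_cast; ring

open Polynomial

def homg (n : ℕ) (f : ℤ[X]) (p q : ℤ) : ℤ := ∑ i ∈ Finset.range (n+1), f.coeff i * (p^i*q^(n-i))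

theorem homg_cast (n : ℕ) (f : ℤ[X]) (hf : f.natDegree ≤ n) (p q : ℤ) (hq : q ≠ 0) :
    (homg n f p q : ℚ) = q^n * (f.map (Int.castRingHom ℚ)).eval ((p:ℚ)/q) := by
  have hq' : (q:ℚ) ≠ 0 := by exact_mod_cast hq
  unfold homg
  rw [eval_eq_sum_range' (n := n+1) (lt_of_le_of_lt (natDegree_map_le) (by omega)), Finset.mul_sum]
  push_cast
  refine Finset.sum_congr rfl fun i hi => ?_
  have hi' : i ≤ n := by have := Finset.mem_range.1 hi; omega
  have h1 : (q:ℚ)^n = q^i * q^(n-i) := by rw [← pow_add]; congr 1; omega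
  rw [coeff_map, h1, div_pow]
  simp only [eq_intCast]
  field_simp

theorem homg_top (n : ℕ) (f : ℤ[X]) (p q : ℤ) : ∃ w, homg n f p q = f.coeff n * p^n + q * w := by
  unfold homg
  rw [Finset.sum_range_succ, Nat.sub_self, pow_zero, mul_one, add_comm]
  have : q ∣ ∑ i ∈ Finset.range n, f.coeff i * (p^i*q^(n-i)) := by
    refine Finset.dvd_sum fun i hi => ?_
    have := Finset.mem_range.1 hi
    exact Dvd.dvd.mul_left (Dvd.dvd.mul_left (dvd_pow_self q (by omega)) _) _
  obtain ⟨w, hw⟩ := this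
  exact ⟨w, by rw [hw]⟩

theorem dvd_elim (m R c p q w : ℤ) (n k : ℕ) (hpq : IsCoprime p q) (h1 : m ∣ R * q^n)
    (h2 : m ∣ c * p^k + q * w) : m ∣ R * c^n := by
  have h3 : m ∣ (c*p^k)^n - (-(q*w))^n := by
    refine dvd_trans ?_ (sub_dvd_pow_sub_pow _ _ n)
    simpa using h2
  have h4 : m ∣ R * c^n * p^(k*n) := by
    have e : R * c^n * p^(k*n) = R * ((c*p^k)^n - (-(q*w))^n) + R * q^n * (-w)^n := by
      rw [pow_mul]; ring
    rw [e]
    exact dvd_add (h3.mul_left _) (h1.mul_right _)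
  have h5 : m ∣ R * c^n * q^n := by
    have e : R * c^n * q^n = R * q^n * c^n := by ring
    rw [e]; exact h1.mul_right _
  obtain ⟨x, y, hxy⟩ := (IsCoprime.pow (m := k*n) (n := n) hpq)
  have e : R * c^n = x * (R * c^n * p^(k*n)) + y * (R * c^n * q^n) := by linear_combination (-R*c^n) * hxy
  rw [e]
  exact dvd_add (h4.mul_left _) (h5.mul_left _)

theorem exists_N0 (k : ℕ) (a b : ℤ[X]) (ha : a.natDegree ≤ k) (hb : b.natDegree ≤ k)
    (hc : a.coeff k ≠ 0 ∨ b.coeff k ≠ 0)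
    (hcop : IsCoprime (a.map (Int.castRingHom ℚ)) (b.map (Int.castRingHom ℚ)))
    (M : ℝ) (hM : 1 ≤ M) (haM : ∀ i, |(a.coeff i : ℝ)| ≤ M) (hbM : ∀ i, |(b.coeff i : ℝ)| ≤ M) :
    ∃ N0 : ℤ, N0 ≠ 0 ∧ |(N0:ℝ)| ≤ (2*k).factorial * M^(4*k+1) ∧
      ∀ p q m : ℤ, q ≠ 0 → IsCoprime p q → m ∣ homg k a p q → m ∣ homg k b p q → m ∣ N0 := by
  have hcc : ∃ c : ℤ, c ≠ 0 ∧ |(c:ℝ)| ≤ M ∧ ∀ p q m : ℤ, m ∣ homg k a p q → m ∣ homg k b p q → ∃ w, m ∣ c * p^k + q * w := by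
    rcases hc with hc | hc
    · refine ⟨a.coeff k, hc, haM k, fun p q m h1 _ => ?_⟩
      obtain ⟨w, hw⟩ := homg_top k a p q
      exact ⟨w, by rw [← hw]; exact h1⟩
    · refine ⟨b.coeff k, hc, hbM k, fun p q m _ h1 => ?_⟩
      obtain ⟨w, hw⟩ := homg_top k b p q
      exact ⟨w, by rw [← hw]; exact h1⟩
  rcases Nat.eq_zero_or_pos k with rfl | hk
  · rcases hc with hc | hc
    · refine ⟨a.coeff 0, hc, by simpa using haM 0, fun p q m _ _ h1 _ => by simpa [homg] using h1⟩
    · refine ⟨b.coeff 0, hc, by simpa using hbM 0, fun p q m _ _ _ h1 => by simpa [homg] using h1⟩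
  obtain ⟨c, hc0, hcM, hcd⟩ := hcc
  set R := resultant a b with hR
  have hinj : Function.Injective (Int.castRingHom ℚ) := Int.cast_injective
  have hR0 : R ≠ 0 := by
    intro h0
    have h1 : resultant (a.map (Int.castRingHom ℚ)) (b.map (Int.castRingHom ℚ)) = 0 := by
      rw [natDegree_map_eq_of_injective hinj, natDegree_map_eq_of_injective hinj, resultant_map_map, ← hR, h0, map_zero]
    rw [resultant_eq_zero_iff] at h1
    exact h1.2 hcop
  have hdeg : a.natDegree ≠ 0 ∨ b.natDegree ≠ 0 := by
    rcases hc with hc | hc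
    · left; have := le_natDegree_of_ne_zero hc; omega
    · right; have := le_natDegree_of_ne_zero hc; omega
  obtain ⟨u, v, hu, hv, e⟩ := exists_mul_add_mul_eq_C_resultant a b le_rfl le_rfl hdeg
  have hu' : u.natDegree ≤ k := by
    apply natDegree_le_of_degree_le
    exact hu.le.trans (by exact_mod_cast hb)
  have hv' : v.natDegree ≤ k := by
    apply natDegree_le_of_degree_le
    exact hv.le.trans (by exact_mod_cast ha)
  refine ⟨R * c^(2*k), mul_ne_zero hR0 (pow_ne_zero _ hc0), ?_, ?_⟩
  · have h1 : |(R:ℝ)| ≤ (2*k).factorial * M^(2*k) := by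
      have h2 := abs_det_le_cols ((Int.castRingHom ℝ).mapMatrix (sylvester a b a.natDegree b.natDegree)) (fun _ => M) (by
        intro i j
        simp only [sylvester, RingHom.mapMatrix_apply, Matrix.map_apply, Matrix.of_apply]
        refine Fin.addCases (fun j => ?_) (fun j => ?_) j
        · simp only [Fin.addCases_left]; split_ifs
          · simpa using hbM _
          · simpa using (by linarith)
        · simp only [Fin.addCases_right]; split_ifs
          · simpa using haM _
          · simpa using (by linarith))
      rw [← RingHom.map_det, Finset.prod_const, Finset.card_univ, Fintype.card_fin] at h2
      refine le_trans (le_of_eq ?_) (h2.trans ?_)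
      · rw [hR]; simp [resultant]
      · gcongr
        · omega
        · omega
    push_cast
    rw [abs_mul, abs_pow]
    calc |(R:ℝ)| * |(c:ℝ)|^(2*k) ≤ (2*k).factorial * M^(2*k) * M^(2*k) := by gcongr
      _ = (2*k).factorial * M^(4*k) := by rw [mul_assoc, ← pow_add]; congr 2; omega
      _ ≤ _ := by gcongr; omega
  · intro p q m hq hpq h1 h2
    obtain ⟨w, hw⟩ := hcd p q m h1 h2
    refine dvd_elim m R c p q w (2*k) k hpq ?_ hw
    have : R * q^(2*k) = homg k a p q * homg k u p q + homg k b p q * homg k v p q := by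
      have h3 : ((R * q^(2*k) : ℤ) : ℚ) = ((homg k a p q * homg k u p q + homg k b p q * homg k v p q : ℤ) : ℚ) := by
        push_cast
        rw [homg_cast k a ha p q hq, homg_cast k u hu' p q hq, homg_cast k b hb p q hq, homg_cast k v hv' p q hq]
        have e2 := congrArg (fun f => (f.map (Int.castRingHom ℚ)).eval ((p:ℚ)/q)) e
        simp only [Polynomial.map_add, Polynomial.map_mul, eval_add, eval_mul, map_C, eval_C] at e2
        rw [← hR] at e2
        simp only [eq_intCast] at e2
        rw [← e2, two_mul, pow_add]; ring
      exact_mod_cast h3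
    rw [this]
    exact dvd_add (h1.mul_right _) (h2.mul_right _)

open Polynomial

theorem card_Icc_le (Λ : ℝ) (hΛ : 1 ≤ Λ) : ((Finset.Icc (-⌊Λ⌋) ⌊Λ⌋).card : ℝ) ≤ 3 * Λ := by
  rw [Int.card_Icc]
  have h0 : 0 ≤ ⌊Λ⌋ := Int.floor_nonneg.2 (by linarith)
  have h1 := Int.floor_le Λ
  have : (((⌊Λ⌋ + 1 - -⌊Λ⌋).toNat : ℤ) : ℝ) = 2 * ⌊Λ⌋ + 1 := by
    rw [Int.toNat_of_nonneg (by omega)]; push_cast; ring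
  rw [Int.cast_natCast] at this
  rw [this]; linarith

theorem mem_Icc_floor (Λ : ℝ) (a : ℤ) (h : |(a:ℝ)| ≤ Λ) : a ∈ Finset.Icc (-⌊Λ⌋) ⌊Λ⌋ := by
  rw [abs_le] at h
  rw [Finset.mem_Icc]
  constructor
  · have : -a ≤ ⌊Λ⌋ := Int.le_floor.2 (by push_cast; linarith)
    omega
  · exact Int.le_floor.2 h.2

theorem card_le_of_key {α β : Type*} [DecidableEq β] (S : Finset α) (f : α → β) (D : Finset β)
    (hf : ∀ z ∈ S, f z ∈ D) (n : ℕ) (h : ∀ b ∈ D, (S.filter fun z => f z = b).card ≤ n) :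
    S.card ≤ n * D.card := by
  exact Finset.card_le_mul_card_image_of_maps_to hf n h

theorem fiber_m (D d2 k : ℕ) (hD : 1 ≤ D) (ψ : ℚ[X]) (hψ : ψ.natDegree ≤ k) (m : ℤ) (hm : m ≠ 0)
    (S : Finset Pt) (Λ B : ℝ) (hΛ : 1 ≤ Λ) (hS : ∀ z ∈ S, Good Λ B z) (hT : Set.InjOn Pt.T S)
    (h : ∀ z ∈ S, (z.q:ℚ)^D * ψ.eval z.T = (m:ℚ)^d2) :
    (S.card : ℝ) ≤ (k + 2) * (3*Λ) := by
  classical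
  have key : S.card ≤ (k+2) * (Finset.Icc (-⌊Λ⌋) ⌊Λ⌋).card := by
    by_cases hd : ψ.natDegree = 0
    · refine card_le_of_key S Pt.p _ (fun z hz => mem_Icc_floor _ _ (hS z hz).hp) _ ?_
      intro p _
      have hmem : ∀ z ∈ S.filter (fun z => z.p = p), z ∈ S ∧ z.p = p := fun z hz => Finset.mem_filter.1 hz
      obtain h0 | ⟨z0, hz0⟩ := (S.filter (fun z => z.p = p)).eq_empty_or_nonempty
      · rw [h0]; simp
      have h1 : ((S.filter (fun z => z.p = p)).image Pt.q).card ≤ 2 := by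
        refine (Finset.card_le_card ?_).trans (Finset.card_le_two (a := z0.q) (b := -z0.q))
        intro q hq
        obtain ⟨z, hz, rfl⟩ := Finset.mem_image.1 hq
        have e1 := h z (hmem z hz).1
        have e2 := h z0 (hmem z0 hz0).1
        rw [eq_C_of_natDegree_eq_zero hd, eval_C] at e1 e2
        have hc : ψ.coeff 0 ≠ 0 := by
          intro h0; rw [h0, mul_zero] at e1
          exact (pow_ne_zero d2 (by exact_mod_cast hm : (m:ℚ) ≠ 0)) e1.symm
        have e3 : (z.q:ℚ)^D = (z0.q:ℚ)^D := mul_right_cancel₀ hc (e1.trans e2.symm)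
        have e4 : |z.q| = |z0.q| := by
          have : |(z.q:ℚ)|^D = |(z0.q:ℚ)|^D := by rw [← abs_pow, ← abs_pow, e3]
          have := (pow_left_inj₀ (abs_nonneg _) (abs_nonneg _) (by omega)).1 this
          exact_mod_cast this
        rcases abs_eq_abs.1 e4 with h | h <;> simp [h]
      rw [Finset.card_image_of_injOn] at h1
      · omega
      · intro z hz z' hz' hq
        refine hT (hmem z hz).1 (hmem z' hz').1 ?_
        unfold Pt.T
        rw [(hmem z hz).2, (hmem z' hz').2, hq]
    · refine card_le_of_key S Pt.q _ (fun z hz => mem_Icc_floor _ _ (hS z hz).hq) _ ?_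
      intro q _
      have hmem : ∀ z ∈ S.filter (fun z => z.q = q), z ∈ S ∧ z.q = q := fun z hz => Finset.mem_filter.1 hz
      rw [← Finset.card_image_of_injOn (hT.mono (fun z hz => (hmem z hz).1) : Set.InjOn Pt.T (S.filter (fun z => z.q = q)))]
      set Q := ψ - C ((m:ℚ)^d2/(q:ℚ)^D) with hQ
      have hQd : Q.natDegree = ψ.natDegree := natDegree_sub_C
      have hQ0 : Q ≠ 0 := by
        intro h0; rw [h0] at hQd; simp at hQd; omega
      have : Q.natDegree ≤ k + 2 := by omega
      refine le_trans (Finset.card_le_card ?_) ((Multiset.toFinset_card_le Q.roots).trans ((card_roots' Q).trans this))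
      intro T hT'
      obtain ⟨z, hz, rfl⟩ := Finset.mem_image.1 hT'
      rw [Multiset.mem_toFinset, mem_roots hQ0, IsRoot, hQ, eval_sub, eval_C, sub_eq_zero]
      have e1 := h z (hmem z hz).1
      have hq0 : (q:ℚ) ≠ 0 := by rw [← (hmem z hz).2]; exact_mod_cast (hS z (hmem z hz).1).q0
      rw [(hmem z hz).2] at e1
      rw [eq_div_iff (pow_ne_zero _ hq0), ← e1]; ring
  have h2 := card_Icc_le Λ hΛ
  calc (S.card:ℝ) ≤ ((k+2) * (Finset.Icc (-⌊Λ⌋) ⌊Λ⌋).card : ℕ) := by exact_mod_cast key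
    _ = (k+2) * (((Finset.Icc (-⌊Λ⌋) ⌊Λ⌋).card : ℕ) : ℝ) := by push_cast; ring
    _ ≤ _ := by gcongr

theorem linear_case (k d1 d2 : ℕ) (hd1 : 1 ≤ d1) (ε : ℝ) (hε : 0 < ε) :
    ∃ C : ℝ, 0 < C ∧ ∀ Λ B : ℝ, 1 ≤ Λ → Λ ≤ B → ∀ (S : Finset Pt) (g : Fin (k+1) × Fin (1+1) → ℤ) (φ : ℚ[X][X]),
    (∀ z ∈ S, Good Λ B z) → Set.InjOn Pt.T S → (∀ z ∈ S, (Gp k 1 g).evalEval z.T z.U = 0) →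
    (∀ x, |(g x : ℝ)| ≤ (((k+1)*(1+1):ℕ) * (Λ^k*B^1))^((k+1)*(1+1))) →
    Irreducible (Gp k 1 g) → (Gp k 1 g).natDegree = 1 → tdeg (Gp k 1 g) = k →
    φ.natDegree ≤ d2 → (∀ j, (φ.coeff j).natDegree ≤ d1) →
    (∀ z ∈ S, (z.q:ℚ)^d1*(z.s:ℚ)^d2*φ.evalEval z.T z.U = 1) → (S.card : ℝ) ≤ C * B^ε * Λ := by
  classical
  set N := (k+1)*(1+1) with hN
  have hN1 : 1 ≤ N := Nat.mul_pos (by omega) (by omega)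
  set c1 : ℕ := (2*k).factorial * (N^N)^(4*k+1) with hc1
  set c2 : ℕ := (k+1)*N*(4*k+1) with hc2
  have hc2' : 0 < c2 := by positivity
  have hc1' : 0 < c1 := by positivity
  obtain ⟨C0, hC0, hC0b⟩ := divisor_bound (ε/c2) (by positivity)
  refine ⟨2 * (C0 * (c1:ℝ)^(ε/c2)) * (((d1 + k*d2 : ℕ) + 2)*3), by positivity, ?_⟩
  intro Λ B hΛ hΛB S g φ hS hT hv hg hG hGl hGk hφ hφ1 hφv
  have hB : 1 ≤ B := hΛ.trans hΛB
  let a : ℤ[X] := ∑ i : Fin (k+1), monomial (i:ℕ) (g (i,0))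
  let b : ℤ[X] := ∑ i : Fin (k+1), monomial (i:ℕ) (g (i,1))
  have hcoefg : ∀ (j : Fin (1+1)) (n : ℕ), (∑ i : Fin (k+1), monomial (i:ℕ) (g (i,j))).coeff n =
      if h : n < k+1 then g (⟨n,h⟩,j) else 0 := by
    intro j n
    rw [finsetSum_coeff]
    split_ifs with h
    · rw [Finset.sum_eq_single ⟨n,h⟩]
      · simp
      · intro i _ hi
        rw [coeff_monomial, if_neg]
        intro h'; exact hi (Fin.ext h')
      · simp
    · refine Finset.sum_eq_zero fun i _ => ?_
      rw [coeff_monomial, if_neg]; omega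
  have hdegg : ∀ j : Fin (1+1), (∑ i : Fin (k+1), monomial (i:ℕ) (g (i,j))).natDegree ≤ k := by
    intro j
    apply natDegree_sum_le_of_forall_le
    intro i _; exact (natDegree_monomial_le _).trans (by omega)
  have hGa : (Gp k 1 g).coeff 0 = a.map (Int.castRingHom ℚ) := by
    ext n
    rw [coeff_map, hcoefg]
    split_ifs with h
    · exact Gp_coeff k 1 g (⟨n,h⟩,0)
    · rw [map_zero]; exact coeff_eq_zero_of_natDegree_lt (lt_of_le_of_lt (Gp_coeff_natDegree k 1 g 0) (by omega))
  have hGb : (Gp k 1 g).coeff 1 = b.map (Int.castRingHom ℚ) := by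
    ext n
    rw [coeff_map, hcoefg]
    split_ifs with h
    · exact Gp_coeff k 1 g (⟨n,h⟩,1)
    · rw [map_zero]; exact coeff_eq_zero_of_natDegree_lt (lt_of_le_of_lt (Gp_coeff_natDegree k 1 g 1) (by omega))
  have hcop : IsCoprime (a.map (Int.castRingHom ℚ)) (b.map (Int.castRingHom ℚ)) := by
    rw [← EuclideanDomain.gcd_isUnit_iff]
    have hprim : (Gp k 1 g).IsPrimitive := hG.isPrimitive (by omega)
    apply hprim
    rw [C_dvd_iff_dvd_coeff]
    intro j
    rcases j with _ | _ | j
    · rw [hGa]; exact EuclideanDomain.gcd_dvd_left _ _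
    · rw [hGb]; exact EuclideanDomain.gcd_dvd_right _ _
    · rw [coeff_eq_zero_of_natDegree_lt (by omega)]; exact dvd_zero _
  have hc : a.coeff k ≠ 0 ∨ b.coeff k ≠ 0 := by
    by_contra hcon
    push Not at hcon
    have h0 : ∀ j, ((Gp k 1 g).coeff j).coeff k = 0 := by
      intro j
      rcases j with _ | _ | j
      · rw [hGa, coeff_map, hcon.1]; simp
      · rw [hGb, coeff_map, hcon.2]; simp
      · rw [coeff_eq_zero_of_natDegree_lt (p := Gp k 1 g) (by omega), coeff_zero]
    rcases Nat.eq_zero_or_pos k with hk | hk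
    · apply hG.ne_zero
      ext j i
      rw [coeff_zero, coeff_zero]
      rcases Nat.eq_zero_or_pos i with hi | hi
      · have := h0 j; rw [show i = k by omega]; exact this
      · exact coeff_eq_zero_of_natDegree_lt (lt_of_le_of_lt (Gp_coeff_natDegree k 1 g j) (by omega))
    · have : tdeg (Gp k 1 g) ≤ k - 1 := by
        apply tdeg_le
        intro j
        rw [natDegree_le_iff_coeff_eq_zero]
        intro n hn
        rcases Nat.lt_or_ge k n with h | h
        · exact coeff_eq_zero_of_natDegree_lt (lt_of_le_of_lt (Gp_coeff_natDegree k 1 g j) h)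
        · have : n = k := by omega
          rw [this]; exact h0 j
      omega
  set M : ℝ := (N * (Λ^k*B^1))^N with hM
  have hNr : (1:ℝ) ≤ N := by exact_mod_cast hN1
  have hM1 : 1 ≤ M := one_le_pow₀ (one_le_mul_of_one_le_of_one_le hNr
    (one_le_mul_of_one_le_of_one_le (one_le_pow₀ hΛ) (one_le_pow₀ hB)))
  have hMg : ∀ (j : Fin (1+1)) (n : ℕ), |(((∑ i : Fin (k+1), monomial (i:ℕ) (g (i,j))).coeff n : ℤ) : ℝ)| ≤ M := by
    intro j n
    rw [hcoefg]
    split_ifs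
    · exact hg _
    · simp; linarith
  obtain ⟨N0, hN00, hN0b, hN0d⟩ := exists_N0 k a b (hdegg 0) (hdegg 1) hc hcop M hM1 (hMg 0) (hMg 1)
  have hmz : ∀ z ∈ S, ∃ m : ℤ, homg k b z.p z.q = z.s * m ∧ homg k a z.p z.q = - z.r * m := by
    intro z hz
    have hgd := hS z hz
    have h1 := sum_mon k 1 z hgd.q0 hgd.s0 g
    rw [hv z hz, mul_zero] at h1
    have h2 : (∑ x, g x * z.mon k 1 x : ℤ) = 0 := by exact_mod_cast h1
    have h3 : (∑ x, g x * z.mon k 1 x : ℤ) = homg k a z.p z.q * z.s + homg k b z.p z.q * z.r := by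
      rw [Fintype.sum_prod_type, homg, homg, Finset.sum_mul, Finset.sum_mul, ← Finset.sum_add_distrib, Finset.sum_range]
      refine Finset.sum_congr rfl fun i _ => ?_
      rw [hcoefg, hcoefg, dif_pos i.2, dif_pos i.2]
      rw [Fin.sum_univ_two]
      simp [Pt.mon]
      ring
    rw [h3] at h2
    have h4 : z.s ∣ homg k b z.p z.q := by
      apply hgd.crs.symm.dvd_of_dvd_mul_right
      exact ⟨- homg k a z.p z.q, by linear_combination h2⟩
    obtain ⟨m, hm⟩ := h4
    refine ⟨m, hm, ?_⟩
    rw [hm] at h2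
    have : z.s * (homg k a z.p z.q + z.r * m) = 0 := by linear_combination h2
    rcases mul_eq_zero.1 this with h | h
    · exact absurd h hgd.s0
    · linear_combination h
  choose! m hm1 hm2 using hmz
  have hmd : ∀ z ∈ S, m z ∣ N0 := fun z hz => hN0d z.p z.q (m z) (hS z hz).q0 (hS z hz).cpq
    ⟨-z.r, by rw [hm2 z hz]; ring⟩ ⟨z.s, by rw [hm1 z hz]; ring⟩
  have hm0 : ∀ z ∈ S, m z ≠ 0 := fun z hz h => hN00 (by have := hmd z hz; rwa [h, zero_dvd_iff] at this)
  set a' := a.map (Int.castRingHom ℚ) with ha'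
  set b' := b.map (Int.castRingHom ℚ) with hb'
  have hda : a'.natDegree ≤ k := natDegree_map_le.trans (hdegg 0)
  have hdb : b'.natDegree ≤ k := natDegree_map_le.trans (hdegg 1)
  let ψ : ℚ[X] := ∑ j ∈ Finset.range (d2+1), φ.coeff j * ((-a')^j * b'^(d2-j))
  have hψ : ψ.natDegree ≤ d1 + k*d2 := by
    apply natDegree_sum_le_of_forall_le
    intro j hj
    have hj' := Finset.mem_range.1 hj
    refine natDegree_mul_le.trans (add_le_add (hφ1 j) ?_)
    refine natDegree_mul_le.trans ?_
    have e1 : ((-a')^j).natDegree ≤ j * k := natDegree_pow_le.trans (by rw [natDegree_neg]; gcongr)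
    have e2 : (b'^(d2-j)).natDegree ≤ (d2-j)*k := natDegree_pow_le.trans (by gcongr)
    refine (add_le_add e1 e2).trans (le_of_eq ?_)
    rw [← add_mul, mul_comm]; congr 1; omega
  have hψv : ∀ z ∈ S, (z.q:ℚ)^(d1+k*d2) * ψ.eval z.T = (m z:ℚ)^d2 := by
    intro z hz
    have hgd := hS z hz
    have hq : (z.q:ℚ) ≠ 0 := by exact_mod_cast hgd.q0
    have hs : (z.s:ℚ) ≠ 0 := by exact_mod_cast hgd.s0
    have e1 := homg_cast k a (hdegg 0) z.p z.q hgd.q0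
    have e2 := homg_cast k b (hdegg 1) z.p z.q hgd.q0
    rw [hm2 z hz] at e1
    rw [hm1 z hz] at e2
    change _ = _ * a'.eval z.T at e1
    change _ = _ * b'.eval z.T at e2
    push_cast at e1 e2
    have e3 : a'.eval z.T = -((m z:ℚ)/z.q^k * z.r) := by
      field_simp; rw [mul_comm, ← e1]; ring
    have e4 : b'.eval z.T = (m z:ℚ)/z.q^k * z.s := by
      field_simp; rw [mul_comm, ← e2]; ring
    have e5 : ψ.eval z.T = ((m z:ℚ)/z.q^k)^d2 * z.s^d2 * φ.evalEval z.T z.U := by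
      simp only [ψ]
      unfold evalEval
      rw [eval_eq_sum_range' (p := φ) (n := d2+1) (by omega), eval_finsetSum, eval_finsetSum, Finset.mul_sum]
      refine Finset.sum_congr rfl fun j hj => ?_
      have hj' := Finset.mem_range.1 hj
      simp only [eval_mul, eval_pow, eval_neg, e3, e4, eval_C, neg_neg]
      have f1 : ((m z:ℚ)/z.q^k)^d2 = ((m z:ℚ)/z.q^k)^j * ((m z:ℚ)/z.q^k)^(d2-j) := by rw [← pow_add]; congr 1; omega
      have f2 : (z.s:ℚ)^d2 = (z.s:ℚ)^j * (z.s:ℚ)^(d2-j) := by rw [← pow_add]; congr 1; omega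
      have f3 : (z.r:ℚ)^j = z.U^j * z.s^j := by rw [← mul_pow, z.U_mul hgd.s0]
      rw [f1, f2, mul_pow, mul_pow, f3]; ring
    have e6 := hφv z hz
    rw [e5, pow_add, div_pow, ← pow_mul]
    have hqk : (z.q:ℚ)^(k*d2) ≠ 0 := pow_ne_zero _ hq
    field_simp
    linear_combination (m z:ℚ)^d2 * e6
  let Dv : Finset ℤ := (N0.natAbs.divisors.image fun n : ℕ => (n:ℤ)) ∪ (N0.natAbs.divisors.image fun n : ℕ => -(n:ℤ))
  have hDv : (Dv.card : ℝ) ≤ 2 * (C0 * (c1:ℝ)^(ε/c2) * B^ε) := by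
    have h1 : Dv.card ≤ 2 * N0.natAbs.divisors.card := by
      refine (Finset.card_union_le _ _).trans ?_
      have := Finset.card_image_le (s := N0.natAbs.divisors) (f := fun n : ℕ => (n:ℤ))
      have := Finset.card_image_le (s := N0.natAbs.divisors) (f := fun n : ℕ => -(n:ℤ))
      omega
    have h2 := hC0b N0.natAbs (Int.natAbs_ne_zero.2 hN00)
    have h3 : ((N0.natAbs:ℕ):ℝ) ≤ c1 * B^c2 := by
      have e : ((N0.natAbs:ℕ):ℝ) = |(N0:ℝ)| := by rw [← Int.cast_abs, Int.abs_eq_natAbs]; simp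
      rw [e]
      refine hN0b.trans ?_
      have e2 : M ≤ N^N * B^((k+1)*N) := by
        rw [hM]
        calc (N * (Λ^k*B^1))^N ≤ (N * (B^k*B^1))^N := by gcongr
          _ = _ := by rw [← pow_add, mul_pow, ← pow_mul]
      calc _ ≤ ((2*k).factorial:ℝ) * (N^N * B^((k+1)*N))^(4*k+1) := by gcongr
        _ = _ := by rw [hc1, hc2, mul_pow, ← pow_mul B]; push_cast; ring
    have h4 : ((N0.natAbs:ℕ):ℝ)^(ε/c2) ≤ (c1:ℝ)^(ε/c2) * B^ε := by
      calc _ ≤ (c1 * B^c2)^(ε/c2) := by gcongr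
        _ = _ := by
          rw [Real.mul_rpow (by positivity) (by positivity), ← Real.rpow_natCast, ← Real.rpow_mul (by positivity)]
          congr 2; field_simp
    calc (Dv.card:ℝ) ≤ 2 * (N0.natAbs.divisors.card : ℝ) := by exact_mod_cast h1
      _ ≤ 2 * (C0 * ((c1:ℝ)^(ε/c2) * B^ε)) := by
          have := mul_le_mul_of_nonneg_left h4 hC0.le
          linarith
      _ = _ := by ring
  have hmem : ∀ z ∈ S, m z ∈ Dv := by
    intro z hz
    have h1 : (m z).natAbs ∈ N0.natAbs.divisors :=
      Nat.mem_divisors.2 ⟨Int.natAbs_dvd_natAbs.2 (hmd z hz), Int.natAbs_ne_zero.2 hN00⟩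
    simp only [Dv, Finset.mem_union, Finset.mem_image]
    rcases Int.natAbs_eq (m z) with h | h
    · left; exact ⟨_, h1, h.symm⟩
    · right; exact ⟨_, h1, h.symm⟩
  have hfib : ∀ c, ((S.filter fun z => m z = c).card : ℝ) ≤ (((d1 + k*d2 : ℕ):ℝ) + 2) * (3*Λ) := by
    intro c
    have hm' : ∀ z ∈ S.filter (fun z => m z = c), z ∈ S ∧ m z = c := fun z hz => Finset.mem_filter.1 hz
    obtain h0 | ⟨z0, hz0⟩ := (S.filter (fun z => m z = c)).eq_empty_or_nonempty
    · rw [h0]; simp; positivity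
    refine fiber_m (d1+k*d2) d2 (d1+k*d2) (by omega) ψ hψ c ?_ _ Λ B hΛ (fun z hz => hS z (hm' z hz).1)
      (hT.mono (fun z hz => (hm' z hz).1)) ?_
    · rw [← (hm' z0 hz0).2]; exact hm0 z0 (hm' z0 hz0).1
    · intro z hz
      rw [← (hm' z hz).2]; exact hψv z (hm' z hz).1
  have e1 := Finset.card_eq_sum_card_fiberwise (s := S) (t := Dv) (f := m) hmem
  have e2 : (S.card:ℝ) ≤ Dv.card * ((((d1 + k*d2 : ℕ):ℝ) + 2) * (3*Λ)) := by
    rw [e1]; push_cast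
    refine (Finset.sum_le_card_nsmul _ _ _ (fun c _ => hfib c)).trans (le_of_eq ?_)
    push_cast
    rw [nsmul_eq_mul]
  calc (S.card:ℝ) ≤ _ := e2
    _ ≤ (2 * (C0 * (c1:ℝ)^(ε/c2) * B^ε)) * ((((d1 + k*d2 : ℕ):ℝ) + 2) * (3*Λ)) := by gcongr
    _ = _ := by ring

open Polynomial

theorem isUnit_of_degs (H : ℚ[X][X]) (h0 : H ≠ 0) (h1 : H.natDegree = 0) (h2 : tdeg H = 0) : IsUnit H := by
  have e6 : (H.coeff 0).natDegree = 0 := by have := coeff_natDegree_le_tdeg H 0; omega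
  have e7 : H = C (C ((H.coeff 0).coeff 0)) := by
    rw [← eq_C_of_natDegree_eq_zero e6, ← eq_C_of_natDegree_eq_zero h1]
  rw [e7, isUnit_C, isUnit_C, isUnit_iff_ne_zero]
  intro h; rw [h] at e7; simp at e7; exact h0 e7

def CurveHyp (d1 d2 : ℕ) (Λ B : ℝ) (φ : ℚ[X][X]) (S : Finset Pt) : Prop :=
  (∀ z ∈ S, Good Λ B z) ∧ Set.InjOn Pt.T S ∧ φ.natDegree ≤ d2 ∧ (∀ j, (φ.coeff j).natDegree ≤ d1) ∧
    (∀ z ∈ S, (z.q:ℚ)^d1*(z.s:ℚ)^d2*φ.evalEval z.T z.U = 1)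

theorem CurveHyp.mono {d1 d2 Λ B φ S S'} (h : CurveHyp d1 d2 Λ B φ S) (hs : S' ⊆ S) : CurveHyp d1 d2 Λ B φ S' :=
  ⟨fun z hz => h.1 z (hs hz), h.2.1.mono hs, h.2.2.1, h.2.2.2.1, fun z hz => h.2.2.2.2 z (hs hz)⟩

theorem irr_case_fix (k l d1 d2 : ℕ) (hd1 : 1 ≤ d1) (ε : ℝ) (hε : 0 < ε) :
    ∃ C : ℝ, 0 < C ∧ ∀ Λ B : ℝ, 1 ≤ Λ → Λ ≤ B → ∀ (S : Finset Pt) (φ G : ℚ[X][X]),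
    CurveHyp d1 d2 Λ B φ S → Irreducible G → G.natDegree = l → tdeg G = k →
    (∀ z ∈ S, G.evalEval z.T z.U = 0) → (S.card : ℝ) ≤ C * B^ε * Λ := by
  have hone : ∀ Λ B : ℝ, 1 ≤ Λ → Λ ≤ B → 1 ≤ B^ε*Λ := fun Λ B h1 h2 =>
    one_le_mul_of_one_le_of_one_le (Real.one_le_rpow (h1.trans h2) hε.le) h1
  have hcst : ∀ (c : ℕ) (C Λ B : ℝ), 0 ≤ C → 1 ≤ Λ → Λ ≤ B → (c:ℝ) ≤ (c + C) * B^ε * Λ := by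
    intro c C Λ B hC h1 h2
    have := hone Λ B h1 h2
    nlinarith [(Nat.cast_nonneg c : (0:ℝ) ≤ c)]
  rcases Nat.lt_or_ge l 1 with hl | hl
  · refine ⟨k + 1, by positivity, ?_⟩
    intro Λ B hΛ hΛB S φ G hS hG hGl hGk hv
    have h0 : G = C (G.coeff 0) := eq_C_of_natDegree_eq_zero (by omega)
    have hc : G.coeff 0 ≠ 0 := by intro h; rw [h] at h0; simp at h0; exact hG.ne_zero h0
    refine le_trans ?_ (hcst k 1 Λ B zero_le_one hΛ hΛB)
    have : S.card ≤ k := by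
      rw [← Finset.card_image_of_injOn hS.2.1]
      refine le_trans (Finset.card_le_card ?_) ((Multiset.toFinset_card_le (G.coeff 0).roots).trans
        ((card_roots' _).trans (hGk ▸ coeff_natDegree_le_tdeg G 0)))
      intro T hT'
      obtain ⟨z, hz, rfl⟩ := Finset.mem_image.1 hT'
      rw [Multiset.mem_toFinset, mem_roots hc, IsRoot]
      have := hv z hz
      rw [h0] at this
      rwa [evalEval_C] at this
    exact_mod_cast this
  · rcases Nat.lt_or_ge l 2 with hl2 | hl2
    · obtain rfl : l = 1 := by omega
      obtain ⟨C, hC, h⟩ := linear_case k d1 d2 hd1 ε hε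
      refine ⟨((1+1)*k : ℕ) + C, by positivity, ?_⟩
      intro Λ B hΛ hΛB S φ G hS hG hGl hGk hv
      rcases intver k 1 S Λ B hΛ (hΛ.trans hΛB) hS.1 hS.2.1 G hG le_rfl hGl hGk hv with h1 | ⟨g, g1, g2, g3, g4, g5⟩
      · refine le_trans (by exact_mod_cast h1) (hcst _ C Λ B hC.le hΛ hΛB)
      · refine (h Λ B hΛ hΛB S g φ hS.1 hS.2.1 g5 g1 g2 g3 g4 hS.2.2.1 hS.2.2.2.1 hS.2.2.2.2).trans ?_
        have hB : 0 < B := by linarith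
        exact mul_le_mul_of_nonneg_right (mul_le_mul_of_nonneg_right (le_add_of_nonneg_left (Nat.cast_nonneg _)) (by positivity)) (by linarith)
    · obtain ⟨C, hC, h⟩ := padic_case k l hl2 ε hε
      refine ⟨((l+l)*k : ℕ) + C, by positivity, ?_⟩
      intro Λ B hΛ hΛB S φ G hS hG hGl hGk hv
      rcases intver k l S Λ B hΛ (hΛ.trans hΛB) hS.1 hS.2.1 G hG hl hGl hGk hv with h1 | ⟨g, g1, g2, g3, g4, g5⟩
      · refine le_trans (by exact_mod_cast h1) (hcst _ C Λ B hC.le hΛ hΛB)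
      · refine (h Λ B hΛ hΛB S g hS.1 hS.2.1 g5 g1 g2 g3).trans ?_
        have hB : 0 < B := by linarith
        exact mul_le_mul_of_nonneg_right (mul_le_mul_of_nonneg_right (le_add_of_nonneg_left (Nat.cast_nonneg _)) (by positivity)) (by linarith)

theorem curve_count (k d1 d2 : ℕ) (hd1 : 1 ≤ d1) (ε : ℝ) (hε : 0 < ε) :
    ∃ C : ℝ, 0 < C ∧ ∀ Λ B : ℝ, 1 ≤ Λ → Λ ≤ B → ∀ (S : Finset Pt) (φ G : ℚ[X][X]),
    CurveHyp d1 d2 Λ B φ S → G ≠ 0 → G.natDegree ≤ k → (∀ j, (G.coeff j).natDegree ≤ k) →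
    (∀ z ∈ S, G.evalEval z.T z.U = 0) → (S.card : ℝ) ≤ C * B^ε * Λ := by
  classical
  choose c hc h using fun k l => irr_case_fix k l d1 d2 hd1 ε hε
  set C := ∑ x ∈ Finset.range (k+1) ×ˢ Finset.range (k+1), c x.1 x.2 with hC
  have hC0 : 0 < C := Finset.sum_pos (fun x _ => hc _ _) ⟨(0,0), by simp⟩
  have hcC : ∀ a b, a ≤ k → b ≤ k → c a b ≤ C := fun a b ha hb =>
    Finset.single_le_sum (f := fun x : ℕ × ℕ => c x.1 x.2) (fun x _ => (hc _ _).le)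
      (show (a,b) ∈ Finset.range (k+1) ×ˢ Finset.range (k+1) by simp; omega)
  have main : ∀ G : ℚ[X][X], G ≠ 0 → G.natDegree ≤ k → tdeg G ≤ k → ∀ Λ B : ℝ, 1 ≤ Λ → Λ ≤ B →
      ∀ (S : Finset Pt) (φ : ℚ[X][X]), CurveHyp d1 d2 Λ B φ S → (∀ z ∈ S, G.evalEval z.T z.U = 0) →
      (S.card:ℝ) ≤ (G.natDegree + tdeg G : ℕ) * (C * B^ε*Λ) := by
    intro G
    induction G using WfDvdMonoid.induction_on_irreducible with
    | zero => intro h; exact absurd rfl h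
    | unit u hu =>
      intro _ _ _ Λ B hΛ hΛB S φ hS hv
      have : S = ∅ := by
        rw [Finset.eq_empty_iff_forall_notMem]
        intro z hz
        have h1 := hv z hz
        have h2 := hu.map (evalEvalRingHom z.T z.U)
        rw [coe_evalEvalRingHom, h1] at h2
        simp at h2
      rw [this]; simp
      have : 0 < B := by linarith
      positivity
    | mul a i ha hi ih =>
      intro _ hdn hdt Λ B hΛ hΛB S φ hS hv
      have hB : 0 < B := by linarith
      rw [natDegree_mul hi.ne_zero ha] at hdn ⊢
      rw [tdeg_mul _ _ hi.ne_zero ha] at hdt ⊢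
      have hi1 : 1 ≤ i.natDegree + tdeg i := by
        by_contra hcon
        exact hi.not_isUnit (isUnit_of_degs i hi.ne_zero (by omega) (by omega))
      have h1 := h _ _ Λ B hΛ hΛB (S.filter fun z => i.evalEval z.T z.U = 0) φ i
        (hS.mono (Finset.filter_subset _ _)) hi rfl rfl (fun z hz => (Finset.mem_filter.1 hz).2)
      have h2 := ih ha (by omega) (by omega) Λ B hΛ hΛB (S.filter fun z => a.evalEval z.T z.U = 0) φ
        (hS.mono (Finset.filter_subset _ _)) (fun z hz => (Finset.mem_filter.1 hz).2)
      have h3 : S.card ≤ (S.filter fun z => i.evalEval z.T z.U = 0).card + (S.filter fun z => a.evalEval z.T z.U = 0).card := by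
        refine (Finset.card_le_card ?_).trans (Finset.card_union_le _ _)
        intro z hz
        have := hv z hz
        rw [evalEval_mul] at this
        rcases mul_eq_zero.1 this with h | h
        · exact Finset.mem_union_left _ (Finset.mem_filter.2 ⟨hz, h⟩)
        · exact Finset.mem_union_right _ (Finset.mem_filter.2 ⟨hz, h⟩)
      have h4 : (S.card:ℝ) ≤ (S.filter fun z => i.evalEval z.T z.U = 0).card + (S.filter fun z => a.evalEval z.T z.U = 0).card := by
        exact_mod_cast h3
      have h5 : c (tdeg i) i.natDegree * B^ε*Λ ≤ C * B^ε*Λ := by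
        have := hcC (tdeg i) i.natDegree (by omega) (by omega)
        gcongr
      have h6 : C * B^ε*Λ ≤ ((i.natDegree + tdeg i : ℕ):ℝ) * (C * B^ε*Λ) :=
        le_mul_of_one_le_left (by positivity) (by exact_mod_cast hi1)
      calc (S.card:ℝ) ≤ _ := h4
        _ ≤ ((i.natDegree + tdeg i : ℕ):ℝ) * (C * B^ε*Λ) + ((a.natDegree + tdeg a : ℕ):ℝ) * (C * B^ε*Λ) := by
            linarith
        _ = _ := by push_cast; ring
  refine ⟨(k + k + 1) * C, by positivity, ?_⟩
  intro Λ B hΛ hΛB S φ G hS hG hGl hGk hv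
  have hB : 0 < B := by linarith
  have htd := tdeg_le G k hGk
  refine (main G hG hGl htd Λ B hΛ hΛB S φ hS hv).trans ?_
  have : ((G.natDegree + tdeg G : ℕ):ℝ) ≤ k + k + 1 := by exact_mod_cast (by omega)
  calc _ ≤ (k+k+1:ℝ) * (C * B^ε*Λ) := by gcongr
    _ = _ := by ring

open Polynomial

theorem sum_pos1 (N : ℕ) : ∀ y : ℝ, ∑ β ∈ Finset.range N, max (y - β) 0 ≤ (max (y+1) 0)^2/2 := by
  induction N with
  | zero => intro y; simp; positivity
  | succ N ih =>
    intro y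
    rw [Finset.sum_range_succ']
    have h := ih (y-1)
    have e : ∑ β ∈ Finset.range N, max (y - ((β+1:ℕ):ℝ)) 0 = ∑ β ∈ Finset.range N, max (y - 1 - β) 0 :=
      Finset.sum_congr rfl fun β _ => by push_cast; congr 1; ring
    rw [e]
    rw [sub_add_cancel] at h
    simp only [Nat.cast_zero, sub_zero]
    refine (add_le_add_left h _).trans ?_
    rcases le_total 0 y with hy | hy
    · rw [max_eq_left hy, max_eq_left (by linarith)]; nlinarith
    · rw [max_eq_right hy]; simp; positivity

theorem sum_pos2 (μ : ℝ) (hμ : 0 < μ) (N : ℕ) :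
    ∀ y : ℝ, ∑ α ∈ Finset.range N, (max (y - α * μ) 0)^2 ≤ (max (y+μ) 0)^3/(3*μ) := by
  induction N with
  | zero => intro y; simp; positivity
  | succ N ih =>
    intro y
    rw [Finset.sum_range_succ']
    have h := ih (y-μ)
    have e : ∑ β ∈ Finset.range N, (max (y - ((β+1:ℕ):ℝ)*μ) 0)^2 = ∑ β ∈ Finset.range N, (max (y - μ - β*μ) 0)^2 :=
      Finset.sum_congr rfl fun β _ => by push_cast; congr 2; ring
    rw [e]
    rw [sub_add_cancel] at h
    simp only [Nat.cast_zero, zero_mul, sub_zero]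
    refine (add_le_add_left h _).trans ?_
    rcases le_total 0 y with hy | hy
    · rw [max_eq_left hy, max_eq_left (by linarith), le_div_iff₀ (by positivity), add_mul, div_mul_cancel₀ _ (by positivity)]
      nlinarith [mul_nonneg hy hμ.le, mul_nonneg hy (mul_nonneg hμ.le hμ.le), pow_pos hμ 3]
    · rw [max_eq_right hy]; simp; positivity

theorem weight_sum {ι : Type*} [Fintype ι] (p : ι → ℕ × ℕ) (hp : Function.Injective p) (μ w : ℝ) (hμ : 0 < μ) (hw : 0 ≤ w) :
    w * Fintype.card ι - (w+1+μ)^3/(6*μ) ≤ ∑ i, (((p i).1:ℝ)*μ + (p i).2) := by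
  classical
  obtain ⟨N, hN⟩ : ∃ N : ℕ, ∀ i, (p i).1 < N ∧ (p i).2 < N := by
    refine ⟨∑ i, ((p i).1 + (p i).2) + 1, fun i => ?_⟩
    have := Finset.single_le_sum (f := fun i => (p i).1 + (p i).2) (fun _ _ => Nat.zero_le _) (Finset.mem_univ i)
    omega
  have h1 : ∑ i, (w - ((p i).1:ℝ)*μ - (p i).2) ≤ ∑ i, max (w - ((p i).1:ℝ)*μ - (p i).2) 0 :=
    Finset.sum_le_sum fun i _ => le_max_left _ _
  have h2 : ∑ i, max (w - ((p i).1:ℝ)*μ - (p i).2) 0 ≤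
      ∑ q ∈ Finset.range N ×ˢ Finset.range N, max (w - (q.1:ℝ)*μ - q.2) 0 := by
    rw [← Finset.sum_image (f := fun q : ℕ × ℕ => max (w - (q.1:ℝ)*μ - q.2) 0) (hp.injOn)]
    refine Finset.sum_le_sum_of_subset_of_nonneg ?_ fun _ _ _ => le_max_right _ _
    intro q hq
    obtain ⟨i, -, rfl⟩ := Finset.mem_image.1 hq
    simp [hN i]
  rw [Finset.sum_product] at h2
  have h3 : ∑ α ∈ Finset.range N, ∑ β ∈ Finset.range N, max (w - (α:ℝ)*μ - β) 0 ≤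
      ∑ α ∈ Finset.range N, (max (w + 1 - α*μ) 0)^2/2 := by
    refine Finset.sum_le_sum fun α _ => (sum_pos1 N _).trans (le_of_eq ?_)
    congr 3; ring
  rw [← Finset.sum_div] at h3
  have h4 := sum_pos2 μ hμ N (w+1)
  rw [max_eq_left (by positivity)] at h4
  have h5 : ∑ i, (w - ((p i).1:ℝ)*μ - (p i).2) = w * Fintype.card ι - ∑ i, (((p i).1:ℝ)*μ + (p i).2) := by
    rw [Finset.sum_congr rfl (fun i _ => sub_sub w _ _), Finset.sum_sub_distrib]
    simp [mul_comm]
  have h6 : (w+1+μ)^3/(3*μ)/2 = (w+1+μ)^3/(6*μ) := by field_simp; norm_num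
  linarith

def mexp : Fin 4 → ℕ × ℕ := ![(0,0),(1,0),(2,0),(0,1)]

def mv (m : Fin 4) (u v : ℝ) : ℝ := u^(mexp m).1 * v^(mexp m).2

theorem prod_sel (k : ℕ) (i : Fin (k+1)) (a b : ℝ) :
    ∏ t : Fin k, (if (t:ℕ) < i then b else a) = a^(k-(i:ℕ)) * b^(i:ℕ) := by
  rw [Finset.prod_ite, Finset.prod_const, Finset.prod_const, mul_comm]
  have h : (Finset.univ.filter fun t : Fin k => (t:ℕ) < i).card = i := by
    rw [Fin.card_filter_val_lt]; have := i.2; omega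
  have h2 := Finset.card_filter_add_card_filter_not (s := (Finset.univ : Finset (Fin k))) (fun t : Fin k => (t:ℕ) < i)
  simp only [Finset.card_univ, Fintype.card_fin] at h2
  rw [h]; congr 2; omega

theorem real_det (k : ℕ) (K : ℝ) (hK : 1 ≤ K) : ∃ Ck : ℝ, 0 < Ck ∧
    ∀ (L x μ w : ℝ), 0 < L → 1 ≤ x → 0 < μ → 0 ≤ w →
    ∀ (cA cB cC cD : Fin 4 → ℝ), (∀ m, |cA m| ≤ K) → (∀ m, |cB m| ≤ K) → (∀ m, |cC m| ≤ K) → (∀ m, |cD m| ≤ K) →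
    ∀ (l1 l2 u v : Fin (k+1) × Fin (k+1) → ℝ), (∀ i, |l1 i * l2 i| ≤ L) → (∀ i, |u i| ≤ x^(-μ)) → (∀ i, |v i| ≤ x^(-1:ℝ)) →
    |(Matrix.of fun i j : Fin (k+1) × Fin (k+1) =>
      ((l1 i * ∑ m, cA m * mv m (u i) (v i))^(k-(j.1:ℕ)) * (l1 i * ∑ m, cB m * mv m (u i) (v i))^(j.1:ℕ)) *
      ((l2 i * ∑ m, cC m * mv m (u i) (v i))^(k-(j.2:ℕ)) * (l2 i * ∑ m, cD m * mv m (u i) (v i))^(j.2:ℕ))).det| ≤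
    Ck * (L^k)^((k+1)^2) * x^(-(w*(k+1)^2 - (w+1+μ)^3/(6*μ))) := by
  classical
  set κ := Fin k ⊕ Fin k → Fin 4
  set H := Fin (k+1) × Fin (k+1)
  have hH : Fintype.card H = (k+1)^2 := by simp [H, sq]
  refine ⟨∑ r : H → κ, (K^(2*k))^((k+1)^2) * ((k+1)^2).factorial, Finset.sum_pos (fun r _ => by positivity) Finset.univ_nonempty, ?_⟩
  intro L x μ w hL hx hμ hw cA cB cC cD hA hB hC hD l1 l2 u v hl hu hv
  let co : H → Fin k ⊕ Fin k → Fin 4 → ℝ := fun j t m =>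
    Sum.elim (fun t : Fin k => if (t:ℕ) < j.1 then cB m else cA m) (fun t : Fin k => if (t:ℕ) < j.2 then cD m else cC m) t
  have hco : ∀ j t m, |co j t m| ≤ K := by
    intro j t m
    rcases t with t | t
    · simp only [co, Sum.elim_inl]; split_ifs <;> simp [hA, hB]
    · simp only [co, Sum.elim_inr]; split_ifs <;> simp [hC, hD]
  let W : H → κ → ℝ := fun i m => ∏ t, mv (m t) (u i) (v i)
  let c : κ → H → ℝ := fun m j => ∏ t, co j t (m t)
  have hent : ∀ i j : H, ((l1 i * ∑ m, cA m * mv m (u i) (v i))^(k-(j.1:ℕ)) * (l1 i * ∑ m, cB m * mv m (u i) (v i))^(j.1:ℕ)) *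
      ((l2 i * ∑ m, cC m * mv m (u i) (v i))^(k-(j.2:ℕ)) * (l2 i * ∑ m, cD m * mv m (u i) (v i))^(j.2:ℕ)) =
      (l1 i * l2 i)^k * ∑ m, W i m * c m j := by
    intro i j
    have e1 : ∑ m, W i m * c m j = ∏ t, ∑ m : Fin 4, co j t m * mv m (u i) (v i) := by
      rw [Fintype.prod_sum]
      refine Finset.sum_congr rfl fun m _ => ?_
      rw [Finset.prod_mul_distrib, mul_comm]
    have e2 : ∏ t, ∑ m : Fin 4, co j t m * mv m (u i) (v i) =
      ((∑ m, cA m * mv m (u i) (v i))^(k-(j.1:ℕ)) * (∑ m, cB m * mv m (u i) (v i))^(j.1:ℕ)) *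
      ((∑ m, cC m * mv m (u i) (v i))^(k-(j.2:ℕ)) * (∑ m, cD m * mv m (u i) (v i))^(j.2:ℕ)) := by
      rw [Fintype.prod_sum_type, ← prod_sel, ← prod_sel]
      congr 1 <;> refine Finset.prod_congr rfl fun t _ => ?_ <;> simp only [co, Sum.elim_inl, Sum.elim_inr] <;> split_ifs <;> rfl
    rw [e1, e2]
    have p1 : ∀ l : ℝ, l^k = l^(k-(j.1:ℕ)) * l^(j.1:ℕ) := fun l => by rw [← pow_add]; congr 1; have := j.1.2; omega
    have p2 : ∀ l : ℝ, l^k = l^(k-(j.2:ℕ)) * l^(j.2:ℕ) := fun l => by rw [← pow_add]; congr 1; have := j.2.2; omega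
    rw [mul_pow (l1 i) (l2 i), p1 (l1 i), p2 (l2 i)]
    simp only [mul_pow]; ring
  have hdet : (Matrix.of fun i j : H =>
      ((l1 i * ∑ m, cA m * mv m (u i) (v i))^(k-(j.1:ℕ)) * (l1 i * ∑ m, cB m * mv m (u i) (v i))^(j.1:ℕ)) *
      ((l2 i * ∑ m, cC m * mv m (u i) (v i))^(k-(j.2:ℕ)) * (l2 i * ∑ m, cD m * mv m (u i) (v i))^(j.2:ℕ))).det =
      (∏ i, (l1 i * l2 i)^k) * ∑ r : H → κ, (∏ j, c (r j) j) * (Matrix.of fun i j => W i (r j)).det := by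
    rw [← det_expand, ← Matrix.det_mul_column]
    congr 1
    ext i j
    simp only [Matrix.of_apply]
    exact hent i j
  rw [hdet, abs_mul, Finset.abs_prod]
  have b1 : ∏ i : H, |(l1 i * l2 i)^k| ≤ (L^k)^((k+1)^2) := by
    calc _ ≤ ∏ i : H, L^k := Finset.prod_le_prod (fun _ _ => abs_nonneg _) (fun i _ => by
            rw [abs_pow]; exact pow_le_pow_left₀ (abs_nonneg _) (hl i) k)
      _ = _ := by rw [Finset.prod_const, Finset.card_univ, hH]
  let ex : κ → ℕ × ℕ := fun m => ∑ t, mexp (m t)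
  have hW : ∀ i m, W i m = (u i)^(ex m).1 * (v i)^(ex m).2 := by
    intro i m
    simp only [W, mv, ex, Prod.fst_sum, Prod.snd_sum]
    rw [Finset.prod_mul_distrib, Finset.prod_pow_eq_pow_sum, Finset.prod_pow_eq_pow_sum]
  have hx0 : 0 < x := by linarith
  have hWb : ∀ r : H → κ, |(Matrix.of fun i j => W i (r j)).det| ≤ ((k+1)^2).factorial * x^(-(w*(k+1)^2 - (w+1+μ)^3/(6*μ))) := by
    intro r
    by_cases hr : Function.Injective fun j => ex (r j)
    · have h1 := abs_det_le_cols (Matrix.of fun i j => W i (r j)) (fun j => x^(-((ex (r j)).1*μ + (ex (r j)).2))) (by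
        intro i j
        rw [Matrix.of_apply, hW, abs_mul, abs_pow, abs_pow, neg_add, Real.rpow_add hx0]
        have q1 : x^(-((ex (r j)).1*μ)) = (x^(-μ))^(ex (r j)).1 := by
          rw [← Real.rpow_natCast, ← Real.rpow_mul hx0.le]; congr 1; ring
        have q2 : x^(-((ex (r j)).2:ℝ)) = (x^(-1:ℝ))^(ex (r j)).2 := by
          rw [← Real.rpow_natCast, ← Real.rpow_mul hx0.le]; congr 1; ring
        rw [q1, q2]
        exact mul_le_mul (pow_le_pow_left₀ (abs_nonneg _) (hu i) _) (pow_le_pow_left₀ (abs_nonneg _) (hv i) _)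
          (by positivity) (by positivity))
      rw [hH] at h1
      refine h1.trans ?_
      rw [← Real.rpow_sum_of_pos hx0]
      refine mul_le_mul_of_nonneg_left (Real.rpow_le_rpow_of_exponent_le hx ?_) (by positivity)
      have := weight_sum (fun j => ex (r j)) hr μ w hμ hw
      rw [hH] at this
      push_cast at this
      rw [Finset.sum_neg_distrib]
      linarith
    · rw [Function.Injective] at hr
      push Not at hr
      obtain ⟨j, j', h, hne⟩ := hr
      rw [Matrix.det_zero_of_column_eq hne (fun i => by simp only [Matrix.of_apply, hW, h])]
      simp; positivity
  have b2 : |∑ r : H → κ, (∏ j, c (r j) j) * (Matrix.of fun i j => W i (r j)).det| ≤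
      ∑ r : H → κ, (K^(2*k))^((k+1)^2) * (((k+1)^2).factorial * x^(-(w*(k+1)^2 - (w+1+μ)^3/(6*μ)))) := by
    refine (Finset.abs_sum_le_sum_abs _ _).trans (Finset.sum_le_sum fun r _ => ?_)
    rw [abs_mul]
    refine mul_le_mul ?_ (hWb r) (abs_nonneg _) (by positivity)
    rw [Finset.abs_prod]
    calc _ ≤ ∏ j : H, K^(2*k) := Finset.prod_le_prod (fun _ _ => abs_nonneg _) (fun j _ => by
            simp only [c]
            rw [Finset.abs_prod]
            calc _ ≤ ∏ t : Fin k ⊕ Fin k, K := Finset.prod_le_prod (fun _ _ => abs_nonneg _) (fun t _ => hco _ _ _)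
              _ = _ := by rw [Finset.prod_const, Finset.card_univ, Fintype.card_sum, Fintype.card_fin, two_mul])
      _ = _ := by rw [Finset.prod_const, Finset.card_univ, hH]
  calc _ ≤ (L^k)^((k+1)^2) * _ := mul_le_mul b1 b2 (abs_nonneg _) (by positivity)
    _ = _ := by
      simp only [← mul_assoc]
      rw [← Finset.sum_mul]; ring

open Polynomial

theorem exp_num_aux (δ z n μ : ℝ) (h0 : 0 < δ) (h1 : δ ≤ 1) (hz : 0 ≤ z) (hz1 : z ≤ 1/12)
    (hn1 : 1 ≤ n) (hkn : 300 ≤ δ * n) (hμ : μ = 1/2+z+δ) :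
    (2/3+z/2)*((n-1)*n^2) - ((1+z)*n*n^2 - ((1+z)*n+1+μ)^3/(6*μ)) ≤ -1 := by
  have hμ1 : 1/2 ≤ μ := by rw [hμ]; linarith
  have hμ2 : μ ≤ 2 := by rw [hμ]; linarith
  have hn3 : 0 ≤ n^3 := by positivity
  have hn2 : 1 ≤ n^2 := one_le_pow₀ hn1
  have hzz : 0 ≤ z*z := mul_nonneg hz hz
  have hc : (1+z)^3/(6*μ) ≤ (2+3*z)/6 - δ/12 := by
    rw [div_le_iff₀ (by positivity)]
    have e : ((2+3*z)/6 - δ/12)*(6*μ) = (2+3*z)*(1/2+z) + (2+3*z)*δ - δ*μ/2 := by rw [hμ]; ring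
    rw [e]
    have h3 : δ*μ ≤ δ*2 := mul_le_mul_of_nonneg_left hμ2 h0.le
    have h4 : z*z*z ≤ z*z*(1/12) := mul_le_mul_of_nonneg_left hz1 hzz
    have h5 : z*z ≤ z*(1/12) := mul_le_mul_of_nonneg_left hz1 hz
    have h6 := mul_nonneg hz h0.le
    linarith
  have hcube : ((1+z)*n+1+μ)^3/(6*μ) ≤ ((2+3*z)/6 - δ/12)*n^3 + 24*n^2 := by
    have h2 : ((1+z)*n+1+μ)^3 ≤ (1+z)^3*n^3 + 70*n^2 := by
      have a1 : ((1+z)*n+1+μ)^3 ≤ ((1+z)*n+3)^3 := by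
        apply pow_le_pow_left₀ (by positivity); linarith
      refine a1.trans ?_
      have a2 : (1+z)^2 ≤ 1.2 := by nlinarith
      have a3 : n ≤ n^2 := by rw [sq]; exact le_mul_of_one_le_left (by linarith) hn1
      have a5 : (1+z)^2*n^2 ≤ 1.2*n^2 := by gcongr
      have a6 : (1+z)*n ≤ 13/12*n^2 := mul_le_mul (by linarith) a3 (by linarith) (by norm_num)
      linarith
    have h3 := mul_le_mul_of_nonneg_right hc hn3
    have h4 : (70*n^2)/(6*μ) ≤ 24*n^2 := by
      rw [div_le_iff₀ (by positivity)]
      have := mul_le_mul_of_nonneg_left hμ1 (by positivity : 0 ≤ 144*n^2)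
      linarith
    have h5 : ((1+z)*n+1+μ)^3/(6*μ) ≤ ((1+z)^3*n^3 + 70*n^2)/(6*μ) := by gcongr
    have h6 : ((1+z)^3*n^3 + 70*n^2)/(6*μ) = (1+z)^3/(6*μ)*n^3 + (70*n^2)/(6*μ) := by ring
    linarith
  have hq : 0 ≤ (2/3+z/2)*n^2 := by positivity
  have hf : 25*n^2 ≤ (δ*n)/12 * n^2 := mul_le_mul_of_nonneg_right (by linarith) (by positivity)
  have e : (2/3+z/2)*((n-1)*n^2) - ((1+z)*n*n^2 - (((2+3*z)/6 - δ/12)*n^3 + 24*n^2)) =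
     - ((2/3+z/2)*n^2) - (δ*n)/12*n^2 + 24*n^2 := by ring
  linarith

theorem exp_num (δ : ℝ) (h0 : 0 < δ) (h1 : δ ≤ 1) : ∃ k : ℕ, ∀ z : ℝ, 0 ≤ z → z ≤ 1/12 →
    (2/3+z/2)*(k*(k+1)^2) - ((1+z)*(k+1)*(k+1)^2 - ((1+z)*(k+1)+1+(1/2+z+δ))^3/(6*(1/2+z+δ))) ≤ -1 := by
  obtain ⟨k, hk⟩ := exists_nat_ge (300/δ)
  refine ⟨k, fun z hz hz1 => ?_⟩
  have := exp_num_aux δ z (k+1) _ h0 h1 hz hz1 (by linarith [(Nat.cast_nonneg k : (0:ℝ) ≤ k)])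
    (by rw [div_le_iff₀ h0] at hk; linarith) rfl
  rwa [add_sub_cancel_right] at this

structure Q4 where
  (a b c d : ℤ)

theorem Q4.ext' {s t : Q4} (h1 : s.a = t.a) (h2 : s.b = t.b) (h3 : s.c = t.c) (h4 : s.d = t.d) : s = t := by
  cases s; cases t; simp_all

structure Sol (E F : ℝ) (t : Q4) : Prop where
  b0 : 0 ≤ t.b
  ba : t.b ≤ t.a
  e1 : E/2 < (t.a:ℝ)^2 + (t.b:ℝ)^2
  e2 : (t.a:ℝ)^2 + (t.b:ℝ)^2 ≤ E
  f1 : F/2 < (t.c:ℝ)^2 + (t.d:ℝ)^2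
  f2 : (t.c:ℝ)^2 + (t.d:ℝ)^2 ≤ F
  eq : 2*t.a*t.b*t.c + (t.a^2-t.b^2)*t.d = 1

set_option maxHeartbeats 2000000 in
theorem sector_pt (E F θ U a b c d : ℝ) (hE : 40 ≤ E) (hF : 4 ≤ F) (h0 : 0 ≤ θ) (h1 : θ ≤ 1) (hU : U ≤ 1/8)
    (b0 : 0 ≤ b) (ba : b ≤ a) (e1 : E/2 < a^2+b^2) (e2 : a^2+b^2 ≤ E) (f1 : F/2 < c^2+d^2) (f2 : c^2+d^2 ≤ F)
    (heq : 2*a*b*c+(a^2-b^2)*d = 1) (hs : |b - θ*a| ≤ U*a) :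
    ∃ l1 l2 u v : ℝ, a = l1*((1-θ*u)/(1+θ^2)) ∧ b = l1*((u+θ)/(1+θ^2)) ∧
      c = l2*(((1-θ^2)*(1-u^2)+2*θ*(30*v-2*u))/(1+θ^2)^2) ∧
      d = l2*(((1-θ^2)*(30*v-2*u)-2*θ*(1-u^2))/(1+θ^2)^2) ∧
      |u| ≤ U ∧ (l1*l2)^2 ≤ 9*(E*F) ∧ v^2*(E^2*F) ≤ 1/8 := by
  have ha : 0 < a := by
    by_contra h
    have : a = 0 := by linarith
    have : b = 0 := by linarith
    subst_vars; nlinarith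
  obtain ⟨g, hg⟩ : ∃ y, y = 1+θ^2 := ⟨_, rfl⟩
  have hg1 : 1 ≤ g := by nlinarith
  have hg2 : g ≤ 2 := by nlinarith
  have hgs1 : 1 ≤ g^2 := one_le_pow₀ hg1
  have hgs2 : g^2 ≤ 4 := by nlinarith
  obtain ⟨X, hX⟩ : ∃ y, y = a+θ*b := ⟨_, rfl⟩
  obtain ⟨Y, hY⟩ : ∃ y, y = b-θ*a := ⟨_, rfl⟩
  rw [← hY] at hs
  rw [← hg]
  have hXa : a ≤ X := by rw [hX]; linarith [mul_nonneg h0 b0]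
  have hX0 : 0 < X := by linarith
  obtain ⟨u, hu⟩ : ∃ y, y = Y/X := ⟨_, rfl⟩
  have huX : Y = u*X := by rw [hu]; field_simp
  have huU : |u| ≤ U := by
    rw [hu, abs_div, abs_of_pos hX0, div_le_iff₀ hX0]
    have : 0 ≤ U := by
      by_contra h
      have := abs_nonneg Y
      have h5 := mul_neg_of_neg_of_pos (not_le.1 h) ha
      linarith
    exact hs.trans (mul_le_mul_of_nonneg_left hXa this)
  have hu8 : |u| ≤ 1/8 := huU.trans hU
  have hu2 : u^2 ≤ 1/64 := by
    rw [← sq_abs]; nlinarith [abs_nonneg u]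
  obtain ⟨Z, hZ⟩ : ∃ y, y = (1-θ^2)*c - 2*θ*d := ⟨_, rfl⟩
  obtain ⟨W, hW⟩ : ∃ y, y = (1-θ^2)*d + 2*θ*c := ⟨_, rfl⟩
  have n1 : X^2*(1+u^2) = g*(a^2+b^2) := by
    have : X^2*(1+u^2) = X^2+Y^2 := by rw [huX]; ring
    rw [this, hX, hY, hg]; ring
  have n2 : Z^2+W^2 = g^2*(c^2+d^2) := by rw [hZ, hW, hg]; ring
  have n3 : X^2*(2*u*Z + (1-u^2)*W) = g^2 := by
    have e : X^2*(2*u*Z + (1-u^2)*W) = 2*X*Y*Z+(X^2-Y^2)*W := by rw [huX]; ring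
    have e' : 2*X*Y*Z+(X^2-Y^2)*W = g^2*(2*a*b*c+(a^2-b^2)*d) := by rw [hX, hY, hZ, hW, hg]; ring
    rw [e, e', heq]; ring
  have hX2 : g*E*(32/65) ≤ X^2 := by
    have q1 : g*(E/2) ≤ g*(a^2+b^2) := by gcongr
    have q2 : X^2*(1+u^2) ≤ X^2*(65/64) := mul_le_mul_of_nonneg_left (by linarith) (sq_nonneg X)
    linarith
  have hX2' : X^2 ≤ g*E := by
    have q1 : g*(a^2+b^2) ≤ g*E := by gcongr
    have := mul_nonneg (sq_nonneg X) (sq_nonneg u)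
    linarith
  obtain ⟨T, hT⟩ : ∃ y, y = g^2/X^2 := ⟨_, rfl⟩
  have hX2p : 0 < X^2 := by positivity
  have hTX : T*X^2 = g^2 := by rw [hT]; field_simp
  have n3' : 2*u*Z+(1-u^2)*W = T := by rw [hT, eq_div_iff hX2p.ne']; linarith
  have hT0 : 0 < T := by rw [hT]; positivity
  have hTE : T*E ≤ 65/16 := by
    have : T*(g*E*(32/65)) ≤ g^2 := by rw [← hTX]; gcongr
    have : g*(T*E*(32/65)) ≤ g*g := by rw [← sq]; refine le_trans (le_of_eq ?_) this; ring
    have := le_of_mul_le_mul_left this (by linarith)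
    linarith
  have hT4 : T ≤ 1/8 := by have := mul_le_mul_of_nonneg_left hE hT0.le; linarith
  have hWb : |W| ≤ (1/8+|Z|/4)*(64/63) := by
    have q : (1-u^2)*|W| ≤ 1/8 + |Z|/4 := by
      have e : (1-u^2)*W = T - 2*u*Z := by linarith
      have : |(1-u^2)*W| ≤ |T| + |2*u*Z| := by rw [e]; exact abs_sub _ _
      rw [abs_mul, abs_of_nonneg (by linarith : 0 ≤ 1-u^2), abs_of_pos hT0, abs_mul, abs_mul, abs_two] at this
      have := mul_le_mul_of_nonneg_right hu8 (abs_nonneg Z)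
      linarith
    have := mul_le_mul_of_nonneg_right hu2 (abs_nonneg W)
    linarith
  have hZF : F/4 ≤ Z^2 := by
    have q1 : F/2 ≤ Z^2+W^2 := by rw [n2]; have := le_mul_of_one_le_left (by positivity : 0 ≤ c^2+d^2) hgs1; linarith
    have q2 : |Z|^2 = Z^2 := sq_abs Z
    have q3 : |W|^2 = W^2 := sq_abs W
    have hZ1 : 1 ≤ |Z| := by
      by_contra h
      push Not at h
      have h5 : |W| ≤ 1/2 := by linarith
      have := pow_le_pow_left₀ (abs_nonneg W) h5 2
      have := pow_le_pow_left₀ (abs_nonneg Z) h.le 2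
      rw [q3] at *
      rw [q2] at *
      linarith
    have : |W| ≤ |Z|/2 := by linarith
    have := pow_le_pow_left₀ (abs_nonneg W) this 2
    rw [div_pow, q2, q3] at this
    linarith
  have hZ0 : Z ≠ 0 := by rintro h; rw [h] at hZF; norm_num at hZF; linarith
  have hZF2 : Z^2 ≤ 4*F := by
    have : g^2*(c^2+d^2) ≤ 4*F := mul_le_mul hgs2 f2 (by positivity) (by norm_num)
    linarith [sq_nonneg W]
  have hu1 : (0:ℝ) < 1-u^2 := by linarith
  refine ⟨X, Z/(1-u^2), u, T/Z/30, ?_, ?_, ?_, ?_, huU, ?_, ?_⟩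
  · have : X*(1-θ*u) = a*g := by
      have : X*(1-θ*u) = X - θ*Y := by rw [huX]; ring
      rw [this, hX, hY, hg]; ring
    rw [mul_div_assoc', this]; field_simp
  · have : X*(u+θ) = b*g := by
      have : X*(u+θ) = Y+θ*X := by rw [huX]; ring
      rw [this, hX, hY, hg]; ring
    rw [mul_div_assoc', this]; field_simp
  · have e : 30*(T/Z/30) - 2*u = (1-u^2)*W/Z := by
      rw [← n3']; field_simp; ring
    rw [e]
    have : Z/(1-u^2)*(((1-θ^2)*(1-u^2)+2*θ*((1-u^2)*W/Z))/g^2) = ((1-θ^2)*Z + 2*θ*W)/g^2 := by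
      field_simp
    rw [this, eq_div_iff (by positivity), hZ, hW, hg]; ring
  · have e : 30*(T/Z/30) - 2*u = (1-u^2)*W/Z := by
      rw [← n3']; field_simp; ring
    rw [e]
    have : Z/(1-u^2)*(((1-θ^2)*((1-u^2)*W/Z)-2*θ*(1-u^2))/g^2) = ((1-θ^2)*W - 2*θ*Z)/g^2 := by
      field_simp
    rw [this, eq_div_iff (by positivity), hZ, hW, hg]; ring
  · have e : (X*(Z/(1-u^2)))^2 = X^2*Z^2/(1-u^2)^2 := by field_simp
    rw [e, div_le_iff₀ (by positivity)]
    have q1 : X^2*Z^2 ≤ (2*E)*(4*F) := by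
      apply mul_le_mul _ hZF2 (sq_nonneg _) (by positivity)
      exact hX2'.trans (mul_le_mul_of_nonneg_right hg2 (by linarith))
    have q2 : (63/64:ℝ)^2 ≤ (1-u^2)^2 := by apply pow_le_pow_left₀ (by norm_num); linarith
    have : 0 ≤ E*F := by positivity
    have := mul_le_mul_of_nonneg_left q2 this
    linarith
  · have e : (T/Z/30)^2*(E^2*F) = (T*E)^2*F/Z^2/900 := by field_simp; norm_num
    rw [e]
    have q1 : (T*E)^2 ≤ (65/16)^2 := by apply pow_le_pow_left₀ (by positivity) hTE
    have q2 : (T*E)^2*F/Z^2 ≤ 67 := by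
      rw [div_le_iff₀ (by positivity)]
      have : (T*E)^2*F ≤ (65/16)^2*F := by gcongr
      linarith
    linarith

open Polynomial

theorem real_sq_le {x y : ℝ} (hy : 0 ≤ y) (h : x^2 ≤ y^2) : |x| ≤ y := by
  rw [← abs_of_nonneg hy]; exact sq_le_sq.1 h

theorem sector_form (δ : ℝ) (h0 : 0 < δ) (h1 : δ ≤ 1) : ∃ (k : ℕ) (x0 : ℝ), ∀ x z E F θ : ℝ, x0 ≤ x → 2 ≤ x → 0 ≤ z → z ≤ 1/12 →
    E * F ≤ 8 * x^(4/3+z:ℝ) → x^2/8 ≤ E^2*F → 40 ≤ E → 4 ≤ F → 0 ≤ θ → θ ≤ 1 → x^(-(1/2+z+δ)) ≤ 1/8 →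
    ∃ g : Fin (k+1) × Fin (k+1) → ℤ, g ≠ 0 ∧ ∀ t : Q4, Sol E F t → |(t.b:ℝ) - θ*t.a| ≤ x^(-(1/2+z+δ))*t.a →
      ∑ i : Fin (k+1) × Fin (k+1), g i * ((t.a^(k-(i.1:ℕ)) * t.b^(i.1:ℕ)) * (t.c^(k-(i.2:ℕ)) * t.d^(i.2:ℕ))) = 0 := by
  classical
  obtain ⟨k, hk⟩ := exp_num δ h0 h1
  obtain ⟨Ck, hCk, hdet⟩ := real_det k 60 (by norm_num)
  refine ⟨k, Ck*(9^k)^((k+1)^2) + 1, ?_⟩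
  intro x z E F θ hx hx2 hz hz1 hEF hEEF hE hF hθ hθ1 hU
  have hx0 : 0 < x := by linarith
  have hg1 : 1 ≤ 1+θ^2 := by nlinarith
  have hg0 : 0 < 1+θ^2 := by linarith
  set μ := 1/2+z+δ with hμ
  let mon : Q4 → Fin (k+1) × Fin (k+1) → ℤ := fun t i => (t.a^(k-(i.1:ℕ)) * t.b^(i.1:ℕ)) * (t.c^(k-(i.2:ℕ)) * t.d^(i.2:ℕ))
  let S : Set Q4 := {t | Sol E F t ∧ |(t.b:ℝ) - θ*t.a| ≤ x^(-μ)*t.a}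
  have habs : ∀ s : ℝ, |s/(1+θ^2)| ≤ |s| := fun s => by
    rw [abs_div, abs_of_pos hg0]; exact div_le_self (abs_nonneg _) hg1
  have habs2 : ∀ s : ℝ, |s/(1+θ^2)^2| ≤ |s| := fun s => by
    rw [abs_div, abs_of_pos (pow_pos hg0 2)]; exact div_le_self (abs_nonneg _) (one_le_pow₀ hg1)
  have hθs : θ^2 ≤ 1 := by nlinarith
  obtain ⟨B, hB1, hB⟩ : ∃ B : ℝ, 1 ≤ B ∧ ∀ w ∈ mon '' S, ∀ i, |(w i:ℝ)| ≤ B := by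
    refine ⟨(E+1)^k*(F+1)^k, one_le_mul_of_one_le_of_one_le (one_le_pow₀ (by linarith)) (one_le_pow₀ (by linarith)), ?_⟩
    rintro _ ⟨t, ⟨ht, -⟩, rfl⟩ i
    have key : ∀ (y : ℤ) (Y : ℝ), (y:ℝ)^2 ≤ Y → |(y:ℝ)| ≤ Y+1 := by
      intro y Y hY; rw [← sq_abs] at hY; nlinarith [abs_nonneg (y:ℝ)]
    have hab : ∀ (s r Y : ℝ) (m : Fin (k+1)), |s| ≤ Y → |r| ≤ Y → |s^(k-(m:ℕ)) * r^(m:ℕ)| ≤ Y^k := by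
      intro s r Y m hs hr
      have hk : k = (k-(m:ℕ)) + (m:ℕ) := by have := m.2; omega
      conv_rhs => rw [hk, pow_add]
      rw [abs_mul, abs_pow, abs_pow]
      have : 0 ≤ Y := (abs_nonneg _).trans hs
      gcongr
    simp only [mon]
    push_cast
    rw [abs_mul]
    refine mul_le_mul (hab _ _ _ _ (key _ _ ?_) (key _ _ ?_)) (hab _ _ _ _ (key _ _ ?_) (key _ _ ?_)) (abs_nonneg _) (by positivity)
    · linarith [ht.e2, sq_nonneg (t.b:ℝ)]
    · linarith [ht.e2, sq_nonneg (t.a:ℝ)]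
    · linarith [ht.f2, sq_nonneg (t.d:ℝ)]
    · linarith [ht.f2, sq_nonneg (t.c:ℝ)]
  obtain ⟨g, g0, -, hg⟩ := exists_orth (mon '' S) B hB1 hB (by
    intro w hw
    choose t ht hwt using hw
    have hpt := fun i => sector_pt E F θ (x^(-μ)) (t i).a (t i).b (t i).c (t i).d hE hF hθ hθ1 hU
      (by exact_mod_cast (ht i).1.b0) (by exact_mod_cast (ht i).1.ba) (ht i).1.e1 (ht i).1.e2 (ht i).1.f1 (ht i).1.f2
      (by exact_mod_cast (ht i).1.eq) (ht i).2
    choose l1 l2 u v ha hb hc hd hu hl hv using hpt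
    have hD := hdet (9*x^(2/3+z/2:ℝ)) x μ ((1+z)*(k+1)) (by positivity) (by linarith) (by rw [hμ]; positivity) (by positivity)
      ![1/(1+θ^2), -θ/(1+θ^2), 0, 0] ![θ/(1+θ^2), 1/(1+θ^2), 0, 0]
      ![(1-θ^2)/(1+θ^2)^2, -(4*θ)/(1+θ^2)^2, -(1-θ^2)/(1+θ^2)^2, 60*θ/(1+θ^2)^2]
      ![-(2*θ)/(1+θ^2)^2, -(2*(1-θ^2))/(1+θ^2)^2, 2*θ/(1+θ^2)^2, 30*(1-θ^2)/(1+θ^2)^2]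
      (by
        intro m; fin_cases m <;> simp only [Fin.zero_eta, Fin.mk_one, Fin.reduceFinMk, Matrix.cons_val]
        · refine (habs _).trans ?_; norm_num
        · refine (habs _).trans ?_; rw [abs_le]; constructor <;> linarith
        · norm_num
        · norm_num)
      (by
        intro m; fin_cases m <;> simp only [Fin.zero_eta, Fin.mk_one, Fin.reduceFinMk, Matrix.cons_val]
        · refine (habs _).trans ?_; rw [abs_le]; constructor <;> linarith
        · refine (habs _).trans ?_; norm_num
        · norm_num
        · norm_num)
      (by
        intro m; fin_cases m <;> simp only [Fin.zero_eta, Fin.mk_one, Fin.reduceFinMk, Matrix.cons_val] <;>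
          refine (habs2 _).trans ?_ <;> rw [abs_le] <;> constructor <;> linarith [sq_nonneg θ])
      (by
        intro m; fin_cases m <;> simp only [Fin.zero_eta, Fin.mk_one, Fin.reduceFinMk, Matrix.cons_val] <;>
          refine (habs2 _).trans ?_ <;> rw [abs_le] <;> constructor <;> linarith [sq_nonneg θ])
      l1 l2 u v
      (by
        intro i
        refine real_sq_le (by positivity) ((hl i).trans ?_)
        have : (9*x^(2/3+z/2:ℝ))^2 = 81 * x^(4/3+z:ℝ) := by
          rw [mul_pow, ← Real.rpow_natCast (x^(2/3+z/2:ℝ)), ← Real.rpow_mul hx0.le]; norm_num; congr 1; ring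
        rw [this]
        have := Real.rpow_nonneg hx0.le (4/3+z:ℝ)
        linarith)
      hu
      (by
        intro i
        refine real_sq_le (by positivity) ?_
        rw [Real.rpow_neg_one, inv_pow, ← one_div, le_div_iff₀ (by positivity)]
        have := mul_le_mul_of_nonneg_left hEEF (sq_nonneg (v i))
        linarith [hv i])
    have hcast : (((Matrix.of w).det : ℤ) : ℝ) = (Matrix.of fun i j : Fin (k+1) × Fin (k+1) =>
      ((l1 i * ∑ m, ![1/(1+θ^2), -θ/(1+θ^2), 0, 0] m * mv m (u i) (v i))^(k-(j.1:ℕ)) * (l1 i * ∑ m, ![θ/(1+θ^2), 1/(1+θ^2), 0, 0] m * mv m (u i) (v i))^(j.1:ℕ)) *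
      ((l2 i * ∑ m, ![(1-θ^2)/(1+θ^2)^2, -(4*θ)/(1+θ^2)^2, -(1-θ^2)/(1+θ^2)^2, 60*θ/(1+θ^2)^2] m * mv m (u i) (v i))^(k-(j.2:ℕ)) * (l2 i * ∑ m, ![-(2*θ)/(1+θ^2)^2, -(2*(1-θ^2))/(1+θ^2)^2, 2*θ/(1+θ^2)^2, 30*(1-θ^2)/(1+θ^2)^2] m * mv m (u i) (v i))^(j.2:ℕ))).det := by
      rw [Int.cast_det]
      congr 1
      ext i j
      simp only [Matrix.map_apply, Matrix.of_apply, ← hwt, mon]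
      push_cast
      have ea : l1 i * ∑ m, ![1/(1+θ^2), -θ/(1+θ^2), 0, 0] m * mv m (u i) (v i) = (t i).a := by
        rw [ha i]; simp [Fin.sum_univ_four, mv, mexp]; left; ring
      have eb : l1 i * ∑ m, ![θ/(1+θ^2), 1/(1+θ^2), 0, 0] m * mv m (u i) (v i) = (t i).b := by
        rw [hb i]; simp [Fin.sum_univ_four, mv, mexp]; left; ring
      have ec : l2 i * ∑ m, ![(1-θ^2)/(1+θ^2)^2, -(4*θ)/(1+θ^2)^2, -(1-θ^2)/(1+θ^2)^2, 60*θ/(1+θ^2)^2] m * mv m (u i) (v i) = (t i).c := by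
        rw [hc i]; simp [Fin.sum_univ_four, mv, mexp]; left; ring
      have ed : l2 i * ∑ m, ![-(2*θ)/(1+θ^2)^2, -(2*(1-θ^2))/(1+θ^2)^2, 2*θ/(1+θ^2)^2, 30*(1-θ^2)/(1+θ^2)^2] m * mv m (u i) (v i) = (t i).d := by
        rw [hd i]; simp [Fin.sum_univ_four, mv, mexp]; left; ring
      rw [ea, eb, ec, ed]
    rw [← hcast] at hD
    have hlt : |(((Matrix.of w).det : ℤ) : ℝ)| < 1 := by
      refine hD.trans_lt ?_
      have e1 : ((9*x^(2/3+z/2:ℝ))^k)^((k+1)^2) = (9^k)^((k+1)^2) * x^((2/3+z/2)*(k*(k+1)^2):ℝ) := by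
        rw [mul_pow, mul_pow]
        congr 1
        rw [← pow_mul, ← Real.rpow_natCast, ← Real.rpow_mul hx0.le]
        push_cast; rfl
      rw [e1, ← mul_assoc, mul_assoc _ _ (x^(-(_:ℝ))), ← Real.rpow_add hx0]
      have e2 : x^((2/3+z/2)*(k*(k+1)^2) + -((1+z)*(k+1)*(k+1)^2 - ((1+z)*(k+1)+1+μ)^3/(6*μ))) ≤ x^(-1:ℝ) := by
        apply Real.rpow_le_rpow_of_exponent_le (by linarith)
        exact hk z hz hz1
      calc _ ≤ Ck*(9^k)^((k+1)^2) * x^(-1:ℝ) := by gcongr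
        _ < 1 := by rw [Real.rpow_neg_one, ← div_eq_mul_inv, div_lt_one hx0]; linarith
    rw [← Int.cast_abs] at hlt
    have : |(Matrix.of w).det| < 1 := by exact_mod_cast hlt
    rw [Int.abs_lt_one_iff] at this
    exact this)
  refine ⟨g, g0, fun t ht hs => hg (mon t) ⟨t, ⟨ht, hs⟩, rfl⟩⟩

open Polynomial

theorem lin_indep (k : ℕ) (l1 l2 m1 m2 : ℤ) (hdet : m1*l2-m2*l1 = 1) (h : Fin (k+1) → ℤ)
    (hz : ∑ i : Fin (k+1), C (h i:ℚ) * ((C (m1:ℚ) * X + C (l1:ℚ))^(k-(i:ℕ)) * (C (m2:ℚ) * X + C (l2:ℚ))^(i:ℕ)) = 0) : h = 0 := by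
  have hdq : (m1:ℚ)*l2-m2*l1 = 1 := by exact_mod_cast hdet
  set P : ℚ[X] := ∑ i : Fin (k+1), C (h i:ℚ) * X^(i:ℕ) with hP
  have hP0 : P = 0 := by
    by_contra hne
    have hinf : {T : ℚ | (m1:ℚ)*T+l1 ≠ 0}.Infinite := by
      have hfin : ({T : ℚ | (m1:ℚ)*T+l1 = 0}).Finite := by
        apply Set.Subsingleton.finite
        intro T hT T' hT'
        simp only [Set.mem_ofPred_eq] at hT hT'
        by_cases hm : (m1:ℚ) = 0
        · rw [hm] at hT hdq
          have : (l1:ℚ) = 0 := by linarith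
          rw [this] at hdq; norm_num at hdq
        · have : (m1:ℚ)*(T-T') = 0 := by linarith
          rcases mul_eq_zero.1 this with h | h
          · exact absurd h hm
          · linarith
      have := hfin.infinite_compl
      convert this using 1
      ext T; simp
    have hmaps : Set.MapsTo (fun T : ℚ => (m2*T+l2)/(m1*T+l1)) {T : ℚ | (m1:ℚ)*T+l1 ≠ 0} {y | P.IsRoot y} := by
      intro T hT
      simp only [Set.mem_ofPred_eq] at hT ⊢
      have h1 := congrArg (eval T) hz
      simp only [eval_finsetSum, eval_mul, eval_C, eval_pow, eval_add, eval_X, eval_zero] at h1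
      rw [IsRoot, hP]
      simp only [eval_finsetSum, eval_mul, eval_C, eval_pow, eval_X]
      have h2 : (m1*T+l1)^k * ∑ i : Fin (k+1), (h i:ℚ) * ((m2*T+l2)/(m1*T+l1))^(i:ℕ) = 0 := by
        rw [← h1, Finset.mul_sum]
        refine Finset.sum_congr rfl fun i _ => ?_
        have : (m1*T+l1)^k = (m1*T+l1)^(k-(i:ℕ)) * (m1*T+l1)^(i:ℕ) := by
          rw [← pow_add]; congr 1; have := i.2; omega
        rw [this, div_pow]; field_simp
      rcases mul_eq_zero.1 h2 with h3 | h3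
      · exact absurd h3 (pow_ne_zero _ hT)
      · exact h3
    have hinj : Set.InjOn (fun T : ℚ => (m2*T+l2)/(m1*T+l1)) {T : ℚ | (m1:ℚ)*T+l1 ≠ 0} := by
      intro T hT T' hT' he
      simp only [Set.mem_ofPred_eq] at hT hT' he
      rw [div_eq_div_iff hT hT'] at he
      linear_combination (-1:ℚ) * he - (T-T')*hdq
    exact (finite_setOfPred_isRoot hne).not_infinite ((hinf.image hinj).mono hmaps.image_subset)
  funext i
  have := congrArg (fun Q : ℚ[X] => Q.coeff (i:ℕ)) hP0
  simp only [hP, finsetSum_coeff, coeff_C_mul, coeff_X_pow, coeff_zero] at this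
  rw [Finset.sum_eq_single i] at this
  · simpa using this
  · intro j _ hj
    rw [if_neg (fun h => hj (Fin.ext h.symm)), mul_zero]
  · simp

theorem form_count (k d1 d2 : ℕ) (hd1 : 1 ≤ d1) (ε : ℝ) (hε : 0 < ε) :
    ∃ C : ℝ, 0 < C ∧ ∀ Λ B : ℝ, 1 ≤ Λ → Λ ≤ B → ∀ (S : Finset Pt) (φ : ℚ[X][X]), CurveHyp d1 d2 Λ B φ S →
    ∀ l1 l2 m1 m2 : ℤ, m1*l2-m2*l1 = 1 → ∀ h : Fin (k+1) × Fin (k+1) → ℤ, h ≠ 0 →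
    (∀ z ∈ S, ∑ i : Fin (k+1) × Fin (k+1), h i * (((m1*z.p+l1*z.q)^(k-(i.1:ℕ)) * (m2*z.p+l2*z.q)^(i.1:ℕ)) *
      (z.s^(k-(i.2:ℕ)) * z.r^(i.2:ℕ))) = 0) → (S.card : ℝ) ≤ C * B^ε * Λ := by
  obtain ⟨c, hc, hcc⟩ := curve_count k d1 d2 hd1 ε hε
  refine ⟨c, hc, ?_⟩
  intro Λ B hΛ hΛB S φ hS l1 l2 m1 m2 hdet h h0 hv
  let A : ℚ[X] := C (m1:ℚ) * X + C (l1:ℚ)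
  let D : ℚ[X] := C (m2:ℚ) * X + C (l2:ℚ)
  let a : Fin (k+1) → ℚ[X] := fun j => ∑ i : Fin (k+1), C (h (i,j):ℚ) * (A^(k-(i:ℕ)) * D^(i:ℕ))
  let G : ℚ[X][X] := ∑ j : Fin (k+1), C (a j) * X^(j:ℕ)
  have hcoef : ∀ n, G.coeff n = if hn : n < k+1 then a ⟨n, hn⟩ else 0 := by
    intro n
    simp only [G, finsetSum_coeff, coeff_C_mul, coeff_X_pow]
    split_ifs with hn
    · rw [Finset.sum_eq_single ⟨n, hn⟩]
      · simp
      · intro j _ hj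
        rw [if_neg (fun h => hj (Fin.ext h.symm)), mul_zero]
      · simp
    · refine Finset.sum_eq_zero fun j _ => ?_
      rw [if_neg (fun (h : n = (j:ℕ)) => hn (h ▸ j.2)), mul_zero]
  have hadeg : ∀ j, (a j).natDegree ≤ k := by
    intro j
    refine natDegree_sum_le_of_forall_le _ _ fun i _ => ?_
    refine (natDegree_C_mul_le _ _).trans (natDegree_mul_le.trans ?_)
    have h1 := natDegree_pow_le_of_le (k-(i:ℕ)) (natDegree_linear_le (a := (m1:ℚ)) (b := (l1:ℚ)))
    have h2 := natDegree_pow_le_of_le (i:ℕ) (natDegree_linear_le (a := (m2:ℚ)) (b := (l2:ℚ)))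
    have := i.2
    change (A^(k-(i:ℕ))).natDegree + (D^(i:ℕ)).natDegree ≤ k
    simp only [A, D]
    omega
  refine hcc Λ B hΛ hΛB S φ G hS ?_ ?_ ?_ ?_
  · intro hG
    apply h0
    funext ⟨i, j⟩
    have h1 : a j = 0 := by
      have := hcoef j
      rw [hG, dif_pos j.2] at this
      simpa using this.symm
    exact congrFun (lin_indep k l1 l2 m1 m2 hdet (fun i => h (i,j)) h1) i
  · rw [natDegree_le_iff_coeff_eq_zero]
    intro n hn
    rw [hcoef, dif_neg (by omega)]
  · intro j
    rw [hcoef]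
    split_ifs
    · exact hadeg _
    · simp
  · intro z hz
    have hg := hS.1 z hz
    have hq : (z.q:ℚ) ≠ 0 := by exact_mod_cast hg.q0
    have hs : (z.s:ℚ) ≠ 0 := by exact_mod_cast hg.s0
    have e1 : G.evalEval z.T z.U = ∑ j : Fin (k+1), ∑ i : Fin (k+1), (h (i,j):ℚ) * ((m1*z.T+l1)^(k-(i:ℕ)) * (m2*z.T+l2)^(i:ℕ)) * z.U^(j:ℕ) := by
      simp only [G, a, A, D, evalEval, eval_finsetSum, eval_mul, eval_C, eval_pow, eval_X, eval_add, Finset.sum_mul]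
    have e2 : (z.q:ℚ)^k * (z.s:ℚ)^k * G.evalEval z.T z.U = 0 := by
      have h3 : ((∑ i : Fin (k+1) × Fin (k+1), h i * (((m1*z.p+l1*z.q)^(k-(i.1:ℕ)) * (m2*z.p+l2*z.q)^(i.1:ℕ)) *
        (z.s^(k-(i.2:ℕ)) * z.r^(i.2:ℕ))) : ℤ):ℚ) = 0 := by rw [hv z hz]; simp
      rw [e1, ← h3]
      push_cast
      rw [Fintype.sum_prod_type, Finset.sum_comm, Finset.mul_sum]
      refine Finset.sum_congr rfl fun i _ => ?_
      rw [Finset.mul_sum]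
      refine Finset.sum_congr rfl fun j _ => ?_
      have hi : (z.q:ℚ)^k = z.q^(k-(i:ℕ)) * z.q^(i:ℕ) := by
        rw [← pow_add]; congr 1; have := i.2; omega
      have hj : (z.s:ℚ)^k = z.s^(k-(j:ℕ)) * z.s^(j:ℕ) := by
        rw [← pow_add]; congr 1; have := j.2; omega
      have t1 : (m1:ℚ)*z.p+l1*z.q = z.q * (m1*z.T+l1) := by rw [Pt.T]; field_simp
      have t2 : (m2:ℚ)*z.p+l2*z.q = z.q * (m2*z.T+l2) := by rw [Pt.T]; field_simp
      have t3 : (z.r:ℚ) = z.s * z.U := by rw [Pt.U]; field_simp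
      rw [hi, hj, t1, t2, t3, mul_pow, mul_pow, mul_pow]; ring
    rcases mul_eq_zero.1 e2 with h4 | h4
    · rcases mul_eq_zero.1 h4 with h5 | h5
      · exact absurd h5 (pow_ne_zero _ hq)
      · exact absurd h5 (pow_ne_zero _ hs)
    · exact h4

open Polynomial

theorem frac_eq {p q p' q' : ℤ} (h : IsCoprime p q) (h' : IsCoprime p' q') (hq : q ≠ 0) (hq' : q' ≠ 0)
    (he : (p:ℚ)/q = p'/q') : (p' = p ∧ q' = q) ∨ (p' = -p ∧ q' = -q) := by
  rw [div_eq_div_iff (by exact_mod_cast hq) (by exact_mod_cast hq')] at he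
  have he' : p * q' = p' * q := by exact_mod_cast he
  have d1 : q ∣ q' := by
    refine h.symm.dvd_of_dvd_mul_left ?_
    rw [he']; exact dvd_mul_left _ _
  have d2 : q' ∣ q := by
    refine h'.symm.dvd_of_dvd_mul_left ?_
    rw [← he']; exact dvd_mul_left _ _
  rcases Int.associated_iff.1 (associated_of_dvd_dvd d1 d2) with h1 | h1
  · left; subst h1
    exact ⟨(mul_right_cancel₀ hq he').symm, rfl⟩
  · right
    have h2 : q' = -q := by omega
    refine ⟨?_, h2⟩
    rw [h2] at he'
    have : p' * q = (-p)*q := by linarith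
    exact mul_right_cancel₀ hq this

theorem box_count (k d1 d2 : ℕ) (hd1 : 1 ≤ d1) (ε : ℝ) (hε : 0 < ε) :
    ∃ C : ℝ, 0 < C ∧ ∀ Λ B : ℝ, 1 ≤ Λ → Λ ≤ B → ∀ (K : ℕ) (S : Finset Q4) (φ : ℚ[X][X]) (w1 w2 r s : Q4 → ℤ),
    φ.natDegree ≤ d2 → (∀ j, (φ.coeff j).natDegree ≤ d1) →
    ∀ l1 l2 m1 m2 : ℤ, m1*l2-m2*l1 = 1 → ∀ h : Fin (k+1) × Fin (k+1) → ℤ, h ≠ 0 →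
    (∀ t ∈ S, IsCoprime (w1 t) (w2 t) ∧ IsCoprime (r t) (s t) ∧ s t ≠ 0 ∧ |(r t:ℝ)| ≤ B ∧ |(s t:ℝ)| ≤ B ∧
      |((w1 t*l2-w2 t*l1 : ℤ):ℝ)| ≤ Λ ∧ |((m1*w2 t-m2*w1 t:ℤ):ℝ)| ≤ Λ) →
    (∀ t ∈ S, (m1*w2 t-m2*w1 t ≠ 0) → ((m1*w2 t-m2*w1 t:ℤ):ℚ)^d1 * (s t:ℚ)^d2 *
      φ.evalEval (((w1 t*l2-w2 t*l1 : ℤ):ℚ)/((m1*w2 t-m2*w1 t:ℤ):ℚ)) ((r t:ℚ)/(s t:ℚ)) = 1) →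
    (∀ t ∈ S, ∑ i : Fin (k+1) × Fin (k+1), h i * ((w1 t^(k-(i.1:ℕ)) * w2 t^(i.1:ℕ)) *
      (s t^(k-(i.2:ℕ)) * r t^(i.2:ℕ))) = 0) →
    (∀ x y : ℤ, ∀ S' ⊆ S, (∀ t ∈ S', (w1 t = x ∧ w2 t = y) ∨ (w1 t = -x ∧ w2 t = -y)) → S'.card ≤ K) →
    (S.card : ℝ) ≤ K * (C * B^ε * Λ + 1) := by
  classical
  obtain ⟨c, hc, hcc⟩ := form_count k d1 d2 hd1 ε hε
  refine ⟨c, hc, ?_⟩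
  intro Λ B hΛ hΛB K S φ w1 w2 r s hφ1 hφ2 l1 l2 m1 m2 hdet h h0 hpt hrel hform hfib
  let pt : Q4 → Pt := fun t => ⟨w1 t*l2-w2 t*l1, m1*w2 t-m2*w1 t, r t, s t⟩
  have hw1 : ∀ t, w1 t = m1*(pt t).p+l1*(pt t).q := fun t => by
    simp only [pt]; linear_combination (-(w1 t)) * hdet
  have hw2 : ∀ t, w2 t = m2*(pt t).p+l2*(pt t).q := fun t => by
    simp only [pt]; linear_combination (-(w2 t)) * hdet
  have hcop : ∀ t ∈ S, IsCoprime (pt t).p (pt t).q := by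
    intro t ht
    obtain ⟨u, v, huv⟩ := (hpt t ht).1
    refine ⟨u*m1+v*m2, u*l1+v*l2, ?_⟩
    rw [hw1 t, hw2 t] at huv
    rw [← huv]; ring
  set S0 := S.filter fun t => (pt t).q = 0 with hS0
  set S1 := S.filter fun t => (pt t).q ≠ 0 with hS1
  have hsplit : S.card = S0.card + S1.card := (Finset.card_filter_add_card_filter_not _).symm
  have hc0 : S0.card ≤ K := by
    refine hfib m1 m2 S0 (Finset.filter_subset _ _) ?_
    intro t ht
    obtain ⟨htS, hq⟩ := Finset.mem_filter.1 ht
    have hu := hcop t htS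
    rw [hq, isCoprime_zero_right, Int.isUnit_iff] at hu
    rw [hw1 t, hw2 t, hq]
    rcases hu with hu | hu <;> rw [hu] <;> simp
  have hc1 : S1.card ≤ K * (S1.image fun t => (pt t).T).card := by
    rw [mul_comm]
    refine Finset.card_le_mul_card_image _ _ ?_ |>.trans (le_of_eq (mul_comm _ _))
    intro τ hτ
    obtain ⟨t0, ht0, rfl⟩ := Finset.mem_image.1 hτ
    refine hfib (w1 t0) (w2 t0) _ ((Finset.filter_subset _ _).trans (Finset.filter_subset _ _)) ?_
    intro t ht
    obtain ⟨ht1, hT⟩ := Finset.mem_filter.1 ht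
    obtain ⟨htS, hq⟩ := Finset.mem_filter.1 ht1
    obtain ⟨htS0, hq0⟩ := Finset.mem_filter.1 ht0
    rcases frac_eq (hcop t0 htS0) (hcop t htS) hq0 hq (by simpa [Pt.T] using hT.symm) with ⟨h1, h2⟩ | ⟨h1, h2⟩
    · left; rw [hw1 t, hw2 t, hw1 t0, hw2 t0, h1, h2]; exact ⟨rfl, rfl⟩
    · right; rw [hw1 t, hw2 t, hw1 t0, hw2 t0, h1, h2]; constructor <;> ring
  have hsec : ∀ τ ∈ S1.image fun t => (pt t).T, ∃ t ∈ S1, (pt t).T = τ := fun τ hτ => by simpa using hτ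
  have : Nonempty Q4 := ⟨⟨0,0,0,0⟩⟩
  choose! sec hsec1 hsec2 using hsec
  set S2 := (S1.image fun t => (pt t).T).image fun τ => pt (sec τ) with hS2
  have hcard : S2.card = (S1.image fun t => (pt t).T).card := by
    apply Finset.card_image_of_injOn
    intro τ hτ τ' hτ' he
    have := congrArg Pt.T he
    rwa [hsec2 τ hτ, hsec2 τ' hτ'] at this
  have hmem : ∀ z ∈ S2, ∃ t ∈ S1, z = pt t ∧ sec z.T = t ∧ z.T ∈ (S1.image fun t => (pt t).T) := by
    intro z hz
    obtain ⟨τ, hτ, rfl⟩ := Finset.mem_image.1 hz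
    refine ⟨sec τ, hsec1 τ hτ, rfl, ?_, ?_⟩
    · simp only [hsec2 τ hτ]
    · simp only [hsec2 τ hτ]; exact hτ
  have hCH : CurveHyp d1 d2 Λ B φ S2 := by
    refine ⟨?_, ?_, hφ1, hφ2, ?_⟩
    · intro z hz
      obtain ⟨t, ht, rfl, -⟩ := hmem z hz
      obtain ⟨htS, hq⟩ := Finset.mem_filter.1 ht
      obtain ⟨a1, a2, a3, a4, a5, a6, a7⟩ := hpt t htS
      exact { q0 := hq, s0 := a3, cpq := hcop t htS, crs := a2, hp := a6, hq := a7, hr := a4, hs := a5 }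
    · intro z hz z' hz' he
      obtain ⟨t, ht, h1, h2, -⟩ := hmem z hz
      obtain ⟨t', ht', h1', h2', -⟩ := hmem z' hz'
      rw [h1, h1', ← h2, ← h2', he]
    · intro z hz
      obtain ⟨t, ht, rfl, -⟩ := hmem z hz
      obtain ⟨htS, hq⟩ := Finset.mem_filter.1 ht
      exact hrel t htS hq
  have hfin := hcc Λ B hΛ hΛB S2 φ hCH l1 l2 m1 m2 hdet h h0 (by
    intro z hz
    obtain ⟨t, ht, rfl, -⟩ := hmem z hz
    obtain ⟨htS, hq⟩ := Finset.mem_filter.1 ht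
    rw [← hw1 t, ← hw2 t]
    exact hform t htS)
  rw [hcard] at hfin
  have hK : (S.card:ℝ) ≤ K + K * (S1.image fun t => (pt t).T).card := by
    rw [hsplit]; exact_mod_cast add_le_add hc0 hc1
  calc (S.card:ℝ) ≤ _ := hK
    _ ≤ K + K * (c * B^ε * Λ) := by gcongr
    _ = _ := by ring

open Polynomial

theorem Sol.ca {E F t} (h : Sol E F t) : IsCoprime t.a t.b := ⟨2*t.b*t.c+t.a*t.d, -(t.b*t.d), by linear_combination h.eq⟩
theorem Sol.cc {E F t} (h : Sol E F t) : IsCoprime t.c t.d := ⟨2*t.a*t.b, t.a^2-t.b^2, by linear_combination h.eq⟩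
theorem Sol.a1 {E F t} (h : Sol E F t) (hE : 40 ≤ E) : 2 ≤ t.a := by
  by_contra hc
  have h1 : t.a ≤ 1 := by omega
  have h2 : (t.a:ℝ) ≤ 1 := by exact_mod_cast h1
  have h3 : (t.b:ℝ) ≤ t.a := by exact_mod_cast h.ba
  have h4 : (0:ℝ) ≤ t.b := by exact_mod_cast h.b0
  nlinarith [h.e1]
theorem Sol.c0 {E F t} (h : Sol E F t) (hE : 40 ≤ E) : t.c ≠ 0 := by
  intro hc
  have h1 := h.eq
  rw [hc, mul_zero, zero_add] at h1
  have h2 := h.a1 hE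
  have hb := h.b0; have hba := h.ba
  have h3 : (t.a+t.b) * ((t.a-t.b)*t.d) = 1 := by linear_combination h1
  rcases Int.eq_one_or_neg_one_of_mul_eq_one h3 with h4 | h4 <;> omega

theorem fiberE (E F : ℝ) (hE : 40 ≤ E) (hF : F ≤ 8*E^2) (x y : ℤ) (S : Finset Q4) (hS : ∀ t ∈ S, Sol E F t)
    (hxy : ∀ t ∈ S, (t.a = x ∧ t.b = y) ∨ (t.a = -x ∧ t.b = -y)) : S.card ≤ 25 := by
  classical
  rcases S.eq_empty_or_nonempty with h | ⟨t0, ht0⟩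
  · simp [h]
  have h0 := hS t0 ht0
  have hsame : ∀ t ∈ S, t.a = t0.a ∧ t.b = t0.b := by
    intro t ht
    have := hxy t ht; have := hxy t0 ht0
    have := (hS t ht).a1 hE; have := h0.a1 hE
    omega
  have key : ∀ t ∈ S, (t.c*t0.d-t.d*t0.c)*(t0.a^2-t0.b^2) = t.c-t0.c ∧ (t.c*t0.d-t.d*t0.c)*(2*t0.a*t0.b) = -(t.d-t0.d) := by
    intro t ht
    have e1 := (hS t ht).eq
    rw [(hsame t ht).1, (hsame t ht).2] at e1
    have e2 := h0.eq
    constructor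
    · linear_combination t.c * e2 - t0.c * e1
    · linear_combination t0.d * e1 - t.d * e2
  have hmaps : ∀ t ∈ S, t.c*t0.d-t.d*t0.c ∈ Finset.Icc (-12:ℤ) 12 := by
    intro t ht
    obtain ⟨k1, k2⟩ := key t ht
    set ρ := t.c*t0.d-t.d*t0.c
    have k3 : (ρ:ℝ)^2*((t0.a:ℝ)^2+(t0.b:ℝ)^2)^2 = ((t.c:ℝ)-t0.c)^2+((t.d:ℝ)-t0.d)^2 := by
      have k1' : (ρ:ℝ)*((t0.a:ℝ)^2-(t0.b:ℝ)^2) = t.c-t0.c := by exact_mod_cast k1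
      have k2' : (ρ:ℝ)*(2*t0.a*t0.b) = -((t.d:ℝ)-t0.d) := by exact_mod_cast k2
      rw [← k1', ← neg_sq ((t.d:ℝ)-t0.d), ← k2']; ring
    have k4 : ((t.c:ℝ)-t0.c)^2+((t.d:ℝ)-t0.d)^2 ≤ 4*F := by
      linarith [(hS t ht).f2, h0.f2, sq_nonneg ((t.c:ℝ)+t0.c), sq_nonneg ((t.d:ℝ)+t0.d)]
    have k5 : (E/2)^2 ≤ ((t0.a:ℝ)^2+(t0.b:ℝ)^2)^2 := pow_le_pow_left₀ (by linarith) h0.e1.le 2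
    have k6 : (ρ:ℝ)^2*(E/2)^2 ≤ 32*E^2 := by
      have := mul_le_mul_of_nonneg_left k5 (sq_nonneg (ρ:ℝ))
      linarith
    have k7 : (ρ:ℝ)^2 ≤ 128 := by
      have : (0:ℝ) < E^2 := by positivity
      by_contra hcon
      push Not at hcon
      nlinarith
    have k8 : ρ^2 ≤ 128 := by exact_mod_cast k7
    rw [Finset.mem_Icc]
    constructor <;> nlinarith
  have := Finset.card_le_card_of_injOn (s := S) (t := Finset.Icc (-12:ℤ) 12) (fun t : Q4 => t.c*t0.d-t.d*t0.c) hmaps (by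
    intro t ht t' ht' he
    simp only at he
    obtain ⟨k1, k2⟩ := key t ht
    obtain ⟨k1', k2'⟩ := key t' ht'
    rw [he] at k1 k2
    refine Q4.ext' ?_ ?_ ?_ ?_
    · rw [(hsame t ht).1, (hsame t' ht').1]
    · rw [(hsame t ht).2, (hsame t' ht').2]
    · linarith
    · linarith)
  simpa using this

theorem uniqF (E F : ℝ) (hE : 40 ≤ E) (hF : 129 ≤ F) (t t' : Q4) (h : Sol E F t) (h' : Sol E F t') (hc : t.c = t'.c) (hd : t.d = t'.d) :
    t = t' := by
  obtain ⟨a, b, c, d⟩ := t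
  obtain ⟨a', b', c', d'⟩ := t'
  simp only at hc hd
  subst hc hd
  have hb := h.b0; have hba := h.ba; have hb' := h'.b0; have hba' := h'.ba
  have ha := h.a1 hE; have ha' := h'.a1 hE
  have e := h.eq; have e' := h'.eq; have c1 := h.ca; have c2 := h'.ca
  have e1 := h.e1; have e2 := h.e2; have e1' := h'.e1; have e2' := h'.e2; have f1 := h.f1
  clear h h'
  simp only at *
  by_cases hΔ : a*b'-a'*b = 0
  · have : a = a' ∧ b = b' := by
      rcases frac_eq c1.symm c2.symm (by omega) (by omega) (by
        rw [div_eq_div_iff (by exact_mod_cast (by omega)) (by exact_mod_cast (by omega))]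
        exact_mod_cast (by linarith : b*a' = b'*a)) with h | h <;> omega
    rw [this.1, this.2]
  · exfalso
    set Δ := a*b'-a'*b with hΔd
    set P := a*a'+b*b' with hP
    set n := (a^2-b^2)*c-2*a*b*d with hn
    have r1 : P^2-Δ^2+2*P*Δ*n = (a^2+b^2)^2 := by
      rw [hP, hΔd, hn]
      linear_combination (-((a*a'+b*b')^2-(a*b'-a'*b)^2)) * e + (a^2+b^2)^2 * e'
    have r2 : P^2+Δ^2 = (a^2+b^2)*(a'^2+b'^2) := by rw [hP, hΔd]; ring
    have r3 : n^2+1 = (a^2+b^2)^2*(c^2+d^2) := by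
      rw [hn]
      linear_combination (-(2*a*b*c+(a^2-b^2)*d) - 1) * e
    have hPa : a*a' ≤ P := by rw [hP]; linarith [mul_nonneg hb hb']
    have hP0 : 0 < P := by have : 0 < a*a' := by positivity
                           linarith
    clear_value Δ P n
    have q1 : E/4 ≤ P := by
      have hbR : (b:ℝ)^2 ≤ (a:ℝ)^2 := by exact_mod_cast pow_le_pow_left₀ hb hba 2
      have hbR' : (b':ℝ)^2 ≤ (a':ℝ)^2 := by exact_mod_cast pow_le_pow_left₀ hb' hba' 2
      have s1 : E/4 ≤ (a:ℝ)^2 := by linarith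
      have s2 : E/4 ≤ (a':ℝ)^2 := by linarith
      have s3 : (E/4)^2 ≤ ((a:ℝ)*a')^2 := by
        rw [mul_pow, sq (E/4)]; exact mul_le_mul s1 s2 (by linarith) (by positivity)
      have s4 := abs_le_of_sq_le_sq' s3 (by have : (0:ℤ) ≤ a*a' := by positivity
                                            exact_mod_cast this)
      have s5 : (a:ℝ)*a' ≤ P := by exact_mod_cast hPa
      linarith [s4.2]
    have q2 : (1:ℝ) ≤ |(Δ:ℝ)| := by exact_mod_cast Int.one_le_abs hΔ
    have hEE : ((a:ℝ)^2+(b:ℝ)^2)^2 ≤ E^2 := pow_le_pow_left₀ (by positivity) e2 2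
    have hEE' : ((a:ℝ)^2+(b:ℝ)^2)*((a':ℝ)^2+(b':ℝ)^2) ≤ E*E := mul_le_mul e2 e2' (by positivity) (by linarith)
    have r1' : (P:ℝ)^2-Δ^2+2*P*Δ*n = ((a:ℝ)^2+(b:ℝ)^2)^2 := by exact_mod_cast r1
    have r2' : (P:ℝ)^2+Δ^2 = ((a:ℝ)^2+(b:ℝ)^2)*((a':ℝ)^2+(b':ℝ)^2) := by exact_mod_cast r2
    have q3 : 2*(P:ℝ) * |(Δ:ℝ)| * |(n:ℝ)| ≤ 2*E^2 := by
      have hPR : (0:ℝ) < P := by exact_mod_cast hP0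
      have : 2*(P:ℝ) * |(Δ:ℝ)| * |(n:ℝ)| = |2*(P:ℝ)*Δ*n| := by rw [abs_mul, abs_mul, abs_mul, abs_of_pos hPR, abs_two]
      rw [this, abs_le]
      constructor <;> linarith [sq_nonneg (P:ℝ), sq_nonneg (Δ:ℝ), sq_nonneg ((a:ℝ)^2+(b:ℝ)^2)]
    have q4 : |(n:ℝ)| ≤ 4*E := by
      have s1 : 2*(E/4)*1 * |(n:ℝ)| ≤ 2*E^2 := le_trans (by gcongr) q3
      have s2 : E * |(n:ℝ)| ≤ E*(4*E) := by linarith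
      exact le_of_mul_le_mul_left s2 (by linarith)
    have q5 : (n:ℝ)^2 ≤ (4*E)^2 := by rw [← sq_abs]; exact pow_le_pow_left₀ (abs_nonneg _) q4 2
    have r3' : (n:ℝ)^2+1 = ((a:ℝ)^2+(b:ℝ)^2)^2*((c:ℝ)^2+(d:ℝ)^2) := by exact_mod_cast r3
    have q6 : (E/2)^2*(F/2) ≤ ((a:ℝ)^2+(b:ℝ)^2)^2*((c:ℝ)^2+(d:ℝ)^2) :=
      mul_le_mul (pow_le_pow_left₀ (by linarith) e1.le 2) f1.le (by linarith) (by positivity)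
    have q7 : E^2*129 ≤ E^2*F := mul_le_mul_of_nonneg_left hF (sq_nonneg E)
    have q8 : (40:ℝ)^2 ≤ E^2 := pow_le_pow_left₀ (by norm_num) hE 2
    linarith

theorem fiberF (E F : ℝ) (hE : 40 ≤ E) (hF : 129 ≤ F) (x y : ℤ) (S : Finset Q4) (hS : ∀ t ∈ S, Sol E F t)
    (hxy : ∀ t ∈ S, (t.c = x ∧ t.d = y) ∨ (t.c = -x ∧ t.d = -y)) : S.card ≤ 2 := by
  classical
  have hsub : S ⊆ (S.filter fun t => t.c = x ∧ t.d = y) ∪ (S.filter fun t => t.c = -x ∧ t.d = -y) := by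
    intro t ht
    rw [Finset.mem_union, Finset.mem_filter, Finset.mem_filter]
    rcases hxy t ht with h | h
    · exact Or.inl ⟨ht, h⟩
    · exact Or.inr ⟨ht, h⟩
  have h1 : ∀ x y : ℤ, (S.filter fun t => t.c = x ∧ t.d = y).card ≤ 1 := by
    intro x y
    rw [Finset.card_le_one]
    intro t ht t' ht'
    rw [Finset.mem_filter] at ht ht'
    exact uniqF E F hE hF t t' (hS t ht.1) (hS t' ht'.1) (by rw [ht.2.1, ht'.2.1]) (by rw [ht.2.2, ht'.2.2])
  have := (Finset.card_le_card hsub).trans (Finset.card_union_le _ _)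
  have := h1 x y; have := h1 (-x) (-y)
  omega

open Polynomial

theorem abs_le_of_sum_sq {y z B F : ℝ} (hB : 0 ≤ B) (h : y^2+z^2 ≤ F) (hF : F ≤ B^2) : |y| ≤ B ∧ |z| ≤ B :=
  ⟨real_sq_le hB (by linarith [sq_nonneg z]), real_sq_le hB (by linarith [sq_nonneg y])⟩

theorem natDeg_lin (m l : ℚ) : (C m * X + C l : ℚ[X]).natDegree ≤ 1 := natDegree_linear_le

theorem sectorE (k : ℕ) (ε : ℝ) (hε : 0 < ε) : ∃ C : ℝ, 0 < C ∧ ∀ E F Λ B : ℝ, 40 ≤ E → F ≤ 8*E^2 → 1 ≤ Λ → Λ ≤ B → F ≤ B^2 →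
    ∀ l1 l2 m1 m2 : ℤ, m1*l2-m2*l1 = 1 → ∀ h : Fin (k+1) × Fin (k+1) → ℤ, h ≠ 0 → ∀ S : Finset Q4,
    (∀ t ∈ S, Sol E F t) → (∀ t ∈ S, |((t.a*l2-t.b*l1 : ℤ):ℝ)| ≤ Λ ∧ |((m1*t.b-m2*t.a:ℤ):ℝ)| ≤ Λ) →
    (∀ t ∈ S, ∑ i : Fin (k+1) × Fin (k+1), h i * ((t.a^(k-(i.1:ℕ)) * t.b^(i.1:ℕ)) * (t.c^(k-(i.2:ℕ)) * t.d^(i.2:ℕ))) = 0) →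
    (S.card:ℝ) ≤ 25 * (C * B^ε * Λ + 1) := by
  obtain ⟨c, hc, hcc⟩ := box_count k 2 1 (by norm_num) ε hε
  refine ⟨c, hc, ?_⟩
  intro E F Λ B hE hF hΛ hΛB hFB l1 l2 m1 m2 hdet h h0 S hS hbox hform
  have hA := natDeg_lin m1 l1
  have hD := natDeg_lin m2 l2
  have := hcc Λ B hΛ hΛB 25 S
    (C (2*(C (m1:ℚ) * X + C (l1:ℚ))*(C (m2:ℚ) * X + C (l2:ℚ))) + C ((C (m1:ℚ) * X + C (l1:ℚ))^2 - (C (m2:ℚ) * X + C (l2:ℚ))^2) * X)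
    Q4.a Q4.b Q4.d Q4.c ?_ ?_ l1 l2 m1 m2 hdet h h0 ?_ ?_ hform
    (fun x y S' hS' h1 => fiberE E F hE hF x y S' (fun t ht => hS t (hS' ht)) h1)
  · exact_mod_cast this
  · rw [add_comm]; exact natDegree_linear_le
  · intro j
    rw [coeff_add, coeff_C, coeff_C_mul_X]
    have d1 : (2*(C (m1:ℚ) * X + C (l1:ℚ))*(C (m2:ℚ) * X + C (l2:ℚ))).natDegree ≤ 2 := by
      have : (2:ℚ[X]) = C 2 := rfl
      rw [mul_assoc, this]
      exact (natDegree_C_mul_le _ _).trans (natDegree_mul_le.trans (by omega))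
    have d2 : ((C (m1:ℚ) * X + C (l1:ℚ))^2 - (C (m2:ℚ) * X + C (l2:ℚ))^2).natDegree ≤ 2 := by
      refine (natDegree_sub_le _ _).trans (max_le ?_ ?_)
      · have := natDegree_pow_le_of_le 2 hA; omega
      · have := natDegree_pow_le_of_le 2 hD; omega
    split_ifs
    any_goals omega
    all_goals simp only [add_zero, zero_add, natDegree_zero]
    all_goals first | exact d1 | exact d2 | omega
  · intro t ht
    have hs := hS t ht
    have hcd := abs_le_of_sum_sq (by linarith : 0 ≤ B) hs.f2 hFB
    exact ⟨hs.ca, hs.cc.symm, hs.c0 hE, hcd.2, hcd.1, (hbox t ht).1, (hbox t ht).2⟩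
  · intro t ht hq
    have hs := hS t ht
    have hq' : ((m1*t.b-m2*t.a:ℤ):ℚ) ≠ 0 := by exact_mod_cast hq
    have hs' : (t.c:ℚ) ≠ 0 := by exact_mod_cast hs.c0 hE
    simp only [evalEval, eval_mul, eval_C, eval_pow, eval_X, eval_add, eval_sub, eval_ofNat]
    have heq : (2*t.a*t.b*t.c+(t.a^2-t.b^2)*t.d:ℚ) = 1 := by exact_mod_cast hs.eq
    have hdq : (m1:ℚ)*l2-m2*l1 = 1 := by exact_mod_cast hdet
    generalize hqq : ((m1*t.b-m2*t.a:ℤ):ℚ) = q at *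
    have e1 : (m1:ℚ)*(((t.a*l2-t.b*l1:ℤ):ℚ)/q)+l1 = t.a/q := by
      field_simp
      rw [← hqq]; push_cast; linear_combination (t.a:ℚ)*hdq
    have e2 : (m2:ℚ)*(((t.a*l2-t.b*l1:ℤ):ℚ)/q)+l2 = t.b/q := by
      field_simp
      rw [← hqq]; push_cast; linear_combination (t.b:ℚ)*hdq
    rw [e1, e2, ← heq]
    field_simp

theorem sectorF (k : ℕ) (ε : ℝ) (hε : 0 < ε) : ∃ C : ℝ, 0 < C ∧ ∀ E F Λ B : ℝ, 40 ≤ E → 129 ≤ F → 1 ≤ Λ → Λ ≤ B → E ≤ B^2 →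
    ∀ l1 l2 m1 m2 : ℤ, m1*l2-m2*l1 = 1 → ∀ h : Fin (k+1) × Fin (k+1) → ℤ, h ≠ 0 → ∀ S : Finset Q4,
    (∀ t ∈ S, Sol E F t) → (∀ t ∈ S, |((t.c*l2-t.d*l1 : ℤ):ℝ)| ≤ Λ ∧ |((m1*t.d-m2*t.c:ℤ):ℝ)| ≤ Λ) →
    (∀ t ∈ S, ∑ i : Fin (k+1) × Fin (k+1), h i * ((t.a^(k-(i.1:ℕ)) * t.b^(i.1:ℕ)) * (t.c^(k-(i.2:ℕ)) * t.d^(i.2:ℕ))) = 0) →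
    (S.card:ℝ) ≤ 25 * (C * B^ε * Λ + 1) := by
  obtain ⟨c, hc, hcc⟩ := box_count k 1 2 (by norm_num) ε hε
  refine ⟨c, hc, ?_⟩
  intro E F Λ B hE hF hΛ hΛB hFB l1 l2 m1 m2 hdet h h0 S hS hbox hform
  have hA := natDeg_lin m1 l1
  have hD := natDeg_lin m2 l2
  have := hcc Λ B hΛ hΛB 25 S
    (C (-(C (m2:ℚ) * X + C (l2:ℚ))) * X^2 + C (2*(C (m1:ℚ) * X + C (l1:ℚ))) * X + C (C (m2:ℚ) * X + C (l2:ℚ)))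
    Q4.c Q4.d Q4.b Q4.a ?_ ?_ l1 l2 m1 m2 hdet (fun i => h (i.2, i.1)) ?_ ?_ ?_ ?_
    (fun x y S' hS' h1 => (fiberF E F hE hF x y S' (fun t ht => hS t (hS' ht)) h1).trans (by norm_num))
  · exact_mod_cast this
  · exact natDegree_quadratic_le
  · intro j
    rw [coeff_add, coeff_add, coeff_C, coeff_C_mul_X, coeff_C_mul_X_pow]
    have d1 : (-(C (m2:ℚ) * X + C (l2:ℚ))).natDegree ≤ 1 := by rw [natDegree_neg]; exact hD
    have d2 : (2*(C (m1:ℚ) * X + C (l1:ℚ))).natDegree ≤ 1 := by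
      have : (2:ℚ[X]) = C 2 := rfl
      rw [this]
      exact (natDegree_C_mul_le _ _).trans hA
    split_ifs
    any_goals omega
    all_goals simp only [add_zero, zero_add, natDegree_zero]
    all_goals first | exact d1 | exact d2 | exact hD | omega
  · intro h1
    apply h0
    funext i
    exact congrFun h1 (i.2, i.1)
  · intro t ht
    have hs := hS t ht
    have hcd := abs_le_of_sum_sq (by linarith : 0 ≤ B) hs.e2 hFB
    have := hs.a1 hE
    exact ⟨hs.cc, hs.ca.symm, by omega, hcd.2, hcd.1, (hbox t ht).1, (hbox t ht).2⟩
  · intro t ht hq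
    have hs := hS t ht
    have hq' : ((m1*t.d-m2*t.c:ℤ):ℚ) ≠ 0 := by exact_mod_cast hq
    have hs' : (t.a:ℚ) ≠ 0 := by
      have := hs.a1 hE
      exact_mod_cast (by omega : t.a ≠ 0)
    simp only [evalEval, eval_mul, eval_C, eval_pow, eval_X, eval_add, eval_neg, eval_ofNat]
    have heq : (2*t.a*t.b*t.c+(t.a^2-t.b^2)*t.d:ℚ) = 1 := by exact_mod_cast hs.eq
    have hdq : (m1:ℚ)*l2-m2*l1 = 1 := by exact_mod_cast hdet
    generalize hqq : ((m1*t.d-m2*t.c:ℤ):ℚ) = q at *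
    have e1 : (m1:ℚ)*(((t.c*l2-t.d*l1:ℤ):ℚ)/q)+l1 = t.c/q := by
      field_simp
      rw [← hqq]; push_cast; linear_combination (t.c:ℚ)*hdq
    have e2 : (m2:ℚ)*(((t.c*l2-t.d*l1:ℤ):ℚ)/q)+l2 = t.d/q := by
      field_simp
      rw [← hqq]; push_cast; linear_combination (t.d:ℚ)*hdq
    rw [e1, e2, ← heq]
    field_simp
    ring
  · intro t ht
    rw [← hform t ht]
    refine Fintype.sum_equiv (Equiv.prodComm _ _) _ _ fun i => ?_
    simp only [Equiv.prodComm_apply, Prod.fst_swap, Prod.snd_swap, Prod.swap]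
    ring


theorem compl_vec (k h : ℤ) (hk : 1 ≤ k) (hc : IsCoprime k h) : ∃ m1 m2 : ℤ, m1*h-m2*k = 1 ∧ |m1| ≤ k := by
  obtain ⟨u, v, huv⟩ := hc
  refine ⟨v % k, -u - h*(v/k), ?_, ?_⟩
  · have := Int.emod_add_mul_ediv v k
    linear_combination huv + h * this
  · rw [abs_of_nonneg (Int.emod_nonneg _ (by omega))]
    exact (Int.emod_lt_of_pos _ (by omega)).le

theorem dir_box (s : ℝ) (hs : |s| ≤ 1) (Q : ℕ) (hQ : 1 ≤ Q) : ∃ (k : ℕ) (h m1 m2 : ℤ), 1 ≤ k ∧ k ≤ Q ∧ |h| ≤ k ∧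
    m1*h-m2*k = 1 ∧ |s*k-h| ≤ 1/(Q+1) ∧
    ∀ (w1 w2 : ℤ) (R D : ℝ), |(w1:ℝ)| ≤ R → |(w2:ℝ)-s*w1| ≤ D →
      |((w1*h-w2*k:ℤ):ℝ)| ≤ 2*R/k+k*D ∧ |((m1*w2-m2*w1:ℤ):ℝ)| ≤ 2*R/k+k*D := by
  obtain ⟨q, hq1, hq2⟩ := Real.exists_rat_abs_sub_le_and_den_le s (n := Q) (by omega)
  have hd : 1 ≤ q.den := q.pos
  obtain ⟨m1, m2, hm, hm1⟩ := compl_vec q.den q.num (by exact_mod_cast hd)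
    (by rw [Int.isCoprime_iff_gcd_eq_one]; exact q.reduced.symm)
  have hdR : (1:ℝ) ≤ q.den := by exact_mod_cast hd
  have hd0 : (0:ℝ) < q.den := by linarith
  have hqe : (q:ℝ) = q.num/q.den := by exact_mod_cast (Rat.num_div_den q).symm
  have h1 : |s*q.den-q.num| ≤ 1/((Q:ℝ)+1) := by
    have : s*q.den-q.num = (s-q)*q.den := by rw [hqe]; field_simp
    rw [this, abs_mul, abs_of_pos hd0]
    calc _ ≤ 1/(((Q:ℝ)+1)*q.den)*q.den := by gcongr
      _ = _ := by field_simp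
  have hQR : (1:ℝ) ≤ Q := by exact_mod_cast hQ
  have hkQ : (q.den:ℝ) ≤ Q := by exact_mod_cast hq2
  have h2 : 1/((Q:ℝ)+1) < 1 := by rw [div_lt_one (by linarith)]; linarith
  have h3 : 1/((Q:ℝ)+1) ≤ 1/q.den := one_div_le_one_div_of_le hd0 (by linarith)
  refine ⟨q.den, q.num, m1, m2, hd, hq2, ?_, hm, h1, ?_⟩
  · have : |(q.num:ℝ)| < q.den+1 := by
      have e : (q.num:ℝ) = s*q.den - (s*q.den-q.num) := by ring
      rw [e]
      refine (abs_sub _ _).trans_lt ?_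
      rw [abs_mul, abs_of_pos hd0]
      have := mul_le_mul_of_nonneg_right hs hd0.le
      linarith
    have : |q.num| < (q.den:ℤ)+1 := by exact_mod_cast this
    omega
  · intro w1 w2 R D hw hD
    have hR : 0 ≤ R := (abs_nonneg _).trans hw
    have hD0 : 0 ≤ D := (abs_nonneg _).trans hD
    generalize q.num = h at *
    generalize q.den = k at *
    have hmR : (m1:ℝ)*h-m2*k = 1 := by exact_mod_cast hm
    have hm1R : |(m1:ℝ)| ≤ k := by exact_mod_cast hm1
    have hRk : 0 ≤ R/k := by positivity
    constructor
    · have e : ((w1*h-w2*k:ℤ):ℝ) = -((s*k-h)*w1 + k*((w2:ℝ)-s*w1)) := by push_cast; ring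
      rw [e, abs_neg]
      refine (abs_add_le _ _).trans ?_
      rw [abs_mul, abs_mul, abs_of_pos hd0]
      have a1 : |s*k-h| * |(w1:ℝ)| ≤ 1/k*R := mul_le_mul (h1.trans h3) hw (abs_nonneg _) (by positivity)
      have a2 : (k:ℝ) * |(w2:ℝ)-s*w1| ≤ k*D := by gcongr
      have : 1/k*R = R/(k:ℝ) := by ring
      have : 2*R/(k:ℝ) = 2*(R/k) := by ring
      linarith
    · have e : ((m1*w2-m2*w1:ℤ):ℝ) = m1*((w2:ℝ)-s*w1) + (m1*(s*k-h)+1)*(w1/k) := by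
        push_cast; field_simp; linear_combination (w1:ℝ)*hmR
      rw [e]
      refine (abs_add_le _ _).trans ?_
      rw [abs_mul, abs_mul, abs_div, abs_of_pos hd0]
      have a1 : |(m1:ℝ)| * |(w2:ℝ)-s*w1| ≤ k*D := mul_le_mul hm1R hD (abs_nonneg _) hd0.le
      have a2 : |(m1:ℝ)*(s*k-h)+1| ≤ 2 := by
        refine (abs_add_le _ _).trans ?_
        rw [abs_mul, abs_one]
        have : |(m1:ℝ)| * |s*k-h| ≤ k*(1/k) := mul_le_mul hm1R (h1.trans h3) (abs_nonneg _) hd0.le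
        have e3 : (k:ℝ)*(1/k) = 1 := by field_simp
        linarith
      have a3 : |(m1:ℝ)*(s*k-h)+1| * (|(w1:ℝ)|/k) ≤ 2*(R/k) := mul_le_mul a2 (by gcongr) (by positivity) (by norm_num)
      have : 2*R/(k:ℝ) = 2*(R/k) := by ring
      linarith

theorem card_diam (T : Finset ℕ) (L : ℝ) (hL : 0 ≤ L) (h : ∀ i ∈ T, ∀ j ∈ T, |(i:ℝ)-j| ≤ L) : (T.card:ℝ) ≤ L+1 := by
  rcases T.eq_empty_or_nonempty with h0 | hne
  · simp [h0]; linarith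
  have hsub : T ⊆ Finset.Icc (T.min' hne) (T.max' hne) := fun i hi =>
    Finset.mem_Icc.2 ⟨T.min'_le i hi, T.le_max' i hi⟩
  have h1 := Finset.card_le_card hsub
  rw [Nat.card_Icc] at h1
  have h2 := h _ (T.max'_mem hne) _ (T.min'_mem hne)
  have h3 := (le_abs_self _).trans h2
  have h4 : T.card + T.min' hne ≤ T.max' hne + 1 := by
    have := T.min'_le _ (T.max'_mem hne)
    omega
  have h5 : (T.card:ℝ) + T.min' hne ≤ T.max' hne + 1 := by exact_mod_cast h4
  linarith

theorem farey_sum (M Q : ℕ) (hQ : 1 ≤ Q) (J : Finset ℕ) (s : ℕ → ℝ)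
    (hsp : ∀ i ∈ J, ∀ j ∈ J, |(i:ℝ)-j| ≤ M * |s i - s j|) (k : ℕ → ℕ) (h : ℕ → ℤ)
    (hk1 : ∀ j ∈ J, 1 ≤ k j) (hkQ : ∀ j ∈ J, k j ≤ Q) (hh : ∀ j ∈ J, |h j| ≤ k j)
    (hd : ∀ j ∈ J, |s j * k j - h j| ≤ 1/(Q+1)) :
    ∑ j ∈ J, (1:ℝ)/k j ≤ 3*(2*M/Q*(1+Real.log Q) + Q) := by
  classical
  have hQR : (1:ℝ) ≤ Q := by exact_mod_cast hQ
  have h1 : ∑ j ∈ J, (1:ℝ)/k j = ∑ q ∈ Finset.Icc 1 Q, ∑ j ∈ J with k j = q, (1:ℝ)/k j :=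
    (Finset.sum_fiberwise_of_maps_to (fun j hj => Finset.mem_Icc.2 ⟨hk1 j hj, hkQ j hj⟩) _).symm
  have h2 : ∀ q ∈ Finset.Icc 1 Q, ∑ j ∈ J with k j = q, (1:ℝ)/k j ≤ 3*(2*M/Q*(1/q)+1) := by
    intro q hq
    obtain ⟨hq1, hq2⟩ := Finset.mem_Icc.1 hq
    have hqR : (1:ℝ) ≤ q := by exact_mod_cast hq1
    have e1 : ∑ j ∈ J with k j = q, (1:ℝ)/k j = (J.filter fun j => k j = q).card * (1/(q:ℝ)) := by
      rw [← nsmul_eq_mul]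
      refine Finset.sum_eq_card_nsmul fun j hj => ?_
      rw [(Finset.mem_filter.1 hj).2]
    have e2 : (J.filter fun j => k j = q).card = ∑ p ∈ Finset.Icc (-(q:ℤ)) q, ((J.filter fun j => k j = q).filter fun j => h j = p).card := by
      refine Finset.card_eq_sum_card_fiberwise fun j hj => ?_
      have hj' := Finset.mem_filter.1 (Finset.mem_coe.1 hj)
      have := hh j hj'.1
      rw [hj'.2] at this
      exact Finset.mem_coe.2 (Finset.mem_Icc.2 (abs_le.1 this))
    have e3 : ∀ p ∈ Finset.Icc (-(q:ℤ)) q, (((J.filter fun j => k j = q).filter fun j => h j = p).card:ℝ) ≤ 2*M/Q*(1/q)+1 := by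
      intro p hp
      refine card_diam _ _ (by positivity) ?_
      intro i hi j hj
      simp only [Finset.mem_filter] at hi hj
      obtain ⟨⟨hiJ, hik⟩, hih⟩ := hi
      obtain ⟨⟨hjJ, hjk⟩, hjh⟩ := hj
      have a1 := hd i hiJ; have a2 := hd j hjJ
      rw [hik, hih] at a1
      rw [hjk, hjh] at a2
      have a3 : |s i - s j| * q ≤ 2/Q := by
        have e : |s i - s j| * q = |(s i*q-p) - (s j*q-p)| := by
          rw [← abs_of_nonneg (by linarith : (0:ℝ) ≤ q), ← abs_mul]; congr 1
          rw [abs_of_nonneg (by linarith : (0:ℝ) ≤ q)]; ring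
        rw [e]
        refine (abs_sub _ _).trans ?_
        have : 1/((Q:ℝ)+1) ≤ 1/Q := one_div_le_one_div_of_le (by linarith) (by linarith)
        have : 2/(Q:ℝ) = 1/Q+1/Q := by ring
        linarith
      have a4 : |s i - s j| ≤ 2/Q*(1/q) := by
        rw [← le_div_iff₀ (by linarith)] at a3
        refine a3.trans (le_of_eq (by ring))
      refine (hsp i hiJ j hjJ).trans ?_
      refine (mul_le_mul_of_nonneg_left a4 (Nat.cast_nonneg M)).trans (le_of_eq (by ring))
    have e4 : ((J.filter fun j => k j = q).card:ℝ) ≤ (3*q)*(2*M/Q*(1/q)+1) := by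
      rw [e2]; push_cast
      refine (Finset.sum_le_sum e3).trans ?_
      rw [Finset.sum_const, nsmul_eq_mul, Int.card_Icc]
      have : ((q:ℤ)+1 - -(q:ℤ)).toNat = 2*q+1 := by omega
      rw [this]
      gcongr
      push_cast; linarith
    rw [e1]
    calc _ ≤ (3*q)*(2*M/Q*(1/q)+1) * (1/(q:ℝ)) := by gcongr
      _ = 3*(2*M/Q*(1/q)+1)*(q*(1/q)) := by ring
      _ = _ := by rw [mul_one_div_cancel (by positivity)]; ring
  rw [h1]
  refine (Finset.sum_le_sum h2).trans ?_
  rw [← Finset.mul_sum, Finset.sum_add_distrib, ← Finset.mul_sum]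
  have h3 : ∑ q ∈ Finset.Icc 1 Q, (1:ℝ)/q ≤ 1+Real.log Q := by
    have := harmonic_le_one_add_log Q
    rw [harmonic_eq_sum_Icc] at this
    push_cast at this
    simpa using this
  simp only [Finset.sum_const, nsmul_eq_mul, Nat.card_Icc, mul_one, Nat.add_sub_cancel]
  gcongr

theorem side_total (M : ℕ) (hM : 1 ≤ M) (J : Finset ℕ) (hJ : J ⊆ Finset.range (M+1)) (s : ℕ → ℝ)
    (hs : ∀ j ∈ J, |s j| ≤ 1) (hsp : ∀ i ∈ J, ∀ j ∈ J, |(i:ℝ)-j| ≤ M * |s i - s j|)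
    (R c0 A : ℝ) (hR : 0 ≤ R) (hc0 : 0 ≤ c0) (hA : 0 ≤ A) (S : ℕ → Finset Q4) (w1 w2 : Q4 → ℤ)
    (hw : ∀ j ∈ J, ∀ t ∈ S j, |(w1 t:ℝ)| ≤ R ∧ |(w2 t:ℝ)-s j*w1 t| ≤ c0*R/M)
    (hcount : ∀ j ∈ J, ∀ Λ : ℝ, 1 ≤ Λ → Λ ≤ (c0+2)*R+1 → ∀ k h m1 m2 : ℤ, m1*h-m2*k = 1 →
      (∀ t ∈ S j, |((w1 t*h-w2 t*k:ℤ):ℝ)| ≤ Λ ∧ |((m1*w2 t-m2*w1 t:ℤ):ℝ)| ≤ Λ) → ((S j).card:ℝ) ≤ 25*(A*Λ+1)) :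
    ∑ j ∈ J, ((S j).card:ℝ) ≤ 25*(A*((c0+2)*R*(27*Real.sqrt M*(1+Real.log M))+(M+1))+(M+1)) := by
  obtain ⟨Q, hQ⟩ : ∃ Q, Q = Nat.sqrt M := ⟨_, rfl⟩
  have hQ1 : 1 ≤ Q := by rw [hQ]; exact Nat.sqrt_pos.2 hM
  have hQM : Q*Q ≤ M := by rw [hQ]; exact Nat.sqrt_le M
  have hMQ : M ≤ 4*(Q*Q) := by
    have : M < (Q+1)*(Q+1) := by rw [hQ]; exact Nat.lt_succ_sqrt M
    nlinarith
  have hQR : (1:ℝ) ≤ Q := by exact_mod_cast hQ1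
  have hMR : (1:ℝ) ≤ M := by exact_mod_cast hM
  have hQMR : (Q:ℝ)*Q ≤ M := by exact_mod_cast hQM
  have hMQR : (M:ℝ) ≤ 4*(Q*Q) := by exact_mod_cast hMQ
  have hex : ∀ j, ∃ (k : ℕ) (h m1 m2 : ℤ), j ∈ J → (1 ≤ k ∧ k ≤ Q ∧ |h| ≤ k ∧
    m1*h-m2*k = 1 ∧ |s j*k-h| ≤ 1/(Q+1) ∧
    ∀ (w1 w2 : ℤ) (R D : ℝ), |(w1:ℝ)| ≤ R → |(w2:ℝ)-s j*w1| ≤ D →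
      |((w1*h-w2*k:ℤ):ℝ)| ≤ 2*R/k+k*D ∧ |((m1*w2-m2*w1:ℤ):ℝ)| ≤ 2*R/k+k*D) := by
    intro j
    by_cases hj : j ∈ J
    · obtain ⟨k, h, m1, m2, H⟩ := dir_box (s j) (hs j hj) Q hQ1
      exact ⟨k, h, m1, m2, fun _ => H⟩
    · exact ⟨0, 0, 0, 0, fun h => absurd h hj⟩
  choose k h m1 m2 H using hex
  have hfs := farey_sum M Q hQ1 J s hsp k h (fun j hj => (H j hj).1) (fun j hj => (H j hj).2.1)
    (fun j hj => (H j hj).2.2.1) (fun j hj => (H j hj).2.2.2.2.1)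
  have hlog : Real.log Q ≤ Real.log M := Real.log_le_log (by linarith) (by nlinarith)
  have hlog0 : 0 ≤ Real.log Q := Real.log_nonneg hQR
  have hsq : (Q:ℝ) ≤ Real.sqrt M := Real.le_sqrt_of_sq_le (by rw [sq]; exact hQMR)
  have hfs2 : ∑ j ∈ J, (1:ℝ)/k j ≤ 27*Real.sqrt M*(1+Real.log M) := by
    refine hfs.trans ?_
    have a1 : 2*M/Q ≤ 8*(Q:ℝ) := by rw [div_le_iff₀ (by linarith)]; linarith
    have a2 : 2*M/Q*(1+Real.log Q) ≤ 8*(Q:ℝ)*(1+Real.log Q) := by gcongr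
    have a3 : (Q:ℝ) ≤ Q*(1+Real.log Q) := le_mul_of_one_le_right (by linarith) (by linarith)
    have a4 : (Q:ℝ)*(1+Real.log Q) ≤ Real.sqrt M*(1+Real.log M) := by gcongr
    linarith
  have hj : ∀ j ∈ J, ((S j).card:ℝ) ≤ 25*(A*((c0+2)*R*(1/k j)+1)+1) := by
    intro j hj
    obtain ⟨b1, b2, b3, b4, b5, b6⟩ := H j hj
    have b1R : (1:ℝ) ≤ k j := by exact_mod_cast b1
    have b2R : (k j:ℝ) ≤ Q := by exact_mod_cast b2
    have hk0 : (0:ℝ) ≤ 1/k j := by positivity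
    have hk1 : (1:ℝ)/k j ≤ 1 := by rw [div_le_one (by linarith)]; exact b1R
    have hcR : 0 ≤ (c0+2)*R := by positivity
    refine hcount j hj _ (by linarith [mul_nonneg hcR hk0]) (by linarith [mul_le_mul_of_nonneg_left hk1 hcR]) (k j) (h j) (m1 j) (m2 j) b4 ?_
    intro t ht
    obtain ⟨u1, u2⟩ := hw j hj t ht
    have := b6 _ _ _ _ u1 u2
    have key : 2*R/k j + k j*(c0*R/M) ≤ (c0+2)*R*(1/k j)+1 := by
      have v1 : (k j:ℝ)/M ≤ 1/k j := by
        rw [div_le_div_iff₀ (by linarith) (by linarith)]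
        have : (k j:ℝ)*k j ≤ Q*Q := by gcongr
        linarith
      have v2 := mul_le_mul_of_nonneg_left v1 (by positivity : 0 ≤ c0*R)
      have e1 : 2*R/k j + k j*(c0*R/M) = 2*R*(1/k j) + c0*R*(k j/M) := by ring
      rw [e1]; linarith
    exact ⟨this.1.trans key, this.2.trans key⟩
  refine (Finset.sum_le_sum hj).trans ?_
  have hJc : (J.card:ℝ) ≤ M+1 := by
    have := Finset.card_le_card hJ
    rw [Finset.card_range] at this
    exact_mod_cast this
  have e : ∑ j ∈ J, 25*(A*((c0+2)*R*(1/(k j:ℝ))+1)+1) = 25*(A*((c0+2)*R*(∑ j ∈ J, 1/(k j:ℝ)) + J.card)+J.card) := by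
    rw [← Finset.mul_sum, Finset.sum_add_distrib, ← Finset.mul_sum, Finset.sum_add_distrib, ← Finset.mul_sum]
    simp
  rw [e]
  gcongr


theorem sector_cover (E F : ℝ) (hE : 40 ≤ E) (M : ℕ) (hM : 1 ≤ M) (t : Q4) (h : Sol E F t) :
    ∃ j ∈ Finset.range (M+1), |(t.b:ℝ) - (j/M:ℝ)*t.a| ≤ 1/M*t.a := by
  have ha : (2:ℝ) ≤ t.a := by exact_mod_cast h.a1 hE
  have hb : (0:ℝ) ≤ t.b := by exact_mod_cast h.b0
  have hba : (t.b:ℝ) ≤ t.a := by exact_mod_cast h.ba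
  have hMR : (1:ℝ) ≤ M := by exact_mod_cast hM
  have h0 : 0 ≤ M*((t.b:ℝ)/t.a) := by positivity
  have h1 : (t.b:ℝ)/t.a ≤ 1 := by rw [div_le_one (by linarith)]; exact hba
  refine ⟨⌊(M*((t.b:ℝ)/t.a))⌋₊, ?_, ?_⟩
  · rw [Finset.mem_range, Nat.lt_succ_iff]
    refine Nat.floor_le_of_le ?_
    have := mul_le_mul_of_nonneg_left h1 (Nat.cast_nonneg (α := ℝ) M)
    linarith
  · have f1 := Nat.floor_le h0
    have f2 := Nat.lt_floor_add_one (M*((t.b:ℝ)/t.a))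
    generalize ⌊(M*((t.b:ℝ)/t.a))⌋₊ = j at *
    have e : (t.b:ℝ) - (j/M:ℝ)*t.a = (M*((t.b:ℝ)/t.a) - j)*(1/M*t.a) := by
      have : (t.a:ℝ) ≠ 0 := by linarith
      field_simp
    rw [e, abs_mul, abs_of_nonneg (by linarith), abs_of_nonneg (a := 1/(M:ℝ)*t.a) (by positivity)]
    have : 0 ≤ 1/(M:ℝ)*t.a := by positivity
    nlinarith

theorem W_bound (E F θ U R a b c d : ℝ) (hE : 40 ≤ E) (h0 : 0 ≤ θ) (h1 : θ ≤ 1) (hU0 : 0 ≤ U) (hU : U ≤ 1/8)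
    (b0 : 0 ≤ b) (ba : b ≤ a) (e1 : E/2 < a^2+b^2) (hR : 0 ≤ R) (f2 : c^2+d^2 ≤ R^2) (hUR : 1/E ≤ U*R)
    (heq : 2*a*b*c+(a^2-b^2)*d = 1) (hs : |b - θ*a| ≤ U*a) : |(1-θ^2)*d + 2*θ*c| ≤ 21*(U*R) := by
  obtain ⟨g, hg⟩ : ∃ y, y = 1+θ^2 := ⟨_, rfl⟩
  have hg1 : 1 ≤ g := by nlinarith
  have hg2 : g ≤ 2 := by nlinarith
  have hgs2 : g^2 ≤ 4 := by nlinarith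
  obtain ⟨X, hX⟩ : ∃ y, y = a+θ*b := ⟨_, rfl⟩
  obtain ⟨Y, hY⟩ : ∃ y, y = b-θ*a := ⟨_, rfl⟩
  rw [← hY] at hs
  have hXa : a ≤ X := by rw [hX]; linarith [mul_nonneg h0 b0]
  have ha : 0 ≤ a := by linarith
  obtain ⟨Z, hZ⟩ : ∃ y, y = (1-θ^2)*c - 2*θ*d := ⟨_, rfl⟩
  obtain ⟨W, hW⟩ : ∃ y, y = (1-θ^2)*d + 2*θ*c := ⟨_, rfl⟩
  have n2 : Z^2+W^2 = g^2*(c^2+d^2) := by rw [hZ, hW, hg]; ring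
  have e' : 2*X*Y*Z+(X^2-Y^2)*W = g^2 := by
    have : 2*X*Y*Z+(X^2-Y^2)*W = g^2*(2*a*b*c+(a^2-b^2)*d) := by rw [hX, hY, hZ, hW, hg]; ring
    rw [this, heq, mul_one]
  rw [← hW]
  have hZR : |Z| ≤ 2*R := by
    refine real_sq_le (by linarith) ?_
    have : g^2*(c^2+d^2) ≤ 4*R^2 := mul_le_mul hgs2 f2 (by positivity) (by norm_num)
    linarith [sq_nonneg W]
  have hXE : E/4 ≤ X^2 := by
    have : a^2 ≤ X^2 := pow_le_pow_left₀ ha hXa 2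
    have : b^2 ≤ a^2 := pow_le_pow_left₀ b0 ba 2
    linarith
  have hX2 : 0 < X^2 := by linarith
  have hX0 : 0 ≤ X := by linarith
  have hYU : |Y| ≤ U*X := hs.trans (mul_le_mul_of_nonneg_left hXa hU0)
  have hY2 : Y^2 ≤ X^2/64 := by
    have h8 : |Y| ≤ X/8 := hYU.trans (by have := mul_le_mul_of_nonneg_right hU hX0; linarith)
    have := pow_le_pow_left₀ (abs_nonneg Y) h8 2
    rw [sq_abs] at this
    linarith
  have k1 : (X^2-Y^2) * |W| ≤ 4 + 2*(X*(U*X)*(2*R)) := by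
    have e : (X^2-Y^2)*W = g^2 - 2*X*Y*Z := by linarith
    have : |(X^2-Y^2)*W| ≤ |g^2| + |2*X*Y*Z| := by rw [e]; exact abs_sub _ _
    rw [abs_mul, abs_of_nonneg (by linarith : 0 ≤ X^2-Y^2), abs_of_nonneg (sq_nonneg g), abs_mul, abs_mul, abs_mul, abs_two, abs_of_nonneg hX0] at this
    have q : X * |Y| * |Z| ≤ X*(U*X)*(2*R) := mul_le_mul (mul_le_mul_of_nonneg_left hYU hX0) hZR (abs_nonneg _) (by positivity)
    linarith
  have k2 : X^2*(63/64) * |W| ≤ (X^2-Y^2) * |W| := mul_le_mul_of_nonneg_right (by linarith) (abs_nonneg _)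
  have k3 : 4 ≤ X^2*(16*(U*R)) := by
    have q1 : 1 ≤ E*(U*R) := by rw [div_le_iff₀ (by linarith)] at hUR; linarith
    have := mul_le_mul_of_nonneg_right hXE (mul_nonneg hU0 hR)
    linarith
  have k4 : X^2 * (63/64 * |W|) ≤ X^2*(20*(U*R)) := by linarith
  have k5 := le_of_mul_le_mul_left k4 hX2
  have : 0 ≤ U*R := mul_nonneg hU0 hR
  linarith

theorem sideE (k : ℕ) (ε : ℝ) (hε : 0 < ε) : ∃ C : ℝ, 0 < C ∧ ∀ (E F B R : ℝ) (M : ℕ), 40 ≤ E → F ≤ 8*E^2 → F ≤ B^2 → 0 ≤ R → E ≤ R^2 →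
    44*R+1 ≤ B → 1 ≤ M → (∀ j : ℕ, j ≤ M → ∃ g : Fin (k+1) × Fin (k+1) → ℤ, g ≠ 0 ∧ ∀ t : Q4, Sol E F t →
      |(t.b:ℝ) - (j/M:ℝ)*t.a| ≤ 1/M*t.a →
      ∑ i, g i * ((t.a^(k-(i.1:ℕ)) * t.b^(i.1:ℕ)) * (t.c^(k-(i.2:ℕ)) * t.d^(i.2:ℕ))) = 0) →
    ∀ S : Finset Q4, (∀ t ∈ S, Sol E F t) →
    (S.card:ℝ) ≤ 50*(C*B^ε*(44*R*(27*Real.sqrt M*(1+Real.log M))+(M+1))+(M+1)) := by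
  classical
  obtain ⟨C, hC, H⟩ := sectorE k ε hε
  refine ⟨C, hC, ?_⟩
  intro E F B R M hE hF hFB hR hER hRB hM hform S hS
  have hMR : (1:ℝ) ≤ M := by exact_mod_cast hM
  have hB0 : 0 ≤ B := by linarith
  have hA : 0 ≤ C*B^ε := by positivity
  obtain ⟨T, hT⟩ : ∃ T : ℕ → Finset Q4, T = fun j : ℕ => S.filter fun t => |(t.b:ℝ) - (j/M:ℝ)*t.a| ≤ 1/M*t.a := ⟨_, rfl⟩
  have hTm : ∀ j t, t ∈ T j ↔ t ∈ S ∧ |(t.b:ℝ) - (j/M:ℝ)*t.a| ≤ 1/M*t.a := by intro j t; rw [hT, Finset.mem_filter]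
  have hsub : S ⊆ (Finset.range (M+1)).biUnion T := by
    intro t ht
    obtain ⟨j, hj, hj2⟩ := sector_cover E F hE M hM t (hS t ht)
    exact Finset.mem_biUnion.2 ⟨j, hj, (hTm j t).2 ⟨ht, hj2⟩⟩
  have hcard : (S.card:ℝ) ≤ ∑ j ∈ Finset.range (M+1), ((T j).card:ℝ) := by
    exact_mod_cast (Finset.card_le_card hsub).trans Finset.card_biUnion_le
  have := side_total M hM (Finset.range (M+1)) (fun _ h => h) (fun j => (j:ℝ)/M) (by
      intro j hj
      have : j ≤ M := by rw [Finset.mem_range] at hj; omega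
      have : (j:ℝ) ≤ M := by exact_mod_cast this
      rw [abs_of_nonneg (by positivity), div_le_one (by linarith)]; exact this) (by
      intro i _ j _
      have : (i:ℝ)/M-j/M = (i-j)/M := by ring
      rw [this, abs_div, abs_of_nonneg (by linarith : (0:ℝ) ≤ M), mul_div_cancel₀ _ (by linarith)])
    R 1 (C*B^ε) hR (by norm_num) hA T Q4.a Q4.b (by
      intro j hj t ht
      obtain ⟨htS, ht2⟩ := (hTm j t).1 ht
      have ha := (abs_le_of_sum_sq hR (hS t htS).e2 hER).1
      refine ⟨ha, ht2.trans ?_⟩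
      rw [one_mul, div_mul_eq_mul_div, one_mul]
      gcongr
      exact (le_abs_self _).trans ha) (by
      intro j hj Λ hΛ1 hΛ2 l1 l2 m1 m2 hdet hb
      obtain ⟨g, hg0, hg⟩ := hform j (by rw [Finset.mem_range] at hj; omega)
      exact H E F Λ B hE hF hΛ1 (by linarith) hFB l1 l2 m1 m2 hdet g hg0 (T j) (fun t ht => hS t ((hTm j t).1 ht).1)
        hb (fun t ht => hg t (hS t ((hTm j t).1 ht).1) ((hTm j t).1 ht).2))
  refine hcard.trans (this.trans ?_)
  have hl : 0 ≤ Real.log M := Real.log_nonneg hMR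
  have : (1+2:ℝ) ≤ 44 := by norm_num
  gcongr
  norm_num

theorem sideF (k : ℕ) (ε : ℝ) (hε : 0 < ε) : ∃ C : ℝ, 0 < C ∧ ∀ (E F B R : ℝ) (M : ℕ), 40 ≤ E → 129 ≤ F → E ≤ B^2 → 0 ≤ R → F ≤ R^2 →
    44*R+1 ≤ B → 8 ≤ M → (M:ℝ) ≤ E*R → (∀ j : ℕ, j ≤ M → ∃ g : Fin (k+1) × Fin (k+1) → ℤ, g ≠ 0 ∧ ∀ t : Q4, Sol E F t →
      |(t.b:ℝ) - (j/M:ℝ)*t.a| ≤ 1/M*t.a →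
      ∑ i, g i * ((t.a^(k-(i.1:ℕ)) * t.b^(i.1:ℕ)) * (t.c^(k-(i.2:ℕ)) * t.d^(i.2:ℕ))) = 0) →
    ∀ S : Finset Q4, (∀ t ∈ S, Sol E F t) →
    (S.card:ℝ) ≤ 50*(C*B^ε*(44*R*(27*Real.sqrt M*(1+Real.log M))+(M+1))+(M+1)) := by
  classical
  obtain ⟨C, hC, H⟩ := sectorF k ε hε
  refine ⟨C, hC, ?_⟩
  intro E F B R M hE hF hEB hR hFR hRB hM hME hform S hS
  have hMR : (8:ℝ) ≤ M := by exact_mod_cast hM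
  have hM0 : (0:ℝ) < M := by linarith
  have hB0 : 0 ≤ B := by linarith
  have hA : 0 ≤ C*B^ε := by positivity
  obtain ⟨T, hT⟩ : ∃ T : ℕ → Finset Q4, T = fun j : ℕ => S.filter fun t => |(t.b:ℝ) - (j/M:ℝ)*t.a| ≤ 1/M*t.a := ⟨_, rfl⟩
  have hTm : ∀ j t, t ∈ T j ↔ t ∈ S ∧ |(t.b:ℝ) - (j/M:ℝ)*t.a| ≤ 1/M*t.a := by intro j t; rw [hT, Finset.mem_filter]
  have hsub : S ⊆ (Finset.range (M+1)).biUnion T := by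
    intro t ht
    obtain ⟨j, hj, hj2⟩ := sector_cover E F hE M (by omega) t (hS t ht)
    exact Finset.mem_biUnion.2 ⟨j, hj, (hTm j t).2 ⟨ht, hj2⟩⟩
  have hcard : (S.card:ℝ) ≤ ∑ j ∈ Finset.range (M+1), ((T j).card:ℝ) := by
    exact_mod_cast (Finset.card_le_card hsub).trans Finset.card_biUnion_le
  have hθ0 : ∀ j : ℕ, (0:ℝ) ≤ j/M := fun j => by positivity
  have hθ1 : ∀ j ∈ Finset.range (M+1), (j:ℝ)/M ≤ 1 := by
    intro j hj
    have : j ≤ M := by rw [Finset.mem_range] at hj; omega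
    have : (j:ℝ) ≤ M := by exact_mod_cast this
    rw [div_le_one hM0]; exact this
  have hθd : ∀ i j : ℕ, |(i:ℝ)-j| = M * |(i:ℝ)/M-j/M| := by
    intro i j
    have : (i:ℝ)/M-j/M = (i-j)/M := by ring
    rw [this, abs_div, abs_of_nonneg hM0.le, mul_div_cancel₀ _ hM0.ne']
  have hUR : 1/E ≤ 1/(M:ℝ)*R := by
    rw [div_le_iff₀ (by linarith)]
    have : 1/(M:ℝ)*R*E = (E*R)/M := by ring
    rw [this, le_div_iff₀ hM0]; linarith
  have hWb : ∀ j ∈ Finset.range (M+1), ∀ t ∈ T j, |(1-((j:ℝ)/M)^2)*t.d + 2*((j:ℝ)/M)*t.c| ≤ 21*(1/M*R) := by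
    intro j hj t ht
    obtain ⟨htS, ht2⟩ := (hTm j t).1 ht
    have hs := hS t htS
    exact W_bound E F _ (1/M) R t.a t.b t.c t.d hE (hθ0 j) (hθ1 j hj) (by positivity)
      (one_div_le_one_div_of_le (by norm_num) hMR) (by exact_mod_cast hs.b0) (by exact_mod_cast hs.ba) hs.e1 hR (hs.f2.trans hFR) hUR
      (by exact_mod_cast hs.eq) ht2
  have hcd : ∀ j, ∀ t ∈ T j, |(t.c:ℝ)| ≤ R ∧ |(t.d:ℝ)| ≤ R := fun j t ht =>
    abs_le_of_sum_sq hR (hS t ((hTm j t).1 ht).1).f2 hFR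
  have hS1 := side_total M (by omega) ((Finset.range (M+1)).filter fun j => 2*((j:ℝ)/M) ≤ 1-((j:ℝ)/M)^2) (Finset.filter_subset _ _)
    (fun j => -(2*((j:ℝ)/M))/(1-((j:ℝ)/M)^2)) (by
      intro j hj
      have h2 := (Finset.mem_filter.1 hj).2
      have h3 := hθ0 j
      have h4 : 0 < 1-((j:ℝ)/M)^2 := by nlinarith
      rw [abs_div, abs_of_pos h4, abs_neg, abs_of_nonneg (by linarith), div_le_one h4]; exact h2) (by
      intro i hi j hj
      have h2 := (Finset.mem_filter.1 hj).2
      have h2' := (Finset.mem_filter.1 hi).2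
      have h3 := hθ0 j
      have h3' := hθ0 i
      rw [hθd]
      refine mul_le_mul_of_nonneg_left ?_ hM0.le
      generalize (i:ℝ)/M = α at *
      generalize (j:ℝ)/M = β at *
      have h4 : 0 < 1-α^2 := by nlinarith
      have h4' : 0 < 1-β^2 := by nlinarith
      have e : -(2*α)/(1-α^2) - -(2*β)/(1-β^2) = -((α-β)*(2*(1+α*β)/((1-α^2)*(1-β^2)))) := by
        field_simp; ring
      rw [e, abs_neg, abs_mul]
      refine le_mul_of_one_le_right (abs_nonneg _) ?_
      rw [abs_of_nonneg (by positivity), le_div_iff₀ (by positivity), one_mul]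
      have : (1-α^2)*(1-β^2) ≤ 1*1 := mul_le_mul (by nlinarith) (by nlinarith) h4'.le (by norm_num)
      linarith [mul_nonneg h3' h3])
    R 42 (C*B^ε) hR (by norm_num) hA T Q4.c Q4.d (by
      intro j hj t ht
      obtain ⟨hj1, h2⟩ := Finset.mem_filter.1 hj
      have h3 := hθ0 j
      have hw := hWb j hj1 t ht
      refine ⟨(hcd j t ht).1, ?_⟩
      generalize (j:ℝ)/M = α at *
      have h5 : 1/2 ≤ 1-α^2 := by nlinarith
      have h4 : 0 < 1-α^2 := by linarith
      have e : (t.d:ℝ) - -(2*α)/(1-α^2)*t.c = ((1-α^2)*t.d+2*α*t.c)/(1-α^2) := by field_simp; ring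
      rw [e, abs_div, abs_of_pos h4, div_le_iff₀ h4]
      refine hw.trans ?_
      have := mul_le_mul_of_nonneg_left h5 (by positivity : 0 ≤ 42*R/M)
      have e2 : 21*(1/M*R) = 42*R/M*(1/2) := by ring
      rw [e2]; exact this) (by
      intro j hj Λ hΛ1 hΛ2 l1 l2 m1 m2 hdet hb
      have hj := (Finset.mem_filter.1 hj).1
      obtain ⟨g, hg0, hg⟩ := hform j (by rw [Finset.mem_range] at hj; omega)
      exact H E F Λ B hE hF hΛ1 (by linarith) hEB l1 l2 m1 m2 hdet g hg0 (T j) (fun t ht => hS t ((hTm j t).1 ht).1)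
        hb (fun t ht => hg t (hS t ((hTm j t).1 ht).1) ((hTm j t).1 ht).2))
  have hS2 := side_total M (by omega) ((Finset.range (M+1)).filter fun j => ¬ 2*((j:ℝ)/M) ≤ 1-((j:ℝ)/M)^2) (Finset.filter_subset _ _)
    (fun j => -(1-((j:ℝ)/M)^2)/(2*((j:ℝ)/M))) (by
      intro j hj
      obtain ⟨hj1, h2⟩ := Finset.mem_filter.1 hj
      have h3 := hθ0 j
      have h5 := hθ1 j hj1
      generalize (j:ℝ)/M = α at *
      have h6 : 0 ≤ 1-α^2 := by nlinarith
      have h4 : 0 < 2*α := by linarith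
      rw [abs_div, abs_of_pos h4, abs_neg, abs_of_nonneg h6, div_le_one h4]; linarith) (by
      intro i hi j hj
      obtain ⟨hj1, h2⟩ := Finset.mem_filter.1 hj
      obtain ⟨hi1, h2'⟩ := Finset.mem_filter.1 hi
      have h3 := hθ0 j
      have h3' := hθ0 i
      have h5 := hθ1 j hj1
      have h5' := hθ1 i hi1
      rw [hθd]
      refine mul_le_mul_of_nonneg_left ?_ hM0.le
      generalize (i:ℝ)/M = α at *
      generalize (j:ℝ)/M = β at *
      have h4 : 0 < α := by nlinarith
      have h4' : 0 < β := by nlinarith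
      have e : -(1-α^2)/(2*α) - -(1-β^2)/(2*β) = (α-β)*((1+1/(α*β))/2) := by
        field_simp; ring
      rw [e, abs_mul]
      refine le_mul_of_one_le_right (abs_nonneg _) ?_
      have : 1 ≤ 1/(α*β) := by
        rw [le_div_iff₀ (by positivity), one_mul]
        calc α*β ≤ 1*1 := mul_le_mul h5' h5 h3 (by norm_num)
          _ = 1 := by norm_num
      rw [abs_of_nonneg (by positivity)]; linarith)
    R 42 (C*B^ε) hR (by norm_num) hA T Q4.d Q4.c (by
      intro j hj t ht
      obtain ⟨hj1, h2⟩ := Finset.mem_filter.1 hj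
      have h3 := hθ0 j
      have hw := hWb j hj1 t ht
      refine ⟨(hcd j t ht).2, ?_⟩
      generalize (j:ℝ)/M = α at *
      have h5 : 1/2 ≤ 2*α := by nlinarith
      have h4 : 0 < α := by linarith
      have e : (t.c:ℝ) - -(1-α^2)/(2*α)*t.d = ((1-α^2)*t.d+2*α*t.c)/(2*α) := by field_simp; ring
      rw [e, abs_div, abs_of_pos (by linarith : 0 < 2*α), div_le_iff₀ (by linarith)]
      refine hw.trans ?_
      have := mul_le_mul_of_nonneg_left h5 (by positivity : 0 ≤ 42*R/M)
      have e2 : 21*(1/M*R) = 42*R/M*(1/2) := by ring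
      rw [e2]; exact this) (by
      intro j hj Λ hΛ1 hΛ2 l1 l2 m1 m2 hdet hb
      have hj := (Finset.mem_filter.1 hj).1
      obtain ⟨g, hg0, hg⟩ := hform j (by rw [Finset.mem_range] at hj; omega)
      refine H E F Λ B hE hF hΛ1 (by linarith) hEB l2 l1 (-m2) (-m1) (by linear_combination hdet) g hg0 (T j) (fun t ht => hS t ((hTm j t).1 ht).1)
        ?_ (fun t ht => hg t (hS t ((hTm j t).1 ht).1) ((hTm j t).1 ht).2)
      intro t ht
      obtain ⟨u1, u2⟩ := hb t ht
      constructor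
      · rw [← abs_neg]; convert u1 using 2; push_cast; ring
      · convert u2 using 2; push_cast; ring)
  rw [← Finset.sum_filter_add_sum_filter_not (Finset.range (M+1)) (fun j : ℕ => 2*((j:ℝ)/M) ≤ 1-((j:ℝ)/M)^2)] at hcard
  have e44 : (42+2:ℝ) = 44 := by norm_num
  rw [e44] at hS1 hS2
  linarith


theorem gauss_cop (n s : ℤ) (x y w : GaussianInt) (hx : x ∣ (⟨n, 1⟩ : GaussianInt)) (hy : y ∣ (⟨n, -1⟩ : GaussianInt))
    (hw : x ∣ w ∨ y ∣ w) (hws : w = 2*(s:GaussianInt)+1) : IsCoprime x y := by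
  obtain ⟨p, hp⟩ := hx
  obtain ⟨q, hq⟩ := hy
  have h2 : (2:GaussianInt) = -(⟨0,1⟩:GaussianInt)*(x*p - y*q) := by
    rw [← hp, ← hq]; ext <;> simp
  rcases hw with ⟨r, hr⟩ | ⟨r, hr⟩
  · refine ⟨r + (⟨0,1⟩:GaussianInt)*p*s, -((⟨0,1⟩:GaussianInt)*q*s), ?_⟩
    linear_combination (-1)*hr + hws + (s:GaussianInt)*h2
  · refine ⟨(⟨0,1⟩:GaussianInt)*p*s, r-((⟨0,1⟩:GaussianInt)*q*s), ?_⟩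
    linear_combination (-1)*hr + hws + (s:GaussianInt)*h2

theorem gauss_red (e f n : ℤ) (he : 0 < e) (h : e^2*f = n^2+1) :
    ∃ a b c d : ℤ, a^2+b^2 = e ∧ c^2+d^2 = f ∧ 2*a*b*c+(a^2-b^2)*d = 1 := by
  have hodd : ∃ s, e^2 = 2*s+1 := by
    rcases Int.even_or_odd' e with ⟨m, hm | hm⟩
    · exfalso
      rw [hm] at h
      have h1 : (n^2+1) % 4 = 0 := by rw [← h]; exact Int.emod_eq_zero_of_dvd ⟨m^2*f, by ring⟩
      rcases Int.even_or_odd' n with ⟨l, hl | hl⟩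
      · have : n^2+1 = 4*l^2+1 := by rw [hl]; ring
        omega
      · have : n^2+1 = 4*(l^2+l)+2 := by rw [hl]; ring
        omega
    · exact ⟨2*m^2+2*m, by rw [hm]; ring⟩
  obtain ⟨s, hs⟩ := hodd
  have hsG : ((e:GaussianInt))^2 = 2*(s:GaussianInt)+1 := by exact_mod_cast congrArg (Int.cast : ℤ → GaussianInt) hs
  have hdvd : ((e:GaussianInt))^2 ∣ (⟨n,1⟩:GaussianInt)*⟨n,-1⟩ := by
    refine ⟨f, ?_⟩
    have : (⟨n,1⟩:GaussianInt)*⟨n,-1⟩ = ((n^2+1:ℤ):GaussianInt) := by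
      ext
      · rw [Zsqrtd.re_mul, Zsqrtd.re_intCast]; ring
      · rw [Zsqrtd.im_mul, Zsqrtd.im_intCast]; ring
    rw [this, ← h]; push_cast; ring
  obtain ⟨x, y, hx, hy, hxy⟩ := exists_dvd_and_dvd_of_dvd_mul hdvd
  have hc := gauss_cop n s x y _ hx hy (Or.inl ⟨y, hxy⟩) hsG
  have hsx : star x ∣ (⟨n,-1⟩:GaussianInt) := by
    obtain ⟨p, hp⟩ := hx
    exact ⟨star p, by rw [← star_mul', ← hp]; ext <;> simp⟩
  have hsy : star y ∣ (⟨n,1⟩:GaussianInt) := by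
    obtain ⟨p, hp⟩ := hy
    exact ⟨star p, by rw [← star_mul', ← hp]; ext <;> simp⟩
  have hstar : star x * star y = x*y := by
    rw [← star_mul', ← hxy, star_pow]; simp
  have c1 := gauss_cop n s x (star x) _ hx hsx (Or.inl ⟨y, hxy⟩) hsG
  have c2 := gauss_cop n s (star y) y _ hsy hy (Or.inr ⟨x, by rw [hxy, mul_comm]⟩) hsG
  have d1 : x ∣ star y := c1.dvd_of_dvd_mul_left ⟨y, hstar⟩
  have d2 : star y ∣ x := c2.dvd_of_dvd_mul_right ⟨star x, by rw [← hstar, mul_comm]⟩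
  have hn1 : x.norm = y.norm := by
    have a1 : x.norm ∣ y.norm := by
      have := map_dvd Zsqrtd.normMonoidHom d1
      simpa [Zsqrtd.normMonoidHom, Zsqrtd.norm_conj] using this
    have a2 : y.norm ∣ x.norm := by
      have := map_dvd Zsqrtd.normMonoidHom d2
      simpa [Zsqrtd.normMonoidHom, Zsqrtd.norm_conj] using this
    exact Int.dvd_antisymm (GaussianInt.norm_nonneg x) (GaussianInt.norm_nonneg y) a1 a2
  have hn2 : x.norm*x.norm = e^2*e^2 := by
    have : (((e:GaussianInt))^2).norm = x.norm * y.norm := by rw [hxy, Zsqrtd.norm_mul]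
    rw [← hn1, sq, Zsqrtd.norm_mul, Zsqrtd.norm_intCast] at this
    rw [← this]; ring
  have hn3 : x.norm = e^2 := by
    rcases mul_self_eq_mul_self_iff.1 hn2 with h | h
    · exact h
    · have := GaussianInt.norm_nonneg x
      have : 0 < e^2 := by positivity
      omega
  obtain ⟨α, hα⟩ := exists_associated_pow_of_mul_eq_pow' hc hxy.symm
  have hαn : α.norm = e := by
    obtain ⟨u, hu⟩ := hα
    have : (α^2*(u:GaussianInt)).norm = e^2 := by rw [hu, hn3]
    have hu1 : (u:GaussianInt).norm = 1 := by
      have := (Zsqrtd.norm_eq_one_iff' (by norm_num : (-1:ℤ) ≤ 0) (u:GaussianInt)).2 u.isUnit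
      exact this
    rw [Zsqrtd.norm_mul, hu1, mul_one, sq, Zsqrtd.norm_mul] at this
    have h0 := GaussianInt.norm_nonneg α
    nlinarith
  obtain ⟨β, hβ⟩ := hα.dvd.trans hx
  have hβn : e^2*β.norm = n^2+1 := by
    have := congrArg Zsqrtd.norm hβ
    rw [Zsqrtd.norm_mul, sq α, Zsqrtd.norm_mul, hαn] at this
    rw [sq e, ← this, Zsqrtd.norm_def]; ring
  have hβf : β.norm = f := by
    have : e^2 ≠ 0 := by positivity
    exact mul_left_cancel₀ this (hβn.trans h.symm)
  refine ⟨α.re, α.im, β.re, β.im, ?_, ?_, ?_⟩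
  · rw [← hαn, Zsqrtd.norm_def]; ring
  · rw [← hβf, Zsqrtd.norm_def]; ring
  · have := congrArg Zsqrtd.im hβ
    simp only [sq, Zsqrtd.im_mul, Zsqrtd.re_mul] at this
    linear_combination (-1)*this

theorem gauss_red2 (e f n : ℤ) (he : 0 < e) (h : e^2*f = n^2+1) :
    ∃ t : Q4, t.a^2+t.b^2 = e ∧ t.c^2+t.d^2 = f ∧ 0 ≤ t.b ∧ t.b ≤ t.a ∧ 2*t.a*t.b*t.c+(t.a^2-t.b^2)*t.d = 1 := by
  obtain ⟨a, b, c, d, h1, h2, h3⟩ := gauss_red e f n he h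
  have : ∃ a b c d : ℤ, a^2+b^2 = e ∧ c^2+d^2 = f ∧ 2*a*b*c+(a^2-b^2)*d = 1 ∧ 0 ≤ a := by
    rcases le_total 0 a with ha | ha
    · exact ⟨a, b, c, d, h1, h2, h3, ha⟩
    · exact ⟨-a, -b, c, d, by linarith, h2, by linarith, by omega⟩
  obtain ⟨a, b, c, d, h1, h2, h3, ha⟩ := this
  have : ∃ a b c d : ℤ, a^2+b^2 = e ∧ c^2+d^2 = f ∧ 2*a*b*c+(a^2-b^2)*d = 1 ∧ 0 ≤ a ∧ 0 ≤ b := by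
    rcases le_total 0 b with hb | hb
    · exact ⟨a, b, c, d, h1, h2, h3, ha, hb⟩
    · exact ⟨a, -b, -c, d, by linarith, by linarith, by linarith, ha, by omega⟩
  obtain ⟨a, b, c, d, h1, h2, h3, ha, hb⟩ := this
  rcases le_total b a with hab | hab
  · exact ⟨⟨a, b, c, d⟩, h1, h2, hb, hab, h3⟩
  · exact ⟨⟨b, a, c, -d⟩, by simp only; linarith, by simp only; linarith, ha, hab, by simp only; linarith⟩

theorem MEF_le (E F K : ℝ) (hK : ∀ S : Finset Q4, (∀ t ∈ S, Sol E F t) → (S.card:ℝ) ≤ K) : (MEF E F : ℝ) ≤ K := by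
  classical
  unfold MEF
  generalize hT : {t : ℕ × ℕ × ℕ | 0 < t.1 ∧ 0 < t.2.1 ∧ 0 < t.2.2 ∧
    E / 2 < (t.1 : ℝ) ∧ (t.1 : ℝ) ≤ E ∧
    F / 2 < (t.2.1 : ℝ) ∧ (t.2.1 : ℝ) ≤ F ∧
    t.1 ^ 2 * t.2.1 = t.2.2 ^ 2 + 1} = T
  have hmem : ∀ t ∈ T, 0 < t.1 ∧ E / 2 < (t.1 : ℝ) ∧ (t.1 : ℝ) ≤ E ∧
    F / 2 < (t.2.1 : ℝ) ∧ (t.2.1 : ℝ) ≤ F ∧ t.1 ^ 2 * t.2.1 = t.2.2 ^ 2 + 1 := by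
    intro t ht
    rw [← hT, Set.mem_ofPred_eq] at ht
    exact ⟨ht.1, ht.2.2.2⟩
  rcases T.finite_or_infinite with hf | hi
  · have hex : ∀ t : ℕ × ℕ × ℕ, ∃ q : Q4, t ∈ T → (q.a^2+q.b^2 = (t.1:ℤ) ∧ q.c^2+q.d^2 = (t.2.1:ℤ) ∧ Sol E F q) := by
      intro t
      by_cases ht : t ∈ T
      · obtain ⟨h0, h1, h2, h3, h4, h5⟩ := hmem t ht
        obtain ⟨q, q1, q2, q3, q4, q5⟩ := gauss_red2 t.1 t.2.1 t.2.2 (by exact_mod_cast h0) (by exact_mod_cast h5)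
        have r1 : (q.a:ℝ)^2+(q.b:ℝ)^2 = t.1 := by exact_mod_cast q1
        have r2 : (q.c:ℝ)^2+(q.d:ℝ)^2 = t.2.1 := by exact_mod_cast q2
        exact ⟨q, fun _ => ⟨q1, q2, q3, q4, by rw [r1]; exact h1, by rw [r1]; exact h2, by rw [r2]; exact h3, by rw [r2]; exact h4, q5⟩⟩
      · exact ⟨⟨0,0,0,0⟩, fun h => absurd h ht⟩
    choose φ hφ using hex
    have hinj : Set.InjOn φ T := by
      intro t ht t' ht' he
      obtain ⟨a1, a2, -⟩ := hφ t ht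
      obtain ⟨b1, b2, -⟩ := hφ t' ht'
      rw [he] at a1 a2
      have e1 : t.1 = t'.1 := by exact_mod_cast a1.symm.trans b1
      have e2 : t.2.1 = t'.2.1 := by exact_mod_cast a2.symm.trans b2
      have h5 := (hmem t ht).2.2.2.2.2
      have h5' := (hmem t' ht').2.2.2.2.2
      rw [e1, e2, h5'] at h5
      have e3 : t.2.2 = t'.2.2 := by
        have : t.2.2^2 = t'.2.2^2 := by omega
        exact (Nat.pow_left_injective (n := 2) (by norm_num)) this
      exact Prod.ext e1 (Prod.ext e2 e3)
    have := hK (hf.toFinset.image φ) (by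
      intro q hq
      obtain ⟨t, ht, rfl⟩ := Finset.mem_image.1 hq
      exact (hφ t (hf.mem_toFinset.1 ht)).2.2)
    rw [Finset.card_image_of_injOn (by rw [hf.coe_toFinset]; exact hinj)] at this
    have e : Nat.card T = hf.toFinset.card := by
      rw [Nat.card_coe_set_eq, Set.ncard_eq_toFinset_card T hf]
    rw [e]; exact this
  · have : Nat.card T = 0 := by
      have := hi.to_subtype
      exact Nat.card_eq_zero_of_infinite
    rw [this]
    simpa using hK ∅ (by simp)


theorem triv_card (E F : ℝ) (N : ℕ) (hE : E ≤ (N:ℝ)^2) (hF : F ≤ (N:ℝ)^2) (S : Finset Q4) (hS : ∀ t ∈ S, Sol E F t) :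
    (S.card:ℝ) ≤ (2*N+1)^4 := by
  classical
  have hi : ∀ y : ℤ, |(y:ℝ)| ≤ (N:ℝ) → y ∈ Finset.Icc (-(N:ℤ)) N := by
    intro y hy
    have : |y| ≤ (N:ℤ) := by exact_mod_cast hy
    exact Finset.mem_Icc.2 (abs_le.1 this)
  obtain ⟨I, hI⟩ : ∃ I, I = Finset.Icc (-(N:ℤ)) N := ⟨_, rfl⟩
  rw [← hI] at hi
  have hIc : I.card = 2*N+1 := by rw [hI, Int.card_Icc]; omega
  have := Finset.card_le_card_of_injOn (s := S) (t := (I ×ˢ I) ×ˢ (I ×ˢ I)) (fun t : Q4 => ((t.a, t.b), (t.c, t.d))) (by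
    intro t ht
    have h := hS t ht
    have h1 := abs_le_of_sum_sq (Nat.cast_nonneg N) h.e2 hE
    have h2 := abs_le_of_sum_sq (Nat.cast_nonneg N) h.f2 hF
    simp only [Finset.coe_product, Set.mem_prod, Finset.mem_coe]
    exact ⟨⟨hi _ h1.1, hi _ h1.2⟩, ⟨hi _ h2.1, hi _ h2.2⟩⟩) (by
    intro t _ t' _ he
    simp only [Prod.mk.injEq] at he
    exact Q4.ext' he.1.1 he.1.2 he.2.1 he.2.2)
  rw [Finset.card_product, Finset.card_product, hIc] at this
  have h2 : (S.card:ℝ) ≤ ((2*N+1)*(2*N+1)*((2*N+1)*(2*N+1)):ℝ) := by exact_mod_cast this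
  refine h2.trans (le_of_eq (by ring))

theorem triv_E (E F : ℝ) (hE : 40 ≤ E) (hF : F ≤ 8*E^2) (S : Finset Q4) (hS : ∀ t ∈ S, Sol E F t) :
    (S.card:ℝ) ≤ 100*E := by
  classical
  obtain ⟨N, hN⟩ : ∃ N, N = ⌊Real.sqrt E⌋₊ := ⟨_, rfl⟩
  have hsq : Real.sqrt E^2 = E := Real.sq_sqrt (by linarith)
  have hNs : (N:ℝ) ≤ Real.sqrt E := by rw [hN]; exact Nat.floor_le (Real.sqrt_nonneg _)
  obtain ⟨I, hI⟩ : ∃ I, I = Finset.Icc (0:ℤ) N := ⟨_, rfl⟩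
  have hIc : I.card = N+1 := by rw [hI, Int.card_Icc]; omega
  have hi : ∀ y : ℤ, 0 ≤ y → |(y:ℝ)| ≤ Real.sqrt E → y ∈ I := by
    intro y hy0 hy
    rw [hI, Finset.mem_Icc]
    refine ⟨hy0, ?_⟩
    obtain ⟨m, rfl⟩ := Int.eq_ofNat_of_zero_le hy0
    have : (m:ℝ) ≤ Real.sqrt E := by simpa using hy
    have := Nat.le_floor this
    rw [← hN] at this
    exact_mod_cast this
  have := Finset.card_le_mul_card_image_of_maps_to (s := S) (t := I ×ˢ I) (f := fun t : Q4 => (t.a, t.b)) (by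
    intro t ht
    have h := hS t ht
    have h1 := abs_le_of_sum_sq (Real.sqrt_nonneg E) h.e2 hsq.ge
    have := h.b0; have := h.ba
    simp only [Finset.mem_product]
    exact ⟨hi _ (by omega) h1.1, hi _ (by omega) h1.2⟩) 25 (by
    intro p _
    refine fiberE E F hE hF p.1 p.2 _ (fun t ht => hS t (Finset.mem_filter.1 ht).1) ?_
    intro t ht
    have := (Finset.mem_filter.1 ht).2
    left
    exact ⟨congrArg Prod.fst this, congrArg Prod.snd this⟩)
  rw [Finset.card_product, hIc] at this
  have h2 : (S.card:ℝ) ≤ 25*((N+1)*(N+1)) := by exact_mod_cast this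
  have h1 : (1:ℝ) ≤ Real.sqrt E := Real.one_le_sqrt.2 (by linarith)
  have h3 : ((N:ℝ)+1)*(N+1) ≤ (2*Real.sqrt E)*(2*Real.sqrt E) := by gcongr <;> linarith
  have h4 : (2*Real.sqrt E)*(2*Real.sqrt E) = 4*E := by linear_combination 4*hsq
  linarith

theorem final_num (x δ C R : ℝ) (M : ℕ) (hx : 2 ≤ x) (hδ : 0 < δ) (hδ1 : δ ≤ 1) (hC : 0 < C) (hR : 0 ≤ R) (hM : 1 ≤ M)
    (hMx : (M:ℝ) ≤ x^2) (hM2 : (M:ℝ)+1 ≤ 3*x^(7/12+δ:ℝ)) (hRM : R*Real.sqrt M ≤ 6*x^(7/12+δ:ℝ)) :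
    50*(C*(100*x)^δ*(44*R*(27*Real.sqrt M*(1+Real.log M))+(M+1))+(M+1)) ≤
    50*(C*100*(7128*(1+2/δ)+3)+3) * x^(7/12+3*δ:ℝ) := by
  have hx0 : 0 < x := by linarith
  have hx1 : 1 ≤ x := by linarith
  obtain ⟨y, hy⟩ : ∃ y, y = x^δ := ⟨_, rfl⟩
  have hy1 : 1 ≤ y := by rw [hy]; exact Real.one_le_rpow hx1 hδ.le
  obtain ⟨p, hp⟩ : ∃ p, p = x^(7/12+δ:ℝ) := ⟨_, rfl⟩
  have hp1 : 1 ≤ p := by rw [hp]; exact Real.one_le_rpow hx1 (by linarith)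
  have e3 : x^(7/12+3*δ:ℝ) = p*y*y := by
    rw [hp, hy, ← Real.rpow_add hx0, ← Real.rpow_add hx0]; congr 1; ring
  rw [e3]
  rw [← hp] at hM2 hRM
  have hB : (100*x)^δ ≤ 100*y := by
    rw [Real.mul_rpow (by norm_num) hx0.le, ← hy]
    have : (100:ℝ)^δ ≤ 100^(1:ℝ) := Real.rpow_le_rpow_of_exponent_le (by norm_num) hδ1
    rw [Real.rpow_one] at this
    gcongr
  have hMR : (1:ℝ) ≤ M := by exact_mod_cast hM
  have hlog : 1+Real.log M ≤ (1+2/δ)*y := by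
    have a1 : Real.log M ≤ Real.log (x^2) := Real.log_le_log (by linarith) hMx
    rw [Real.log_pow] at a1
    have a2 := Real.log_le_rpow_div hx0.le hδ
    rw [← hy] at a2
    push_cast at a1
    have : (1+2/δ)*y = y+2*(y/δ) := by ring
    linarith
  have hl0 : 0 ≤ 1+Real.log M := by linarith [Real.log_nonneg hMR]
  have k1 : 44*R*(27*Real.sqrt M*(1+Real.log M)) ≤ 7128*(1+2/δ)*(p*y) := by
    have : 44*R*(27*Real.sqrt M*(1+Real.log M)) = 1188*((R*Real.sqrt M)*(1+Real.log M)) := by ring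
    rw [this]
    have : (R*Real.sqrt M)*(1+Real.log M) ≤ (6*p)*((1+2/δ)*y) := mul_le_mul hRM hlog hl0 (by linarith)
    linarith
  have k2 : p ≤ p*y := le_mul_of_one_le_right (by linarith) hy1
  have k3 : 44*R*(27*Real.sqrt M*(1+Real.log M))+(M+1) ≤ (7128*(1+2/δ)+3)*(p*y) := by linarith
  have k4 : C*(100*x)^δ*(44*R*(27*Real.sqrt M*(1+Real.log M))+(M+1)) ≤ C*(100*y)*((7128*(1+2/δ)+3)*(p*y)) := by
    gcongr
  have k5 : p*y ≤ p*y*y := le_mul_of_one_le_right (by positivity) hy1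
  linarith

theorem M_bound (x μ : ℝ) (hx : 1 ≤ x) (hμ : 0 ≤ μ) : x^μ ≤ ⌈x^μ⌉₊ ∧ (⌈x^μ⌉₊:ℝ) ≤ 2*x^μ ∧ 1 ≤ ⌈x^μ⌉₊ ∧
    Real.sqrt ⌈x^μ⌉₊ ≤ 2*x^(μ/2) := by
  have h1 : 1 ≤ x^μ := Real.one_le_rpow hx hμ
  have h2 := Nat.le_ceil (x^μ)
  have h3 := Nat.ceil_lt_add_one (by linarith : 0 ≤ x^μ)
  refine ⟨h2, by linarith, Nat.one_le_ceil_iff.2 (by linarith), ?_⟩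
  rw [Real.sqrt_le_left (by positivity), mul_pow, ← Real.rpow_natCast (x^(μ/2)), ← Real.rpow_mul (by linarith)]
  have : μ/2*((2:ℕ):ℝ) = μ := by push_cast; ring
  rw [this]; linarith


set_option maxHeartbeats 2000000 in
theorem big_x (δ : ℝ) (hδ : 0 < δ) (hδ1 : δ ≤ 1/8) : ∃ K x1 : ℝ, 0 < K ∧ ∀ x E F : ℝ, x1 ≤ x → 2000000 ≤ x →
      x ^ ((1 : ℝ) / 2) ≤ E → E ≤ x ^ ((3 : ℝ) / 4) →
      x ^ 2 / 8 ≤ E ^ 2 * F → E ^ 2 * F ≤ 8 * x ^ 2 → ∀ S : Finset Q4, (∀ t ∈ S, Sol E F t) →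
      (S.card : ℝ) ≤ K * x ^ (7 / 12 + 3*δ : ℝ) := by
  obtain ⟨k, x0, hform⟩ := sector_form δ hδ (by linarith)
  obtain ⟨C1, hC1, HE⟩ := sideE k δ hδ
  obtain ⟨C2, hC2, HF⟩ := sideF k δ hδ
  have hd0 : 0 < 2/δ := by positivity
  refine ⟨100 + 50*(C1*100*(7128*(1+2/δ)+3)+3) + 50*(C2*100*(7128*(1+2/δ)+3)+3), x0, by positivity, ?_⟩
  intro x E F hx0 hx hE1 hE2 hF1 hF2 S hS
  have hxp : 0 < x := by linarith
  have hx1 : 1 ≤ x := by linarith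
  have hx2 : (2:ℝ) ≤ x := by linarith
  have hp : 0 < x^(7/12+3*δ:ℝ) := by positivity
  have t1 : 0 ≤ 50*(C1*100*(7128*(1+2/δ)+3)+3) * x^(7/12+3*δ:ℝ) := by positivity
  have t2 : 0 ≤ 50*(C2*100*(7128*(1+2/δ)+3)+3) * x^(7/12+3*δ:ℝ) := by positivity
  -- basic bounds
  have hsx : (1032:ℝ) ≤ x^((1:ℝ)/2) := by
    rw [← Real.sqrt_eq_rpow]; exact Real.le_sqrt_of_sq_le (by norm_num; linarith)
  have hE40 : 40 ≤ E := by linarith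
  have hE0 : 0 < E := by linarith
  have hxE : x ≤ E^2 := by
    have := pow_le_pow_left₀ (by positivity) hE1 2
    rwa [← Real.rpow_natCast, ← Real.rpow_mul hxp.le, show (1:ℝ)/2*((2:ℕ):ℝ) = 1 by norm_num, Real.rpow_one] at this
  have hEx : E ≤ x := by
    refine hE2.trans ?_
    have := Real.rpow_le_rpow_of_exponent_le hx1 (by norm_num : (3:ℝ)/4 ≤ 1)
    rwa [Real.rpow_one] at this
  have hF8 : F ≤ 8*E^2 := by
    have h1 : x*x ≤ E^2*E^2 := mul_le_mul hxE hxE hxp.le (by positivity)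
    have h2 : E^2*F ≤ E^2*(8*E^2) := by linarith
    exact le_of_mul_le_mul_left h2 (by positivity)
  have hF8x : F ≤ 8*x := by
    have h0 : 0 ≤ F := by
      by_contra hc
      have : E^2*F < 0 := mul_neg_of_pos_of_neg (by positivity) (not_le.1 hc)
      have : 0 < x^2/8 := by positivity
      linarith
    have h1 : x*F ≤ E^2*F := mul_le_mul_of_nonneg_right hxE h0
    have h2 : x*F ≤ x*(8*x) := by linarith
    exact le_of_mul_le_mul_left h2 hxp
  have hF129 : 129 ≤ F := by
    have h1 : E^2 ≤ x^((3:ℝ)/2) := by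
      have := pow_le_pow_left₀ hE0.le hE2 2
      rwa [← Real.rpow_natCast (x^((3:ℝ)/4)), ← Real.rpow_mul hxp.le, show (3:ℝ)/4*((2:ℕ):ℝ) = 3/2 by norm_num] at this
    by_contra hc
    push Not at hc
    have h2 : E^2*F ≤ x^((3:ℝ)/2)*129 := (mul_le_mul_of_nonneg_left hc.le (by positivity)).trans (mul_le_mul_of_nonneg_right h1 (by norm_num))
    have h2' : E^2*F < E^2*129 := mul_lt_mul_of_pos_left hc (by positivity)
    have h3 : x^2 = x^((3:ℝ)/2)*x^((1:ℝ)/2) := by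
      rw [← Real.rpow_add hxp, ← Real.rpow_natCast]; norm_num
    have h4 : x^((3:ℝ)/2)*1032 ≤ x^2 := by rw [h3]; gcongr
    have h5 : E^2*129 ≤ x^((3:ℝ)/2)*129 := by gcongr
    linarith
  have hR1 : ∀ y : ℝ, 0 ≤ y → y ≤ 8*x → Real.sqrt y ≤ x := by
    intro y hy hyx
    rw [Real.sqrt_le_left hxp.le]
    nlinarith
  -- the forms
  have hforms : ∀ z : ℝ, 0 ≤ z → z ≤ 1/12 → E*F ≤ 8*x^(4/3+z:ℝ) → ∀ j : ℕ, j ≤ ⌈x^(1/2+z+δ:ℝ)⌉₊ →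
      ∃ g : Fin (k+1) × Fin (k+1) → ℤ, g ≠ 0 ∧ ∀ t : Q4, Sol E F t →
      |(t.b:ℝ) - (j/⌈x^(1/2+z+δ:ℝ)⌉₊:ℝ)*t.a| ≤ 1/⌈x^(1/2+z+δ:ℝ)⌉₊*t.a →
      ∑ i, g i * ((t.a^(k-(i.1:ℕ)) * t.b^(i.1:ℕ)) * (t.c^(k-(i.2:ℕ)) * t.d^(i.2:ℕ))) = 0 := by
    intro z hz hz1 hEF j hj
    obtain ⟨m1, m2, m3, m4⟩ := M_bound x (1/2+z+δ) hx1 (by linarith)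
    generalize ⌈x^(1/2+z+δ:ℝ)⌉₊ = M at *
    have hMR : (1:ℝ) ≤ M := by exact_mod_cast m3
    have hjR : (j:ℝ) ≤ M := by exact_mod_cast hj
    have hpow : (1032:ℝ) ≤ x^(1/2+z+δ:ℝ) := hsx.trans (Real.rpow_le_rpow_of_exponent_le hx1 (by linarith))
    have hinv : x^(-(1/2+z+δ)) = 1/x^(1/2+z+δ:ℝ) := by rw [Real.rpow_neg hxp.le]; exact (one_div _).symm
    obtain ⟨g, hg0, hg⟩ := hform x z E F (j/M) hx0 hx2 hz hz1 hEF hF1 hE40 (by linarith) (by positivity)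
      (by rw [div_le_one (by linarith)]; exact hjR)
      (by rw [hinv]; exact one_div_le_one_div_of_le (by norm_num) (by linarith))
    refine ⟨g, hg0, fun t ht hb => hg t ht (hb.trans ?_)⟩
    have ha : (2:ℝ) ≤ t.a := by exact_mod_cast ht.a1 hE40
    rw [hinv]
    gcongr
  rcases lt_or_ge E (x^(7/12:ℝ)) with hc1 | hc1
  · have h1 := triv_E E F hE40 hF8 S hS
    have h2 : x^(7/12:ℝ) ≤ x^(7/12+3*δ:ℝ) := Real.rpow_le_rpow_of_exponent_le hx1 (by linarith)
    linarith
  rcases lt_or_ge E (x^(2/3:ℝ)) with hc2 | hc2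
  · -- E side
    obtain ⟨z, hz⟩ : ∃ z, z = 2/3 - Real.log E / Real.log x := ⟨_, rfl⟩
    have hlx : 0 < Real.log x := Real.log_pos (by linarith)
    have hEz : E = x^(2/3-z:ℝ) := by
      rw [hz, Real.rpow_def_of_pos hxp]
      have : Real.log x * (2/3-(2/3-Real.log E/Real.log x)) = Real.log E := by field_simp; ring
      rw [this, Real.exp_log hE0]
    have hz0 : 0 ≤ z := by
      rw [hEz] at hc2
      have := (Real.rpow_lt_rpow_left_iff (by linarith : 1 < x)).1 hc2
      linarith
    have hz1 : z ≤ 1/12 := by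
      rw [hEz] at hc1
      have := (Real.rpow_le_rpow_left_iff (by linarith : 1 < x)).1 hc1
      linarith
    have hEF : E*F ≤ 8*x^(4/3+z:ℝ) := by
      have h1 : E*(E*F) ≤ E*(8*x^(4/3+z:ℝ)) := by
        have : E*x^(4/3+z:ℝ) = x^2 := by
          rw [hEz, ← Real.rpow_add hxp, ← Real.rpow_natCast]; congr 1; push_cast; ring
        have e : E*(E*F) = E^2*F := by ring
        rw [e]; linarith
      exact le_of_mul_le_mul_left h1 hE0
    have hf := hforms z hz0 hz1 hEF
    obtain ⟨m1, m2, m3, m4⟩ := M_bound x (1/2+z+δ) hx1 (by linarith)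
    generalize ⌈x^(1/2+z+δ:ℝ)⌉₊ = M at *
    have hMR : (1:ℝ) ≤ M := by exact_mod_cast m3
    have hRx := hR1 E hE0.le (by linarith)
    have h1 := HE E F (100*x) (Real.sqrt E) M hE40 hF8 (by nlinarith) (Real.sqrt_nonneg _) (Real.sq_sqrt hE0.le).ge (by linarith) m3 hf S hS
    have hle : x^(1/2+z+δ:ℝ) ≤ x^(7/12+δ:ℝ) := Real.rpow_le_rpow_of_exponent_le hx1 (by linarith)
    have hle2 : x^(1/2+z+δ:ℝ) ≤ x := by
      have := Real.rpow_le_rpow_of_exponent_le hx1 (by linarith : 1/2+z+δ ≤ 1)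
      rwa [Real.rpow_one] at this
    have hpow1 : 1 ≤ x^(1/2+z+δ:ℝ) := Real.one_le_rpow hx1 (by linarith)
    have h2 := final_num x δ C1 (Real.sqrt E) M hx2 hδ (by linarith) hC1 (Real.sqrt_nonneg _) m3 (by nlinarith) (by linarith) (by
      have e : Real.sqrt E = x^((2/3-z)/2:ℝ) := by
        rw [Real.sqrt_eq_rpow, hEz, ← Real.rpow_mul hxp.le]; congr 1; ring
      have : Real.sqrt E * Real.sqrt M ≤ x^((2/3-z)/2:ℝ)*(2*x^((1/2+z+δ)/2:ℝ)) := by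
        rw [e]; gcongr
      refine this.trans ?_
      have e2 : x^((2/3-z)/2:ℝ)*(2*x^((1/2+z+δ)/2:ℝ)) = 2*x^(7/12+δ/2:ℝ) := by
        rw [mul_left_comm, ← Real.rpow_add hxp]; congr 2; ring
      rw [e2]
      have : x^(7/12+δ/2:ℝ) ≤ x^(7/12+δ:ℝ) := Real.rpow_le_rpow_of_exponent_le hx1 (by linarith)
      have : 0 < x^(7/12+δ:ℝ) := by positivity
      linarith)
    linarith
  · -- F side
    have hx43 : x^(2/3:ℝ)*x^(4/3:ℝ) = x^2 := by
      rw [← Real.rpow_add hxp, ← Real.rpow_natCast]; congr 1; norm_num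
    have hF0 : 0 < F := by linarith
    have hEF : E*F ≤ 8*x^(4/3+0:ℝ) := by
      rw [add_zero]
      have h1 : x^(2/3:ℝ)*(E*F) ≤ E*(E*F) := by gcongr
      have h2 : x^(2/3:ℝ)*(E*F) ≤ x^(2/3:ℝ)*(8*x^(4/3:ℝ)) := by linarith
      exact le_of_mul_le_mul_left h2 (by positivity)
    have hFx : F ≤ 8*x^(2/3:ℝ) := by
      have h1 : x^(2/3:ℝ)*F ≤ E*F := by gcongr
      have h2 : x^(2/3:ℝ)*x^(2/3:ℝ) = x^(4/3:ℝ) := by rw [← Real.rpow_add hxp]; congr 1; norm_num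
      have h3 : x^(2/3:ℝ)*F ≤ x^(2/3:ℝ)*(8*x^(2/3:ℝ)) := by rw [add_zero] at hEF; linarith
      exact le_of_mul_le_mul_left h3 (by positivity)
    have hf := hforms 0 le_rfl (by norm_num) hEF
    obtain ⟨m1, m2, m3, m4⟩ := M_bound x (1/2+0+δ) hx1 (by linarith)
    generalize ⌈x^(1/2+0+δ:ℝ)⌉₊ = M at *
    simp only [add_zero] at m1 m2 m4
    have hMR : (1:ℝ) ≤ M := by exact_mod_cast m3
    have hRx := hR1 F hF0.le hF8x
    have hR2 : 2 ≤ Real.sqrt F := Real.le_sqrt_of_sq_le (by linarith)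
    have hpow : (1032:ℝ) ≤ x^(1/2+δ:ℝ) := hsx.trans (Real.rpow_le_rpow_of_exponent_le hx1 (by linarith))
    have hle3 : x^(1/2+δ:ℝ) ≤ x^(2/3:ℝ) := Real.rpow_le_rpow_of_exponent_le hx1 (by linarith)
    have h1 := HF E F (100*x) (Real.sqrt F) M hE40 hF129 (by nlinarith) (Real.sqrt_nonneg _) (Real.sq_sqrt hF0.le).ge (by linarith)
      (by have : (8:ℝ) ≤ M := by linarith
          exact_mod_cast this)
      (by have : E*2 ≤ E*Real.sqrt F := by gcongr
          linarith) hf S hS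
    have hle : x^(1/2+δ:ℝ) ≤ x^(7/12+δ:ℝ) := Real.rpow_le_rpow_of_exponent_le hx1 (by linarith)
    have hle2 : x^(1/2+δ:ℝ) ≤ x := by
      have := Real.rpow_le_rpow_of_exponent_le hx1 (by linarith : 1/2+δ ≤ 1)
      rwa [Real.rpow_one] at this
    have h2 := final_num x δ C2 (Real.sqrt F) M hx2 hδ (by linarith) hC2 (Real.sqrt_nonneg _) m3 (by nlinarith) (by linarith) (by
      have e : Real.sqrt F ≤ 3*x^(1/3:ℝ) := by
        rw [Real.sqrt_le_left (by positivity), mul_pow, ← Real.rpow_natCast (x^(1/3:ℝ)), ← Real.rpow_mul hxp.le,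
          show (1/3:ℝ)*((2:ℕ):ℝ) = 2/3 by norm_num]
        have : 0 < x^(2/3:ℝ) := by positivity
        linarith
      have : Real.sqrt F * Real.sqrt M ≤ (3*x^(1/3:ℝ))*(2*x^((1/2+δ)/2:ℝ)) := by
        gcongr
      refine this.trans ?_
      have e2 : (3*x^(1/3:ℝ))*(2*x^((1/2+δ)/2:ℝ)) = 6*x^(7/12+δ/2:ℝ) := by
        have : x^(7/12+δ/2:ℝ) = x^(1/3:ℝ)*x^((1/2+δ)/2:ℝ) := by rw [← Real.rpow_add hxp]; congr 1; ring
        rw [this]; ring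
      rw [e2]
      have : x^(7/12+δ/2:ℝ) ≤ x^(7/12+δ:ℝ) := Real.rpow_le_rpow_of_exponent_le hx1 (by linarith)
      linarith)
    linarith

theorem MEF_critical_range_bound (ε : ℝ) (hε : 0 < ε) :
    ∃ C : ℝ, ∀ x E F : ℝ, 2 ≤ x →
      x ^ ((1 : ℝ) / 2) ≤ E → E ≤ x ^ ((3 : ℝ) / 4) →
      x ^ 2 / 8 ≤ E ^ 2 * F → E ^ 2 * F ≤ 8 * x ^ 2 →
      (MEF E F : ℝ) ≤ C * x ^ (7 / 12 + ε : ℝ) := by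
  obtain ⟨δ, hδ⟩ : ∃ δ, δ = min ε 1 / 8 := ⟨_, rfl⟩
  have hm0 : 0 < min ε 1 := lt_min hε one_pos
  have hδ0 : 0 < δ := by rw [hδ]; positivity
  have hδ1 : δ ≤ 1/8 := by rw [hδ]; linarith [min_le_right ε 1]
  have hδε : 8*δ ≤ ε := by rw [hδ]; linarith [min_le_left ε 1]
  obtain ⟨K, x1, hK, H⟩ := big_x δ hδ0 hδ1
  obtain ⟨X, hX⟩ : ∃ X, X = max x1 2000000 := ⟨_, rfl⟩
  obtain ⟨N, hN⟩ := exists_nat_ge (8*X)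
  refine ⟨K + (2*N+1)^4, ?_⟩
  intro x E F hx hE1 hE2 hF1 hF2
  have hx1 : 1 ≤ x := by linarith
  have hxp : 0 < x := by linarith
  have hpow : 1 ≤ x^(7/12+ε:ℝ) := Real.one_le_rpow hx1 (by linarith)
  refine MEF_le E F _ fun S hS => ?_
  rcases le_total X x with hxX | hxX
  · have h1 := H x E F (by rw [hX] at hxX; exact (le_max_left _ _).trans hxX) (by rw [hX] at hxX; exact (le_max_right _ _).trans hxX)
      hE1 hE2 hF1 hF2 S hS
    have h2 : x^(7/12+3*δ:ℝ) ≤ x^(7/12+ε:ℝ) := Real.rpow_le_rpow_of_exponent_le hx1 (by linarith)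
    have h3 := mul_le_mul_of_nonneg_left h2 hK.le
    have h4 : (0:ℝ) ≤ (2*N+1)^4*x^(7/12+ε:ℝ) := by positivity
    linarith
  · have hE0 : 0 < E := lt_of_lt_of_le (by positivity) hE1
    have hxE : x ≤ E^2 := by
      have := pow_le_pow_left₀ (by positivity) hE1 2
      rwa [← Real.rpow_natCast, ← Real.rpow_mul hxp.le, show (1:ℝ)/2*((2:ℕ):ℝ) = 1 by norm_num, Real.rpow_one] at this
    have hEx : E ≤ x := by
      refine hE2.trans ?_
      have := Real.rpow_le_rpow_of_exponent_le hx1 (by norm_num : (3:ℝ)/4 ≤ 1)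
      rwa [Real.rpow_one] at this
    have hF8x : F ≤ 8*x := by
      have h0 : 0 ≤ F := by
        by_contra hc
        have : E^2*F < 0 := mul_neg_of_pos_of_neg (by positivity) (not_le.1 hc)
        have : 0 < x^2/8 := by positivity
        linarith
      have h1 : x*F ≤ E^2*F := mul_le_mul_of_nonneg_right hxE h0
      have h2 : x*F ≤ x*(8*x) := by linarith
      exact le_of_mul_le_mul_left h2 hxp
    have hN1 : (1:ℝ) ≤ N := by linarith
    have hNN : (N:ℝ) ≤ (N:ℝ)^2 := by rw [sq]; exact le_mul_of_one_le_left (by linarith) hN1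
    have h1 := triv_card E F N (by linarith) (by linarith) S hS
    have h2 : (2*(N:ℝ)+1)^4 ≤ (2*N+1)^4*x^(7/12+ε:ℝ) := le_mul_of_one_le_right (by positivity) hpow
    have h3 : 0 ≤ K*x^(7/12+ε:ℝ) := by positivity
    linarith
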